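/- Let n ≥ 2, let 1 < k ≤ n and let α > 0. Let u : ℝⁿ → ℝ be a smooth entire k-convex solution of σ_k(D²u) + α σ_{k−1}(D²u) = 1 on all of ℝⁿ, and suppose u has quadratic growth: there exist positive constants c, b and R such that u(x) ≥ c|x|² − b for all |x| ≥ R. Then u is a quadratic polynomial, i.e. there exist a symmetric n×n real matrix A, a vector p ∈ ℝⁿ and a constant q ∈ ℝ such that u(x) = (1/2)⟨Ax, x⟩ + ⟨p, x⟩ + q for all x ∈ ℝⁿ. -/

import Mathlib

open scoped BigOperators

/-- `sigmaMat k A` is the `k`-th elementary symmetric function of the eigenvalues of the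
symmetric matrix `A`, computed as the sum of all `k × k` principal minors of `A`. -/
noncomputable def sigmaMat {n : ℕ} (k : ℕ) (A : Matrix (Fin n) (Fin n) ℝ) : ℝ :=
  ∑ s ∈ Finset.univ.powersetCard k,
    Matrix.det (fun i j : {x : Fin n // x ∈ s} => A i.1 j.1)

/-- The Hessian matrix `D²u` of `u : ℝⁿ → ℝ` at a point `x`. -/
noncomputable def hessian {n : ℕ} (u : EuclideanSpace ℝ (Fin n) → ℝ)
    (x : EuclideanSpace ℝ (Fin n)) : Matrix (Fin n) (Fin n) ℝ :=
  fun i j => iteratedFDeriv ℝ 2 u x ![EuclideanSpace.single i 1, EuclideanSpace.single j 1]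

section EsymPoly
open Polynomial

theorem splits_derivative_of_splits {p : ℝ[X]} (hp : p.Splits) : (derivative p).Splits := by
  rw [splits_iff_card_roots] at hp ⊢
  apply le_antisymm (card_roots' _)
  have h1 := card_roots_le_derivative p
  have h2 := natDegree_derivative_le p
  omega

theorem splits_iterate_derivative {p : ℝ[X]} (hp : p.Splits) (m : ℕ) :
    (derivative^[m] p).Splits := by
  induction m with
  | zero => simpa using hp
  | succ m ih =>
    rw [Function.iterate_succ_apply']
    exact splits_derivative_of_splits ih

theorem laguerre_of_splits {p : ℝ[X]} (hp : p.Splits) (t : ℝ) :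
    p.eval t * (derivative (derivative p)).eval t ≤ (derivative p).eval t ^ 2 := by
  rw [hp.eq_prod_roots]
  generalize p.leadingCoeff = c
  induction p.roots using Multiset.induction_on with
  | empty => simp
  | cons a s ih =>
    set h := C c * (s.map (X - C ·)).prod with hh
    have e : C c * ((a ::ₘ s).map (X - C ·)).prod = (X - C a) * h := by
      rw [Multiset.map_cons, Multiset.prod_cons, hh]; ring
    rw [e]
    simp only [derivative_mul, derivative_sub, derivative_X, derivative_C, derivative_add,
      sub_zero, one_mul, eval_add, eval_mul, eval_sub, eval_X, eval_C]
    nlinarith [sq_nonneg (eval t h), mul_nonneg (sq_nonneg (t - a)) (sub_nonneg.2 ih)]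

end EsymPoly

/-- Elementary symmetric function of degree `j` of the variables indexed by `T`. -/
def esym {ι : Type*} (T : Finset ι) (x : ι → ℝ) (j : ℕ) : ℝ :=
  ∑ s ∈ T.powersetCard j, ∏ i ∈ s, x i

section Esym
variable {ι : Type*}

@[simp] theorem esym_zero (T : Finset ι) (x : ι → ℝ) : esym T x 0 = 1 := by
  simp [esym]

theorem esym_one (T : Finset ι) (x : ι → ℝ) : esym T x 1 = ∑ i ∈ T, x i := by
  simp [esym, Finset.powersetCard_one]

theorem esym_of_card_lt {T : Finset ι} (x : ι → ℝ) {j : ℕ} (h : T.card < j) :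
    esym T x j = 0 := by
  simp [esym, Finset.powersetCard_eq_empty.2 h]

theorem esym_insert [DecidableEq ι] {T : Finset ι} {i : ι} (hi : i ∉ T) (x : ι → ℝ) (j : ℕ) :
    esym (insert i T) x (j + 1) = esym T x (j + 1) + x i * esym T x j := by
  unfold esym
  rw [Finset.powersetCard_succ_insert hi, Finset.sum_union, Finset.mul_sum]
  · congr 1
    rw [Finset.sum_image]
    · refine Finset.sum_congr rfl fun s hs => ?_
      rw [Finset.prod_insert]
      exact fun h => hi ((Finset.mem_powersetCard.1 hs).1 h)
    · intro s hs t ht hst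
      have h1 : i ∉ s := fun h => hi ((Finset.mem_powersetCard.1 hs).1 h)
      have h2 : i ∉ t := fun h => hi ((Finset.mem_powersetCard.1 ht).1 h)
      rw [← Finset.erase_insert h1, ← Finset.erase_insert h2]
      exact congrArg (fun r => r.erase i) hst
  · rw [Finset.disjoint_left]
    intro s hs hs'
    obtain ⟨t, -, rfl⟩ := Finset.mem_image.1 hs'
    exact hi ((Finset.mem_powersetCard.1 hs).1 (Finset.mem_insert_self i t))

theorem esym_erase [DecidableEq ι] {T : Finset ι} {i : ι} (hi : i ∈ T) (x : ι → ℝ) (j : ℕ) :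
    esym T x (j + 1) = esym (T.erase i) x (j + 1) + x i * esym (T.erase i) x j := by
  conv_lhs => rw [← Finset.insert_erase hi]
  exact esym_insert (Finset.notMem_erase i T) x j

open Polynomial in
theorem newton_esym (T : Finset ι) (x : ι → ℝ) (l : ℕ) :
    ((T.card : ℝ) + 1) * (esym T x l * esym T x (l + 2)) ≤ T.card * esym T x (l + 1) ^ 2 := by
  rcases lt_or_ge T.card (l + 2) with h | h
  · rw [esym_of_card_lt x h]; simp; positivity
  obtain ⟨m, hm⟩ := Nat.exists_eq_add_of_le h
  set p : ℝ[X] := ∏ i ∈ T, (X + C (x i)) with hp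
  have hs : p.Splits := Splits.prod fun i _ => Splits.X_add_C (x i)
  have hc : ∀ k ≤ T.card, p.coeff k = esym T x (T.card - k) := fun k hk => by
    rw [hp, Finset.prod_X_add_C_coeff _ _ hk]; rfl
  have hL := laguerre_of_splits (splits_iterate_derivative hs m) 0
  rw [← Function.iterate_succ_apply' derivative, ← Function.iterate_succ_apply' derivative,
    ← coeff_zero_eq_eval_zero, ← coeff_zero_eq_eval_zero, ← coeff_zero_eq_eval_zero,
    coeff_iterate_derivative, coeff_iterate_derivative, coeff_iterate_derivative] at hL
  simp only [zero_add, Nat.descFactorial_self, nsmul_eq_mul] at hL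
  rw [hc m (by omega), hc _ (by omega), hc _ (by omega), show T.card - m = l + 2 by omega,
    show T.card - (m.succ) = l + 1 by omega, show T.card - m.succ.succ = l by omega,
    Nat.factorial_succ, Nat.factorial_succ] at hL
  push_cast at hL
  have hf : (0 : ℝ) < (m.factorial : ℝ) := by exact_mod_cast m.factorial_pos
  set a := esym T x l
  set b := esym T x (l + 1)
  set c := esym T x (l + 2)
  have h3 : ((m : ℝ) + 2) * (a * c) ≤ (m + 1) * b ^ 2 := by
    have : ((m.factorial : ℝ) ^ 2 * (m + 1)) * (((m : ℝ) + 2) * (a * c)) ≤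
      ((m.factorial : ℝ) ^ 2 * (m + 1)) * ((m + 1) * b ^ 2) := by
      have e : ((m : ℝ) + 1 + 1) = m + 2 := by ring
      nlinarith
    exact le_of_mul_le_mul_left this (by positivity)
  have hN : (T.card : ℝ) = l + 2 + m := by rw [hm]; push_cast; ring
  rw [hN]
  have hl : (0 : ℝ) ≤ l := by positivity
  have hm0 : (0 : ℝ) ≤ m := by positivity
  -- compare `(m+1)/(m+2)` with `N/(N+1)`
  rcases le_or_gt (a * c) 0 with h0 | h0
  · have h1 := mul_nonneg (show (0 : ℝ) ≤ l + 2 + m by positivity) (sq_nonneg b)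
    nlinarith
  · have : ((m : ℝ) + 1) * ((l + 2 + m + 1) * (a * c)) ≤ (m + 1) * ((l + 2 + m) * b ^ 2) := by
      have := mul_le_mul_of_nonneg_left h3 (show (0 : ℝ) ≤ l + 2 + m by positivity)
      nlinarith [mul_nonneg (show (0 : ℝ) ≤ l + 1 by positivity) h0.le]
    exact le_of_mul_le_mul_left this (by positivity)

/-- The weak form of Newton's inequality. -/
theorem newton_esym' (T : Finset ι) (x : ι → ℝ) (l : ℕ) :
    esym T x l * esym T x (l + 2) ≤ esym T x (l + 1) ^ 2 := by
  have h := newton_esym T x l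
  have hN : (0 : ℝ) ≤ T.card := by positivity
  rcases le_or_gt (esym T x l * esym T x (l + 2)) 0 with h0 | h0
  · nlinarith [sq_nonneg (esym T x (l + 1))]
  · by_contra! hc
    nlinarith

/-- The Garding cone in the variables indexed by `T`. -/
def garding (T : Finset ι) (k : ℕ) (x : ι → ℝ) : Prop := ∀ j ≤ k, 0 < esym T x j

theorem garding.mono {T : Finset ι} {k l : ℕ} {x : ι → ℝ} (h : garding T k x) (hl : l ≤ k) :
    garding T l x := fun j hj => h j (hj.trans hl)

theorem garding.erase [DecidableEq ι] {T : Finset ι} {k : ℕ} {x : ι → ℝ}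
    (h : garding T (k + 1) x) {i : ι} (hi : i ∈ T) : garding (T.erase i) k x := by
  intro j
  induction j with
  | zero => intro _; simp
  | succ j ih =>
    intro hj
    have h1 := ih (by omega)
    by_contra! hc
    have e1 := esym_erase hi x j
    have e2 := esym_erase hi x (j + 1)
    have p1 := h (j + 1) (by omega)
    have p2 := h (j + 2) (by omega)
    have hN := newton_esym' (T.erase i) x j
    rw [e1] at p1
    rw [show j + 2 = j + 1 + 1 by rfl, e2] at p2
    rw [show j + 2 = j + 1 + 1 by rfl] at hN
    set a := esym (T.erase i) x j
    set b := esym (T.erase i) x (j + 1)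
    set c := esym (T.erase i) x (j + 1 + 1)
    nlinarith

theorem esym_sum_erase [DecidableEq ι] (T : Finset ι) (x : ι → ℝ) (j : ℕ) :
    ∑ i ∈ T, esym (T.erase i) x j = ((T.card : ℝ) - j) * esym T x j := by
  induction T using Finset.induction_on generalizing j with
  | empty => 
    rcases j with _ | j
    · simp
    · rw [esym_of_card_lt x (by simp)]; simp
  | insert a T ha ih =>
    rw [Finset.sum_insert ha, Finset.erase_insert ha, Finset.card_insert_of_notMem ha]
    rcases j with _ | j
    · simp; ring
    · have : ∑ i ∈ T, esym ((insert a T).erase i) x (j + 1) =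
          ∑ i ∈ T, (esym (T.erase i) x (j + 1) + x a * esym (T.erase i) x j) := by
        refine Finset.sum_congr rfl fun i hi => ?_
        have hne : a ≠ i := fun h => ha (h ▸ hi)
        rw [Finset.erase_insert_of_ne hne, esym_insert]
        exact fun h => ha (Finset.mem_of_mem_erase h)
      rw [this, Finset.sum_add_distrib, ← Finset.mul_sum, ih, ih, esym_insert ha]
      push_cast; ring

theorem esym_sum_mul_erase [DecidableEq ι] (T : Finset ι) (x : ι → ℝ) (j : ℕ) :
    ∑ i ∈ T, x i * esym (T.erase i) x j = (j + 1) * esym T x (j + 1) := by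
  have h : ∀ i ∈ T, x i * esym (T.erase i) x j = esym T x (j + 1) - esym (T.erase i) x (j + 1) :=
    fun i hi => by rw [esym_erase hi x j]; ring
  rw [Finset.sum_congr rfl h, Finset.sum_sub_distrib, esym_sum_erase]
  simp; ring

end Esym

section Esym2
variable {ι : Type*} [DecidableEq ι]

theorem titu_ineq {a b c d e : ℝ} (hc : 0 < c) (hd : 0 < d) (he : c + d ≤ e) :
    (a + b) ^ 2 / e ≤ a ^ 2 / c + b ^ 2 / d := by
  have h1 : (a + b) ^ 2 / e ≤ (a + b) ^ 2 / (c + d) :=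
    div_le_div_of_nonneg_left (sq_nonneg _) (by positivity) he
  refine h1.trans ?_
  rw [div_add_div _ _ hc.ne' hd.ne', div_le_div_iff₀ (by positivity) (by positivity)]
  nlinarith [mul_pos hc hd, sq_nonneg (a * d - b * c), mul_nonneg (sq_nonneg (a * d - b * c)) hc.le]

theorem esym_quotient_identity (T : Finset ι) (x : ι → ℝ) (k : ℕ) (h : esym T x (k + 1) ≠ 0)
    (h' : ∀ i ∈ T, esym (T.erase i) x k ≠ 0) :
    ((k : ℝ) + 2) * (esym T x (k + 2) / esym T x (k + 1)) =
      ∑ i ∈ T, (x i - x i ^ 2 /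
        (x i + esym (T.erase i) x (k + 1) / esym (T.erase i) x k)) := by
  have e := esym_sum_mul_erase T x (k + 1)
  push_cast at e
  rw [mul_div_assoc', show ((k : ℝ) + 2) = k + 1 + 1 by ring, show k + 2 = k + 1 + 1 by rfl, ← e,
    Finset.sum_div]
  refine Finset.sum_congr rfl fun i hi => ?_
  have h2 := h' i hi
  have e2 := esym_erase hi x k
  have e3 : x i + esym (T.erase i) x (k + 1) / esym (T.erase i) x k =
      esym T x (k + 1) / esym (T.erase i) x k := by
    rw [e2]; field_simp; ring
  rw [e3, e2]
  rw [e2] at h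
  field_simp
  ring

theorem garding.add_and_quotient (k : ℕ) : ∀ (T : Finset ι) (x y : ι → ℝ),
    garding T (k + 1) x → garding T (k + 1) y → garding T (k + 1) (x + y) ∧
      esym T x (k + 1) / esym T x k + esym T y (k + 1) / esym T y k ≤
        esym T (x + y) (k + 1) / esym T (x + y) k := by
  induction k with
  | zero =>
    intro T x y hx hy
    have e : esym T (x + y) 1 = esym T x 1 + esym T y 1 := by
      simp [esym_one, Finset.sum_add_distrib]
    have h1 := hx 1 le_rfl
    have h2 := hy 1 le_rfl
    constructor
    · intro j hj
      interval_cases j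
      · simp
      · rw [e]; positivity
    · simp [e]
  | succ k ih =>
    intro T x y hx hy
    have hz : garding T (k + 1) (x + y) := (ih T x y (hx.mono (by omega)) (hy.mono (by omega))).1
    have key : ((k : ℝ) + 2) * (esym T x (k + 2) / esym T x (k + 1) +
        esym T y (k + 2) / esym T y (k + 1)) ≤
        (k + 2) * (esym T (x + y) (k + 2) / esym T (x + y) (k + 1)) := by
      have hxi : ∀ i ∈ T, garding (T.erase i) (k + 1) x := fun i hi => hx.erase hi
      have hyi : ∀ i ∈ T, garding (T.erase i) (k + 1) y := fun i hi => hy.erase hi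
      have hzi := fun i hi => ih (T.erase i) x y (hxi i hi) (hyi i hi)
      rw [mul_add, esym_quotient_identity T x k (hx _ (by omega)).ne'
          (fun i hi => (hxi i hi k (by omega)).ne'),
        esym_quotient_identity T y k (hy _ (by omega)).ne'
          (fun i hi => (hyi i hi k (by omega)).ne'),
        esym_quotient_identity T (x + y) k (hz _ (by omega)).ne'
          (fun i hi => ((hzi i hi).1 k (by omega)).ne'), ← Finset.sum_add_distrib]
      refine Finset.sum_le_sum fun i hi => ?_
      have pos : ∀ w : ι → ℝ, garding T (k + 2) w → garding (T.erase i) (k + 1) w →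
          0 < w i + esym (T.erase i) w (k + 1) / esym (T.erase i) w k := by
        intro w h1 h2
        have h3 := h2 k (by omega)
        have h4 := h1 (k + 1) (by omega)
        rw [esym_erase hi] at h4
        have : w i + esym (T.erase i) w (k + 1) / esym (T.erase i) w k =
          (esym (T.erase i) w (k + 1) + w i * esym (T.erase i) w k) / esym (T.erase i) w k := by
          field_simp; ring
        rw [this]; positivity
      have t := titu_ineq (a := x i) (b := y i) (pos x hx (hxi i hi)) (pos y hy (hyi i hi))
        (e := (x + y) i + esym (T.erase i) (x + y) (k + 1) / esym (T.erase i) (x + y) k)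
        (by have := (hzi i hi).2; simp only [Pi.add_apply]; linarith)
      simp only [Pi.add_apply] at t ⊢
      linarith
    have key' := le_of_mul_le_mul_left key (by positivity)
    refine ⟨fun j hj => ?_, key'⟩
    rcases Nat.lt_or_ge j (k + 2) with h | h
    · exact hz j (by omega)
    · obtain rfl : j = k + 2 := by omega
      have h1 := hz (k + 1) le_rfl
      have p1 := div_pos (hx (k + 2) le_rfl) (hx (k + 1) (by omega))
      have p2 := div_pos (hy (k + 2) le_rfl) (hy (k + 1) (by omega))
      have : 0 < esym T (x + y) (k + 2) / esym T (x + y) (k + 1) := by linarith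
      exact (div_pos_iff_of_pos_right h1).1 this

theorem esym_smul (T : Finset ι) (c : ℝ) (x : ι → ℝ) (j : ℕ) :
    esym T (c • x) j = c ^ j * esym T x j := by
  unfold esym
  rw [Finset.mul_sum]
  refine Finset.sum_congr rfl fun s hs => ?_
  simp [Finset.prod_mul_distrib, (Finset.mem_powersetCard.1 hs).2]

/-- Midpoint log-concavity of the elementary symmetric functions on the Garding cone. -/
theorem garding.mul_le_sq {T : Finset ι} {k : ℕ} {x y z : ι → ℝ} (hx : garding T k x)
    (hy : garding T k y) (hz : x + y = (2 : ℝ) • z) (hzg : garding T k z) :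
    ∀ j ≤ k, esym T x j * esym T y j ≤ esym T z j ^ 2 := by
  intro j
  induction j with
  | zero => simp
  | succ j ih =>
    intro hj
    have h := (garding.add_and_quotient j T x y (hx.mono hj) (hy.mono hj)).2
    rw [hz, esym_smul, esym_smul] at h
    have x0 := hx j (by omega)
    have x1 := hx (j + 1) hj
    have y0 := hy j (by omega)
    have y1 := hy (j + 1) hj
    have z0 := hzg j (by omega)
    have z1 := hzg (j + 1) hj
    have e : (2 : ℝ) ^ (j + 1) * esym T z (j + 1) / (2 ^ j * esym T z j) =
        2 * (esym T z (j + 1) / esym T z j) := by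
      field_simp; ring
    rw [e] at h
    set p := esym T x (j + 1) / esym T x j with hp
    set q := esym T y (j + 1) / esym T y j with hq
    set r := esym T z (j + 1) / esym T z j with hr
    have ep : esym T x (j + 1) = p * esym T x j := by rw [hp]; field_simp
    have eq : esym T y (j + 1) = q * esym T y j := by rw [hq]; field_simp
    have er : esym T z (j + 1) = r * esym T z j := by rw [hr]; field_simp
    have p0 : 0 < p := by rw [hp]; positivity
    have q0 : 0 < q := by rw [hq]; positivity
    have r0 : 0 < r := by rw [hr]; positivity
    have hpq : p * q ≤ r ^ 2 := by nlinarith [sq_nonneg (p - q)]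
    rw [ep, eq, er, mul_mul_mul_comm, mul_pow]
    exact mul_le_mul hpq (ih (by omega)) (by positivity) (by positivity)

theorem esym_continuous (T : Finset ι) (j : ℕ) : Continuous fun x : ι → ℝ => esym T x j := by
  unfold esym; fun_prop

open Filter Topology in
theorem garding.eventually {T : Finset ι} {k : ℕ} {x : ι → ℝ} (hx : garding T k x) :
    ∀ᶠ y in 𝓝 x, garding T k y := by
  have : ∀ j ∈ Finset.range (k + 1), ∀ᶠ y in 𝓝 x, 0 < esym T y j := fun j hj =>
    ((esym_continuous T j).tendsto x).eventually
      (lt_mem_nhds (hx j (by simpa [Nat.lt_succ_iff] using hj)))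
  filter_upwards [(Filter.eventually_all_finset _).2 this] with y hy j hj
  exact hy j (by simpa [Nat.lt_succ_iff] using hj)

open Filter Topology in
theorem garding.eventually_mul_le_sq {T : Finset ι} {k : ℕ} {x : ι → ℝ} (hx : garding T k x)
    (b : ι → ℝ) :
    ∀ᶠ s : ℝ in 𝓝 0, esym T (x + s • b) k * esym T (x - s • b) k ≤ esym T x k ^ 2 := by
  have h1 : Tendsto (fun s : ℝ => x + s • b) (𝓝 0) (𝓝 x) := by
    have : Continuous fun s : ℝ => x + s • b := by fun_prop
    simpa using this.tendsto 0
  have h2 : Tendsto (fun s : ℝ => x - s • b) (𝓝 0) (𝓝 x) := by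
    have : Continuous fun s : ℝ => x - s • b := by fun_prop
    simpa using this.tendsto 0
  filter_upwards [h1.eventually hx.eventually, h2.eventually hx.eventually] with s hs hs'
  exact hs.mul_le_sq hs' (by ext i; simp; ring) hx k le_rfl

end Esym2

/-- Elementary symmetric functions of the variables indexed by `T` and one more variable `α`. -/
noncomputable def hsym {ι : Type*} (α : ℝ) (T : Finset ι) (x : ι → ℝ) (j : ℕ) : ℝ :=
  esym (Finset.insertNone T) (fun o => o.elim α x) j

section Hsym
variable {ι : Type*} [DecidableEq ι] {α : ℝ}

theorem insertNone_erase_none (T : Finset ι) :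
    (Finset.insertNone T).erase none = T.map Function.Embedding.some := by
  ext o; cases o <;> simp

theorem insertNone_erase_some (T : Finset ι) (i : ι) :
    (Finset.insertNone T).erase (some i) = Finset.insertNone (T.erase i) := by
  ext o; cases o <;> simp

theorem esym_map {κ : Type*} (f : ι ↪ κ) (T : Finset ι) (x : κ → ℝ) (j : ℕ) :
    esym (T.map f) x j = esym T (fun i => x (f i)) j := by
  unfold esym
  rw [Finset.powersetCard_map, Finset.sum_map]
  simp

theorem hsym_zero (T : Finset ι) (x : ι → ℝ) : hsym α T x 0 = 1 := by simp [hsym]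

theorem hsym_succ (T : Finset ι) (x : ι → ℝ) (j : ℕ) :
    hsym α T x (j + 1) = esym T x (j + 1) + α * esym T x j := by
  unfold hsym
  rw [esym_erase (i := none) (by simp), insertNone_erase_none, esym_map, esym_map]
  rfl

theorem hsym_erase {T : Finset ι} {i : ι} (hi : i ∈ T) (x : ι → ℝ) (j : ℕ) :
    hsym α T x (j + 1) = hsym α (T.erase i) x (j + 1) + x i * hsym α (T.erase i) x j := by
  unfold hsym
  rw [esym_erase (i := some i) (by simpa using hi), insertNone_erase_some]
  rfl

theorem garding.hsym_pos {T : Finset ι} {x : ι → ℝ} {k : ℕ} (hα : 0 ≤ α) (h : garding T k x) :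
    ∀ j ≤ k, 0 < hsym α T x j := by
  intro j hj
  rcases j with _ | j
  · simp [hsym_zero]
  · rw [hsym_succ]
    have := h (j + 1) hj
    have := h j (by omega)
    positivity

open Filter Topology in
theorem garding.hsym_eventually {T : Finset ι} {x : ι → ℝ} {k : ℕ} (hα : 0 ≤ α)
    (h : garding T k x) (b : ι → ℝ) :
    ∀ᶠ s : ℝ in 𝓝 0, hsym α T (x + s • b) k * hsym α T (x - s • b) k ≤ hsym α T x k ^ 2 := by
  have hg : garding (Finset.insertNone T) k (fun o => o.elim α x) := h.hsym_pos hα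
  filter_upwards [hg.eventually_mul_le_sq (fun o => o.elim 0 b)] with s hs
  convert hs using 2
  · unfold hsym; congr 1; ext o; cases o <;> simp
  · unfold hsym; congr 1; ext o; cases o <;> simp
  · rfl

end Hsym

section Minor
variable {ι : Type*} [Fintype ι] [DecidableEq ι]

/-- The principal minor of `A` indexed by `s`, as the determinant of the matrix obtained from `A`
by replacing the rows outside `s` by those of the identity. -/
noncomputable def pminor (s : Finset ι) (A : ι → ι → ℝ) : ℝ :=
  Matrix.detRowAlternating (s.piecewise A fun i => Pi.single i 1)

theorem pminor_eq_det_submatrix (s : Finset ι) (A : ι → ι → ℝ) :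
    pminor s A = ((Matrix.of A).submatrix (↑) (↑) : Matrix s s ℝ).det := by
  rw [← Matrix.det_piecewise_one_eq_submatrix_det]
  unfold pminor
  change Matrix.det _ = _
  congr 1
  ext i j
  by_cases h : i ∈ s
  · simp [Finset.piecewise, h, Matrix.row]
  · simp [Finset.piecewise, h, Matrix.row, Matrix.one_apply, Pi.single_apply, eq_comm]

theorem pminor_empty (A : ι → ι → ℝ) : pminor ∅ A = 1 := by
  rw [pminor_eq_det_submatrix]; simp

theorem pminor_singleton (i : ι) (A : ι → ι → ℝ) : pminor {i} A = A i i := by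
  rw [pminor_eq_det_submatrix]
  let : Unique {x // x ∈ ({i} : Finset ι)} := ⟨⟨⟨i, by simp⟩⟩, fun a =>
    Subtype.ext (Finset.mem_singleton.1 a.2)⟩
  rw [Matrix.det_unique]
  rfl

theorem pminor_pair {i j : ι} (hij : i ≠ j) (A : ι → ι → ℝ) :
    pminor {i, j} A = A i i * A j j - A i j * A j i := by
  rw [pminor_eq_det_submatrix]
  let e : Fin 2 ≃ {x // x ∈ ({i, j} : Finset ι)} :=
    { toFun := ![⟨i, by simp⟩, ⟨j, by simp⟩]
      invFun := fun x => if x.1 = i then 0 else 1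
      left_inv := fun a => by fin_cases a <;> simp [hij.symm]
      right_inv := fun ⟨x, hx⟩ => by
        simp only [Finset.mem_insert, Finset.mem_singleton] at hx
        rcases hx with rfl | rfl
        · simp
        · simp [hij.symm] }
  rw [← Matrix.det_submatrix_equiv_self e, Matrix.det_fin_two]
  rfl

theorem pminor_add_diagonal (s : Finset ι) (d : ι → ℝ) (B : ι → ι → ℝ) :
    pminor s (fun i => d i • Pi.single i 1 + B i) =
      ∑ S ∈ s.powerset, (∏ i ∈ s \ S, d i) * pminor S B := by
  unfold pminor
  have h1 : (s.piecewise (fun i => d i • (Pi.single i 1 : ι → ℝ) + B i) fun i => Pi.single i 1) =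
      s.piecewise B 0 + fun i => (if i ∈ s then d i else 1) • (Pi.single i 1 : ι → ℝ) := by
    funext i
    by_cases h : i ∈ s
    · simp [h, add_comm]
    · simp [h]
  rw [h1, AlternatingMap.map_add_univ]
  rw [← Finset.sum_subset (Finset.subset_univ s.powerset)]
  · refine Finset.sum_congr rfl fun S hS => ?_
    rw [Finset.mem_powerset] at hS
    have h2 : (S.piecewise (s.piecewise B 0)
        fun i => (if i ∈ s then d i else 1) • (Pi.single i 1 : ι → ℝ)) =
        fun i => (if i ∈ s \ S then d i else 1) • (S.piecewise B fun i => Pi.single i 1) i := by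
      funext i
      by_cases h : i ∈ S
      · simp [h, hS h]
      · simp [h]
    rw [h2, AlternatingMap.map_smul_univ, smul_eq_mul]
    congr 1
    rw [Finset.prod_ite]
    simp
    refine Finset.prod_congr ?_ fun _ _ => rfl
    ext; simp
  · intro S _ hS
    rw [Finset.mem_powerset, Finset.not_subset] at hS
    obtain ⟨i, hi, his⟩ := hS
    exact AlternatingMap.map_coord_zero _ i (by simp [hi, his])

/-- Elementary symmetric functions of the eigenvalues, as sums of principal minors. -/
noncomputable def sig (k : ℕ) (A : ι → ι → ℝ) : ℝ := ∑ s ∈ Finset.univ.powersetCard k, pminor s A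

theorem sig_add_diagonal (k : ℕ) (d : ι → ℝ) (B : ι → ι → ℝ) :
    sig k (fun i => d i • Pi.single i 1 + B i) =
      ∑ S : Finset ι, if S.card ≤ k then esym Sᶜ d (k - S.card) * pminor S B else 0 := by
  unfold sig
  simp_rw [pminor_add_diagonal]
  rw [Finset.sum_comm' (t' := Finset.univ) (s' := fun S =>
    (Finset.univ.powersetCard k).filter fun s => S ⊆ s)]
  · refine Finset.sum_congr rfl fun S _ => ?_
    rw [← Finset.sum_mul]
    split_ifs with h
    · congr 1
      unfold esym
      refine Finset.sum_bij' (fun s _ => s \ S) (fun t _ => t ∪ S) ?_ ?_ ?_ ?_ ?_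
      · intro s hs
        simp only [Finset.mem_filter, Finset.mem_powersetCard, Finset.subset_univ, true_and] at hs
        rw [Finset.mem_powersetCard, Finset.card_sdiff_of_subset hs.2, hs.1]
        exact ⟨fun x hx => by simp at hx ⊢; exact hx.2, rfl⟩
      · intro t ht
        rw [Finset.mem_powersetCard] at ht
        have hd : Disjoint t S := Finset.disjoint_left.2 fun x hx hS => by
          have := ht.1 hx; simp at this; exact this hS
        simp only [Finset.mem_filter, Finset.mem_powersetCard, Finset.subset_univ, true_and]
        rw [Finset.card_union_of_disjoint hd, ht.2]
        exact ⟨by omega, Finset.subset_union_right⟩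
      · intro s hs
        simp only [Finset.mem_filter] at hs
        exact Finset.sdiff_union_of_subset hs.2
      · intro t ht
        rw [Finset.mem_powersetCard] at ht
        have hd : Disjoint t S := Finset.disjoint_left.2 fun x hx hS => by
          have := ht.1 hx; simp at this; exact this hS
        exact Finset.union_sdiff_cancel_right hd
      · intros; rfl
    · rw [Finset.sum_eq_zero, zero_mul]
      intro s hs
      simp only [Finset.mem_filter, Finset.mem_powersetCard, Finset.subset_univ, true_and] at hs
      exact absurd (hs.1 ▸ Finset.card_le_card hs.2) h
  · intro s S
    simp

/-- `σ_{m+2} + α σ_{m+1}` as a function of matrices. -/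
noncomputable def sigF (α : ℝ) (m : ℕ) (A : ι → ι → ℝ) : ℝ := sig (m + 2) A + α * sig (m + 1) A

theorem sigF_add_diagonal (α : ℝ) (m : ℕ) (d : ι → ℝ) (B : ι → ι → ℝ) :
    sigF α m (fun i => d i • Pi.single i 1 + B i) =
      ∑ S : Finset ι, if S.card ≤ m + 2 then hsym α Sᶜ d (m + 2 - S.card) * pminor S B else 0 := by
  unfold sigF
  rw [sig_add_diagonal, sig_add_diagonal, Finset.mul_sum, ← Finset.sum_add_distrib]
  refine Finset.sum_congr rfl fun S _ => ?_
  rcases lt_trichotomy S.card (m + 2) with h | h | h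
  · rw [if_pos (by omega), if_pos (by omega), if_pos (by omega),
      show m + 2 - S.card = (m + 1 - S.card) + 1 by omega, hsym_succ]
    ring
  · rw [if_pos (by omega), if_neg (by omega), if_pos (by omega), h]
    simp [hsym_zero]
  · rw [if_neg (by omega), if_neg (by omega), if_neg (by omega)]; simp

end Minor

section SecondVariation
open Filter Topology Asymptotics

theorem isLittleO_pow_of_lt {a b : ℕ} (h : a < b) :
    (fun s : ℝ => s ^ b) =o[𝓝 0] fun s => s ^ a := isLittleO_pow_pow h

theorem eq_zero_of_isLittleO_taylor {c₁ c₂ : ℝ}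
    (h : (fun s : ℝ => s * c₁ + s ^ 2 / 2 * c₂) =o[𝓝 0] fun s => s ^ 2) : c₁ = 0 ∧ c₂ = 0 := by
  have pw : (fun s : ℝ => s ^ 2) =o[𝓝 0] fun s => s := by
    simpa using isLittleO_pow_of_lt (show 1 < 2 by norm_num)
  have aux : ∀ (c : ℝ) (j : ℕ), (fun s : ℝ => s ^ j * c) =o[𝓝 0] (fun s => s ^ j) → c = 0 := by
    intro c j hc
    by_contra hne
    have h1 : (fun s : ℝ => s ^ j) =o[𝓝[≠] 0] (fun s => s ^ j) := by
      have := (hc.mono (nhdsWithin_le_nhds (s := {0}ᶜ))).const_mul_left c⁻¹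
      refine this.congr_left fun s => ?_
      field_simp
    have h2 := isLittleO_irrefl (f'' := fun s : ℝ => s ^ j) (l := 𝓝[≠] 0) ?_
    · exact h2 h1
    · refine (eventually_nhdsWithin_of_forall (s := {0}ᶜ) fun s hs => ?_).frequently
      exact pow_ne_zero _ hs
  have h1 : c₁ = 0 := by
    apply aux c₁ 1
    have : (fun s : ℝ => s ^ 2 / 2 * c₂) =o[𝓝 0] fun s => s := by
      refine (pw.const_mul_left (c₂ / 2)).congr_left fun s => by ring
    refine ((h.trans pw).sub this).congr (fun s => by ring) (fun s => by ring)
  refine ⟨h1, ?_⟩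
  subst h1
  have := aux (c₂ / 2) 2 (h.congr_left fun s => by ring)
  linarith

variable {ι : Type*} [Fintype ι] [DecidableEq ι]

/-- Coefficient of `s` in the expansion of a principal minor along `s B + s² W / 2`. -/
noncomputable def minorFst (B : ι → ι → ℝ) (S : Finset ι) : ℝ :=
  if S.card = 1 then ∑ i ∈ S, B i i else 0

/-- Coefficient of `s² / 2` in the expansion of a principal minor along `s B + s² W / 2`. -/
noncomputable def minorSnd (B W : ι → ι → ℝ) (S : Finset ι) : ℝ :=
  (if S.card = 1 then ∑ i ∈ S, W i i else 0) +
    if S.card = 2 then ∑ p ∈ S.offDiag, (B p.1 p.1 * B p.2 p.2 - B p.1 p.2 * B p.2 p.1) else 0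

theorem pminor_taylor {N : ℝ → ι → ι → ℝ} {B W : ι → ι → ℝ}
    (hN : ∀ i j, (fun s => N s i j - (s * B i j + s ^ 2 / 2 * W i j)) =o[𝓝 0] fun s => s ^ 2)
    (S : Finset ι) :
    (fun s => pminor S (N s) - ((if S = ∅ then 1 else 0) + s * minorFst B S +
      s ^ 2 / 2 * minorSnd B W S)) =o[𝓝 0] fun s => s ^ 2 := by
  have pw : (fun s : ℝ => s ^ 2) =o[𝓝 0] fun s => s := by
    simpa using isLittleO_pow_of_lt (show 1 < 2 by norm_num)
  have hN1 : ∀ i j, (fun s => N s i j - s * B i j) =o[𝓝 0] fun s => s := by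
    intro i j
    have := ((hN i j).trans pw).add (pw.const_mul_left (W i j / 2))
    exact this.congr_left fun s => by ring
  have hN0 : ∀ i j, (fun s => N s i j) =O[𝓝 0] fun s => s := by
    intro i j
    have := (hN1 i j).isBigO.add ((isBigO_refl (fun s : ℝ => s) (𝓝 0)).const_mul_left (B i j))
    exact this.congr_left fun s => by ring
  rcases lt_or_ge 2 S.card with h3 | h3
  · have : S ≠ ∅ := by rintro rfl; simp at h3
    simp only [minorFst, minorSnd, show S.card ≠ 1 by omega, show S.card ≠ 2 by omega, this,
      if_false, mul_zero, add_zero, sub_zero]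
    simp_rw [pminor_eq_det_submatrix, Matrix.det_apply]
    refine IsLittleO.fun_sum fun σ _ => ?_
    have h1 : (fun s => ∏ i : S, (Matrix.of (N s)).submatrix (Subtype.val : S → ι)
        (Subtype.val : S → ι) (σ i) i) =O[𝓝 0] fun s => ∏ i : S, s :=
      IsBigO.finsetProd fun i _ => hN0 _ _
    have h2 : (fun s : ℝ => ∏ i : S, s) =o[𝓝 0] fun s => s ^ 2 := by
      simp only [Finset.prod_const, Finset.card_univ, Fintype.card_coe]
      exact isLittleO_pow_of_lt h3
    refine ((h1.trans_isLittleO h2).const_mul_left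
      (((Equiv.Perm.sign σ : ℤˣ) : ℤ) : ℝ)).congr_left fun s => ?_
    rw [Units.smul_def, zsmul_eq_mul]
  · rcases Nat.lt_or_ge S.card 1 with h | h
    · obtain rfl : S = ∅ := by simpa using h
      simp [pminor_empty, minorFst, minorSnd]
    rcases Nat.lt_or_ge S.card 2 with h' | h'
    · obtain ⟨i, rfl⟩ := Finset.card_eq_one.1 (show S.card = 1 by omega)
      simpa [pminor_singleton, minorFst, minorSnd] using hN i i
    · obtain ⟨i, j, hij, rfl⟩ := Finset.card_eq_two.1 (show S.card = 2 by omega)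
      have e : (({i, j} : Finset ι)).offDiag = {(i, j), (j, i)} := by
        ext ⟨a, b⟩
        simp only [Finset.mem_offDiag, Finset.mem_insert, Finset.mem_singleton, Prod.mk.injEq]
        grind
      have hne : (i, j) ≠ (j, i) := by simp [hij]
      simp only [pminor_pair hij, minorFst, minorSnd, Finset.card_pair hij, e,
        Finset.sum_pair hne]
      have hp : ∀ a b c d, (fun s => N s a b * N s c d - s ^ 2 * (B a b * B c d)) =o[𝓝 0]
          fun s => s ^ 2 := by
        intro a b c d
        have t1 := (hN1 a b).mul_isBigO (hN0 c d)
        have t2 := ((isBigO_refl (fun s : ℝ => s) (𝓝 0)).const_mul_left (B a b)).mul_isLittleO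
          (hN1 c d)
        refine (t1.add t2).congr (fun s => by ring) (fun s => by ring)
      refine ((hp i i j j).sub (hp i j j i)).congr_left fun s => ?_
      simp
      ring

theorem sum_minorFst (B : ι → ι → ℝ) (g : Finset ι → ℝ) :
    ∑ S, g S * minorFst B S = ∑ i, g {i} * B i i := by
  have : ∀ S : Finset ι, g S * minorFst B S = if S ∈ Finset.univ.powersetCard 1 then
      g S * ∑ i ∈ S, B i i else 0 := by
    intro S; simp [minorFst, Finset.mem_powersetCard]
  simp_rw [this]
  rw [← Finset.sum_filter, Finset.filter_mem_eq_inter, Finset.univ_inter, Finset.powersetCard_one,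
    Finset.sum_map]
  simp

theorem sum_minorSnd (B W : ι → ι → ℝ) (g : Finset ι → ℝ) :
    ∑ S, g S * minorSnd B W S = ∑ i, g {i} * W i i +
      ∑ p ∈ Finset.univ.offDiag, g {p.1, p.2} * (B p.1 p.1 * B p.2 p.2 - B p.1 p.2 * B p.2 p.1) := by
  have h1 := sum_minorFst W g
  simp only [minorSnd, mul_add, Finset.sum_add_distrib]
  rw [← h1]
  congr 1
  have : ∀ S : Finset ι, (g S * if S.card = 2 then ∑ p ∈ S.offDiag,
      (B p.1 p.1 * B p.2 p.2 - B p.1 p.2 * B p.2 p.1) else 0) =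
      ∑ p ∈ if S.card = 2 then S.offDiag else ∅,
        g S * (B p.1 p.1 * B p.2 p.2 - B p.1 p.2 * B p.2 p.1) := by
    intro S; split_ifs
    · rw [Finset.mul_sum]
    · simp
  simp_rw [this]
  rw [Finset.sum_comm' (t' := Finset.univ.offDiag) (s' := fun p => {({p.1, p.2} : Finset ι)})]
  · simp
  · rintro S ⟨a, b⟩
    simp only [Finset.mem_univ, true_and, Finset.mem_singleton, Finset.mem_offDiag, ne_eq]
    constructor
    · intro h
      split_ifs at h with hc
      · simp only [Finset.mem_offDiag] at h
        refine ⟨?_, h.2.2⟩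
        symm
        apply Finset.eq_of_subset_of_card_le
        · intro x hx
          simp only [Finset.mem_insert, Finset.mem_singleton] at hx
          rcases hx with rfl | rfl
          exacts [h.1, h.2.1]
        · rw [hc, Finset.card_pair h.2.2]
      · simp at h
    · rintro ⟨rfl, h⟩
      simp [Finset.card_pair h, h]

/-- First-order coefficients of `sigF` at a diagonal matrix. -/
noncomputable def fst1 (α : ℝ) (m : ℕ) (d : ι → ℝ) (i : ι) : ℝ := hsym α {i}ᶜ d (m + 1)

/-- Second-order coefficients of `sigF` at a diagonal matrix. -/
noncomputable def snd2 (α : ℝ) (m : ℕ) (d : ι → ℝ) (i j : ι) : ℝ := hsym α {i, j}ᶜ d m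

theorem sigF_taylor {N : ℝ → ι → ι → ℝ} {B W : ι → ι → ℝ}
    (hN : ∀ i j, (fun s => N s i j - (s * B i j + s ^ 2 / 2 * W i j)) =o[𝓝 0] fun s => s ^ 2)
    (α : ℝ) (m : ℕ) (d : ι → ℝ) :
    (fun s => sigF α m (fun i => d i • Pi.single i 1 + N s i) -
      (hsym α Finset.univ d (m + 2) + s * (∑ i, fst1 α m d i * B i i) +
        s ^ 2 / 2 * (∑ i, fst1 α m d i * W i i + ∑ p ∈ Finset.univ.offDiag, snd2 α m d p.1 p.2 *
          (B p.1 p.1 * B p.2 p.2 - B p.1 p.2 * B p.2 p.1)))) =o[𝓝 0] fun s => s ^ 2 := by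
  set g : Finset ι → ℝ := fun S => if S.card ≤ m + 2 then hsym α Sᶜ d (m + 2 - S.card) else 0
    with hg
  have e1 : ∀ i, fst1 α m d i = g {i} := fun i => by simp [hg, fst1]
  have e2 : ∀ p ∈ (Finset.univ : Finset ι).offDiag, snd2 α m d p.1 p.2 *
      (B p.1 p.1 * B p.2 p.2 - B p.1 p.2 * B p.2 p.1) = g {p.1, p.2} *
      (B p.1 p.1 * B p.2 p.2 - B p.1 p.2 * B p.2 p.1) := fun p hp => by
    have : p.1 ≠ p.2 := by simpa using hp
    simp [hg, snd2, Finset.card_pair this]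
  rw [Finset.sum_congr rfl e2]
  simp_rw [e1]
  rw [← sum_minorFst B g, ← sum_minorSnd B W g]
  have e0 : hsym α Finset.univ d (m + 2) = ∑ S, g S * if S = ∅ then 1 else 0 := by
    simp [hg]
  rw [e0]
  have : ∀ S : Finset ι, (fun s => g S * (pminor S (N s) - ((if S = ∅ then 1 else 0) +
      s * minorFst B S + s ^ 2 / 2 * minorSnd B W S))) =o[𝓝 0] fun s => s ^ 2 := fun S =>
    (pminor_taylor hN S).const_mul_left _
  refine (IsLittleO.fun_sum (s := Finset.univ) fun S _ => this S).congr_left fun s => ?_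
  rw [sigF_add_diagonal, Finset.mul_sum, Finset.mul_sum, ← Finset.sum_add_distrib,
    ← Finset.sum_add_distrib, ← Finset.sum_sub_distrib]
  refine Finset.sum_congr rfl fun S _ => ?_
  have : (if S.card ≤ m + 2 then hsym α Sᶜ d (m + 2 - S.card) * pminor S (N s) else 0) =
      g S * pminor S (N s) := by simp only [hg]; split_ifs <;> simp
  rw [this]
  ring

theorem sigF_diagonal (α : ℝ) (m : ℕ) (d : ι → ℝ) :
    sigF α m (fun i => d i • Pi.single i 1) = hsym α Finset.univ d (m + 2) := by
  have := sigF_add_diagonal α m d 0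
  simp only [Pi.zero_apply, add_zero] at this
  rw [this, Finset.sum_eq_single ∅]
  · simp [pminor_empty]
  · intro S _ hS
    obtain ⟨i, hi⟩ := Finset.nonempty_iff_ne_empty.2 hS
    have : pminor S (0 : ι → ι → ℝ) = 0 := by
      unfold pminor
      exact AlternatingMap.map_coord_zero _ i (by simp [hi])
    simp [this]
  · simp

theorem sq_lt_mul_absurd {F Q ε t u v : ℝ} (hF : 0 < F) (hQ : 0 < Q) (hε : ε = Q / 4)
    (ht : 0 < t) (h : u * v ≤ F ^ 2) (hu : -(ε * t) ≤ u - (F + t / 2 * Q))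
    (hv : -(ε * t) ≤ v - (F + t / 2 * Q)) : False := by
  have hp : 0 < t * ε := by subst hε; positivity
  have b1 : F + t * ε ≤ u := by subst hε; linarith
  have b2 : F + t * ε ≤ v := by subst hε; linarith
  have b3 : (F + t * ε) * (F + t * ε) ≤ u * v :=
    mul_le_mul b1 b2 (by positivity) (by linarith)
  nlinarith

/-- Concavity of the equation in directions of diagonal matrices. -/
theorem snd2_diag_nonpos {α : ℝ} (hα : 0 ≤ α) {m : ℕ} {d : ι → ℝ}
    (hd : garding Finset.univ (m + 2) d) (b : ι → ℝ) (hb : ∑ i, fst1 α m d i * b i = 0) :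
    ∑ p ∈ Finset.univ.offDiag, snd2 α m d p.1 p.2 * (b p.1 * b p.2) ≤ 0 := by
  set Q := ∑ p ∈ Finset.univ.offDiag, snd2 α m d p.1 p.2 * (b p.1 * b p.2) with hQ
  set F₀ := hsym α Finset.univ d (m + 2) with hF
  have hF0 : 0 < F₀ := hd.hsym_pos hα _ le_rfl
  have T : (fun s : ℝ => hsym α Finset.univ (d + s • b) (m + 2) - (F₀ + s ^ 2 / 2 * Q))
      =o[𝓝 0] fun s => s ^ 2 := by
    have := sigF_taylor (N := fun s i j => if i = j then s * b i else 0)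
      (B := fun i j => if i = j then b i else 0) (W := 0) (by
        intro i j
        by_cases h : i = j <;> simp [h]) α m d
    refine this.congr_left fun s => ?_
    have e : (fun i => d i • (Pi.single i 1 : ι → ℝ) + fun j => if i = j then s * b i else 0) =
        fun i => (d + s • b) i • (Pi.single i 1 : ι → ℝ) := by
      funext i j
      by_cases h : i = j
      · subst h; simp
      · simp [h, Ne.symm h]
    rw [e, sigF_diagonal]
    have e2 : ∀ p ∈ (Finset.univ : Finset ι).offDiag, snd2 α m d p.1 p.2 *
        ((if p.1 = p.1 then b p.1 else 0) * (if p.2 = p.2 then b p.2 else 0) -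
        (if p.1 = p.2 then b p.1 else 0) * (if p.2 = p.1 then b p.2 else 0)) =
        snd2 α m d p.1 p.2 * (b p.1 * b p.2) := fun p hp => by
      have : p.1 ≠ p.2 := by simpa using hp
      simp [this]
    rw [Finset.sum_congr rfl e2]
    simp [hb, ← hQ, ← hF]
  have T' : (fun s : ℝ => hsym α Finset.univ (d - s • b) (m + 2) - (F₀ + s ^ 2 / 2 * Q))
      =o[𝓝 0] fun s => s ^ 2 := by
    have h0 : Tendsto (fun s : ℝ => -s) (𝓝 0) (𝓝 0) := by
      simpa using (continuous_neg (G := ℝ)).tendsto 0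
    refine (T.comp_tendsto h0).congr (fun s => ?_) (fun s => ?_)
    · simp [sub_eq_add_neg]
    · simp
  by_contra! hQ0
  obtain ⟨ε, hεQ⟩ : ∃ ε, ε = Q / 4 := ⟨_, rfl⟩
  have hε : 0 < ε := hεQ ▸ div_pos hQ0 four_pos
  have hev := hd.hsym_eventually hα b
  have h1 := T.def hε
  have h2 := T'.def hε
  have h3 : ∀ᶠ s : ℝ in 𝓝[≠] 0, False := by
    filter_upwards [nhdsWithin_le_nhds hev, nhdsWithin_le_nhds h1, nhdsWithin_le_nhds h2,
      self_mem_nhdsWithin] with s hs hs1 hs2 hs0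
    have hs0' : s ≠ 0 := hs0
    have hsq : 0 < s ^ 2 := sq_pos_of_ne_zero hs0'
    rw [Real.norm_eq_abs, Real.norm_eq_abs, abs_of_pos hsq] at hs1 hs2
    have a1 := (abs_le.1 hs1).1
    have a2 := (abs_le.1 hs2).1
    exact sq_lt_mul_absurd hF0 hQ0 hεQ hsq hs a1 a2
  exact (h3.exists).elim fun _ h => h

/-- The pointwise second-variation inequality at a diagonal Hessian. -/
theorem second_variation {N : ℝ → ι → ι → ℝ} {B W : ι → ι → ℝ}
    (hN : ∀ i j, (fun s => N s i j - (s * B i j + s ^ 2 / 2 * W i j)) =o[𝓝 0] fun s => s ^ 2)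
    {α : ℝ} (hα : 0 ≤ α) {m : ℕ} {d : ι → ℝ} (hd : garding Finset.univ (m + 2) d)
    (hB : ∀ i j, B i j = B j i)
    (hF : ∀ s, sigF α m (fun i => d i • Pi.single i 1 + N s i) =
      sigF α m (fun i => d i • Pi.single i 1)) :
    ∑ i, fst1 α m d i * B i i = 0 ∧
    ∑ p ∈ Finset.univ.offDiag, snd2 α m d p.1 p.2 * B p.1 p.2 ^ 2 ≤ ∑ i, fst1 α m d i * W i i := by
  have T := sigF_taylor hN α m d
  simp_rw [hF, sigF_diagonal] at T
  have T' := T.neg_left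
  obtain ⟨h1, h2⟩ := eq_zero_of_isLittleO_taylor (T'.congr_left fun s => by
    rw [neg_sub, add_assoc, add_sub_cancel_left])
  refine ⟨h1, ?_⟩
  have h3 := snd2_diag_nonpos hα hd (fun i => B i i) h1
  simp only [mul_sub, Finset.sum_sub_distrib] at h2
  have h4 : ∑ p ∈ Finset.univ.offDiag, snd2 α m d p.1 p.2 * B p.1 p.2 ^ 2 =
      ∑ p ∈ Finset.univ.offDiag, snd2 α m d p.1 p.2 * (B p.1 p.2 * B p.2 p.1) :=
    Finset.sum_congr rfl fun p _ => by rw [hB p.2 p.1]; ring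
  linarith

end SecondVariation

section MatrixCalculus
variable {ι : Type*} [Fintype ι] [DecidableEq ι]

theorem sig_eq_coeff (k : ℕ) (A : Matrix ι ι ℝ) :
    sig k A = (Matrix.det (1 + (Polynomial.X : Polynomial ℝ) • A.map Polynomial.C)).coeff k := by
  rw [Matrix.coeff_det_one_add_X_smul_eq_sum_minors]
  exact Finset.sum_congr rfl fun s _ => pminor_eq_det_submatrix s A

theorem sig_conj (k : ℕ) (A U V : Matrix ι ι ℝ) (h : V * U = 1) : sig k (V * A * U) = sig k A := by
  rw [sig_eq_coeff, sig_eq_coeff]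
  congr 1
  have h1 : V.map Polynomial.C * U.map Polynomial.C = (1 : Matrix ι ι (Polynomial ℝ)) := by
    rw [← Matrix.map_mul, h, Matrix.map_one _ (map_zero _) (map_one _)]
  have h2 : 1 + (Polynomial.X : Polynomial ℝ) • (V * A * U).map Polynomial.C =
      V.map Polynomial.C * (1 + (Polynomial.X : Polynomial ℝ) • A.map Polynomial.C) *
        U.map Polynomial.C := by
    rw [Matrix.mul_add, Matrix.add_mul, Matrix.mul_one, h1, Matrix.map_mul, Matrix.map_mul]
    simp
  rw [h2, Matrix.det_mul, Matrix.det_mul, mul_comm (Matrix.det _), mul_assoc, ← Matrix.det_mul, h1,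
    Matrix.det_one, mul_one]

theorem sigF_conj (α : ℝ) (m : ℕ) (A U V : Matrix ι ι ℝ) (h : V * U = 1) :
    sigF α m (V * A * U) = sigF α m A := by
  unfold sigF; rw [sig_conj _ A U V h, sig_conj _ A U V h]

theorem diagonal_eq_smul_single (d : ι → ℝ) :
    (Matrix.diagonal d : ι → ι → ℝ) = fun i => d i • Pi.single i 1 := by
  funext i j
  by_cases h : i = j
  · subst h; simp
  · simp [h, Ne.symm h]

theorem sig_diagonal (k : ℕ) (d : ι → ℝ) :
    sig k (Matrix.diagonal d) = esym Finset.univ d k := by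
  have := sig_add_diagonal k d 0
  simp only [Pi.zero_apply, add_zero] at this
  rw [diagonal_eq_smul_single, this, Finset.sum_eq_single ∅]
  · simp [pminor_empty]
  · intro S _ hS
    obtain ⟨i, hi⟩ := Finset.nonempty_iff_ne_empty.2 hS
    have : pminor S (0 : ι → ι → ℝ) = 0 := by
      unfold pminor
      exact AlternatingMap.map_coord_zero _ i (by simp [hi])
    simp [this]
  · simp

theorem exists_orthogonal_diagonalization {A : Matrix ι ι ℝ} (hA : A.IsSymm) :
    ∃ (U : Matrix ι ι ℝ) (d : ι → ℝ), U.transpose * U = 1 ∧ U * U.transpose = 1 ∧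
      A = U * Matrix.diagonal d * U.transpose := by
  have hH : A.IsHermitian := by
    rw [Matrix.IsHermitian, Matrix.conjTranspose_eq_transpose_of_trivial]; exact hA
  refine ⟨hH.eigenvectorUnitary, hH.eigenvalues, ?_, ?_, ?_⟩
  · have := Unitary.coe_star_mul_self hH.eigenvectorUnitary
    rwa [Matrix.star_eq_conjTranspose, Matrix.conjTranspose_eq_transpose_of_trivial] at this
  · have := Unitary.coe_star_mul_self hH.eigenvectorUnitary
    rw [Matrix.star_eq_conjTranspose, Matrix.conjTranspose_eq_transpose_of_trivial] at this
    exact mul_eq_one_comm.1 this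
  · have := hH.spectral_theorem
    rw [Unitary.conjStarAlgAut_apply, Matrix.star_eq_conjTranspose,
      Matrix.conjTranspose_eq_transpose_of_trivial] at this
    exact this

/-- The determinant as a continuous multilinear function of the rows. -/
noncomputable def detCML (ι : Type*) [Fintype ι] [DecidableEq ι] :
    ContinuousMultilinearMap ℝ (fun _ : ι => ι → ℝ) ℝ where
  toMultilinearMap := (Matrix.detRowAlternating (R := ℝ) (n := ι)).toMultilinearMap
  cont := by
    change Continuous fun A : ι → ι → ℝ => Matrix.det (Matrix.of A)
    exact Continuous.matrix_det (by fun_prop)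

theorem hasFDerivAt_det_rows {E : Type*} [NormedAddCommGroup E] [NormedSpace ℝ E]
    {R : E → ι → ι → ℝ} {R' : ι → E →L[ℝ] (ι → ℝ)} {x : E}
    (h : ∀ i, HasFDerivAt (fun y => R y i) (R' i) x) :
    HasFDerivAt (fun y => Matrix.detRowAlternating (R y))
      (∑ i, ((detCML ι).toContinuousLinearMap (R x) i).comp (R' i)) x := by
  have := HasFDerivAt.multilinear_comp (f := detCML ι) h
  exact this

/-- Derivative of a principal minor with respect to the entry `(i, j)`. -/
noncomputable def pminorCof (s : Finset ι) (A : ι → ι → ℝ) (i j : ι) : ℝ :=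
  if i ∈ s then Matrix.detRowAlternating
    (Function.update (s.piecewise A fun i => Pi.single i 1) i (Pi.single j 1)) else 0

/-- Derivative of `sigF` with respect to the entry `(i, j)`. -/
noncomputable def linF (α : ℝ) (m : ℕ) (A : ι → ι → ℝ) (i j : ι) : ℝ :=
  ∑ s ∈ Finset.univ.powersetCard (m + 2), pminorCof s A i j +
    α * ∑ s ∈ Finset.univ.powersetCard (m + 1), pminorCof s A i j

theorem det_update_eq_sum (R : ι → ι → ℝ) (i : ι) (v : ι → ℝ) :
    Matrix.detRowAlternating (Function.update R i v) =
      ∑ j, v j * Matrix.detRowAlternating (Function.update R i (Pi.single j 1)) := by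
  have hv : v = ∑ j, v j • (Pi.single j 1 : ι → ℝ) := by
    ext k; simp [Finset.sum_apply, Pi.single_apply]
  conv_lhs => rw [hv]
  rw [AlternatingMap.map_update_sum]
  simp

variable {E : Type*} [NormedAddCommGroup E] [NormedSpace ℝ E]

theorem fderiv_pminor (s : Finset ι) {A : E → ι → ι → ℝ} {x : E}
    (h : ∀ i j, DifferentiableAt ℝ (fun y => A y i j) x) (v : E) :
    DifferentiableAt ℝ (fun y => pminor s (A y)) x ∧
    fderiv ℝ (fun y => pminor s (A y)) x v =
      ∑ i, ∑ j, pminorCof s (A x) i j * fderiv ℝ (fun y => A y i j) x v := by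
  have hr : ∀ i, HasFDerivAt (fun y => (s.piecewise (A y) fun i => Pi.single i 1) i)
      (if i ∈ s then ContinuousLinearMap.pi fun j => fderiv ℝ (fun y => A y i j) x else 0) x := by
    intro i
    by_cases hi : i ∈ s
    · simp only [hi, Finset.piecewise_eq_of_mem, if_true]
      exact hasFDerivAt_pi.2 fun j => (h i j).hasFDerivAt
    · simp only [hi, not_false_eq_true, Finset.piecewise_eq_of_notMem, if_false]
      exact hasFDerivAt_const _ _
  have hd := hasFDerivAt_det_rows hr
  refine ⟨hd.differentiableAt, ?_⟩
  have hd' : HasFDerivAt (fun y => pminor s (A y)) _ x := hd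
  rw [hd'.fderiv, sum_apply]
  refine Finset.sum_congr rfl fun i _ => ?_
  rw [ContinuousLinearMap.comp_apply]
  change Matrix.detRowAlternating (Function.update _ i _) = _
  rw [det_update_eq_sum]
  refine Finset.sum_congr rfl fun j _ => ?_
  by_cases hi : i ∈ s
  · simp [hi, pminorCof, mul_comm]
  · simp [hi, pminorCof]

theorem fderiv_sigF (α : ℝ) (m : ℕ) {A : E → ι → ι → ℝ} {x : E}
    (h : ∀ i j, DifferentiableAt ℝ (fun y => A y i j) x) (v : E) :
    DifferentiableAt ℝ (fun y => sigF α m (A y)) x ∧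
    fderiv ℝ (fun y => sigF α m (A y)) x v =
      ∑ i, ∑ j, linF α m (A x) i j * fderiv ℝ (fun y => A y i j) x v := by
  have d : ∀ k, HasFDerivAt (fun y => sig k (A y)) (∑ s ∈ Finset.univ.powersetCard k,
      fderiv ℝ (fun y => pminor s (A y)) x) x := fun k =>
    HasFDerivAt.fun_sum fun s _ => (fderiv_pminor s h 0).1.hasFDerivAt
  have D : HasFDerivAt (fun y => sigF α m (A y)) _ x := (d (m + 2)).add ((d (m + 1)).const_mul α)
  refine ⟨D.differentiableAt, ?_⟩
  rw [D.fderiv]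
  simp only [add_apply, smul_apply, sum_apply,
    (fderiv_pminor _ h v).2, linF, smul_eq_mul]
  rw [Finset.sum_comm, Finset.sum_comm (s := Finset.univ.powersetCard (m + 1)), Finset.mul_sum,
    ← Finset.sum_add_distrib]
  refine Finset.sum_congr rfl fun i _ => ?_
  rw [Finset.sum_comm, Finset.sum_comm (s := Finset.univ.powersetCard (m + 1)), Finset.mul_sum,
    ← Finset.sum_add_distrib]
  refine Finset.sum_congr rfl fun j _ => ?_
  rw [add_mul, Finset.sum_mul, mul_assoc, Finset.sum_mul]

theorem contDiff_linF (α : ℝ) (m : ℕ) {A : E → ι → ι → ℝ} {r : WithTop ℕ∞}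
    (h : ∀ i j, ContDiff ℝ r fun y => A y i j) (i j : ι) :
    ContDiff ℝ r fun y => linF α m (A y) i j := by
  have key : ∀ s : Finset ι, ContDiff ℝ r fun y => pminorCof s (A y) i j := by
    intro s
    unfold pminorCof
    by_cases hi : i ∈ s
    · simp only [hi, if_true]
      refine (detCML ι).contDiff.comp (contDiff_pi.2 fun p => contDiff_pi.2 fun q => ?_)
      by_cases hp : p = i
      · subst hp; simp only [Function.update_self]; exact contDiff_const
      · simp only [ne_eq, hp, not_false_eq_true, Function.update_of_ne]
        by_cases hps : p ∈ s
        · simp only [hps, Finset.piecewise_eq_of_mem]; exact h p q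
        · simp only [hps, not_false_eq_true, Finset.piecewise_eq_of_notMem]; exact contDiff_const
    · simp only [hi, if_false]; exact contDiff_const
  unfold linF
  exact (ContDiff.sum fun s _ => key s).add (contDiff_const.mul (ContDiff.sum fun s _ => key s))

/-- The linearised operator is divergence free along Hessian-like fields. -/
theorem sum_fderiv_linF_eq_zero (α : ℝ) (m : ℕ) {A : E → ι → ι → ℝ} {x : E}
    (h : ∀ i j, DifferentiableAt ℝ (fun y => A y i j) x) (e : ι → E)
    (hsym : ∀ i p q, fderiv ℝ (fun y => A y p q) x (e i) = fderiv ℝ (fun y => A y i q) x (e p))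
    (j : ι) : ∑ i, fderiv ℝ (fun y => linF α m (A y) i j) x (e i) = 0 := by
  have key : ∀ s : Finset ι, (∀ i, DifferentiableAt ℝ (fun y => pminorCof s (A y) i j) x) ∧
      ∑ i, fderiv ℝ (fun y => pminorCof s (A y) i j) x (e i) = 0 := by
    intro s
    have hr : ∀ i p, HasFDerivAt (fun y => Function.update (s.piecewise (A y) fun i => Pi.single i 1)
        i (Pi.single j 1) p) (if p ∈ s ∧ p ≠ i then
          ContinuousLinearMap.pi fun q => fderiv ℝ (fun y => A y p q) x else 0) x := by
      intro i p
      by_cases hp : p = i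
      · subst hp; simp only [Function.update_self, ne_eq, not_true_eq_false, and_false, if_false]
        exact hasFDerivAt_const _ _
      · simp only [ne_eq, hp, not_false_eq_true, Function.update_of_ne, and_true]
        by_cases hps : p ∈ s
        · simp only [hps, Finset.piecewise_eq_of_mem, if_true]
          exact hasFDerivAt_pi.2 fun q => (h p q).hasFDerivAt
        · simp only [hps, not_false_eq_true, Finset.piecewise_eq_of_notMem, if_false]
          exact hasFDerivAt_const _ _
    have hdet := fun i => hasFDerivAt_det_rows (hr i)
    constructor
    · intro i
      unfold pminorCof
      by_cases hi : i ∈ s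
      · simp only [hi, if_true]; exact (hdet i).differentiableAt
      · simp only [hi, if_false]; exact differentiableAt_const _
    · set X := s.piecewise (A x) fun i => Pi.single i 1
      have hval : ∀ i, fderiv ℝ (fun y => pminorCof s (A y) i j) x (e i) = ∑ p,
          if i ∈ s ∧ p ∈ s ∧ p ≠ i then Matrix.detRowAlternating (Function.update
            (Function.update X i (Pi.single j 1)) p fun q => fderiv ℝ (fun y => A y p q) x (e i))
            else 0 := by
        intro i
        unfold pminorCof
        by_cases hi : i ∈ s
        · simp only [hi, if_true, true_and]
          rw [(hdet i).fderiv, sum_apply]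
          refine Finset.sum_congr rfl fun p _ => ?_
          rw [ContinuousLinearMap.comp_apply]
          change Matrix.detRowAlternating (Function.update _ p _) = _
          by_cases hp : p ∈ s ∧ p ≠ i
          · rw [if_pos hp, if_pos hp]; rfl
          · rw [if_neg hp, if_neg hp]
            exact AlternatingMap.map_coord_zero _ p (by simp)
        · simp [hi]
      simp_rw [hval]
      have anti : ∀ i p, (if i ∈ s ∧ p ∈ s ∧ p ≠ i then Matrix.detRowAlternating (Function.update
            (Function.update X i (Pi.single j 1)) p fun q => fderiv ℝ (fun y => A y p q) x (e i))
            else 0) = - (if p ∈ s ∧ i ∈ s ∧ i ≠ p then Matrix.detRowAlternating (Function.update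
            (Function.update X p (Pi.single j 1)) i fun q => fderiv ℝ (fun y => A y i q) x (e p))
            else 0) := by
        intro i p
        by_cases hc : i ∈ s ∧ p ∈ s ∧ p ≠ i
        · rw [if_pos hc, if_pos ⟨hc.2.1, hc.1, hc.2.2.symm⟩,
            ← AlternatingMap.map_swap _ _ hc.2.2]
          congr 1
          funext k
          simp only [Function.comp]
          by_cases hk : k = i
          · subst hk
            simp [hc.2.2, Equiv.swap_apply_right, hc.2.2.symm]
          · by_cases hk' : k = p
            · subst hk'
              simp [Equiv.swap_apply_left, hsym]
            · rw [Equiv.swap_apply_of_ne_of_ne hk' hk]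
              simp [hk, hk']
        · rw [if_neg hc, if_neg fun h => hc ⟨h.2.1, h.1, h.2.2.symm⟩, neg_zero]
      have := Finset.sum_comm (s := (Finset.univ : Finset ι)) (t := Finset.univ) (f := fun i p =>
        (if i ∈ s ∧ p ∈ s ∧ p ≠ i then Matrix.detRowAlternating (Function.update
            (Function.update X i (Pi.single j 1)) p fun q => fderiv ℝ (fun y => A y p q) x (e i))
            else 0))
      have h2 : ∑ i, ∑ p, (if i ∈ s ∧ p ∈ s ∧ p ≠ i then Matrix.detRowAlternating (Function.update
            (Function.update X i (Pi.single j 1)) p fun q => fderiv ℝ (fun y => A y p q) x (e i))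
            else 0) = - ∑ i, ∑ p, (if p ∈ s ∧ i ∈ s ∧ i ≠ p then Matrix.detRowAlternating
            (Function.update (Function.update X p (Pi.single j 1)) i
              fun q => fderiv ℝ (fun y => A y i q) x (e p)) else 0) := by
        rw [← Finset.sum_neg_distrib]
        refine Finset.sum_congr rfl fun i _ => ?_
        rw [← Finset.sum_neg_distrib]
        exact Finset.sum_congr rfl fun p _ => anti i p
      linarith
  have D : ∀ i, HasFDerivAt (fun y => linF α m (A y) i j)
      (∑ s ∈ Finset.univ.powersetCard (m + 2), fderiv ℝ (fun y => pminorCof s (A y) i j) x +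
        α • ∑ s ∈ Finset.univ.powersetCard (m + 1), fderiv ℝ (fun y => pminorCof s (A y) i j) x) x :=
    fun i => (HasFDerivAt.fun_sum fun s _ => ((key s).1 i).hasFDerivAt).add
      ((HasFDerivAt.fun_sum fun s _ => ((key s).1 i).hasFDerivAt).const_mul α)
  simp_rw [fun i => (D i).fderiv]
  simp only [add_apply, smul_apply, sum_apply,
    smul_eq_mul, Finset.sum_add_distrib, ← Finset.mul_sum]
  rw [Finset.sum_comm, Finset.sum_comm (t := Finset.univ.powersetCard (m + 1))]
  simp [(key _).2]

open Asymptotics Filter Topology in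
theorem linF_eq_of_diagonalization (α : ℝ) (m : ℕ) {A U : Matrix ι ι ℝ} {d : ι → ℝ}
    (hU : U.transpose * U = 1) (hU' : U * U.transpose = 1)
    (hA : A = U * Matrix.diagonal d * U.transpose) (i j : ι) :
    linF α m A i j = ∑ l, fst1 α m d l * (U i l * U j l) := by
  set V : Matrix ι ι ℝ := Matrix.single i j 1 with hV
  set B : Matrix ι ι ℝ := U.transpose * V * U with hB
  have hBl : ∀ l, B l l = U i l * U j l := by
    intro l
    simp only [hB, hV, Matrix.mul_apply, Matrix.transpose_apply, Matrix.single_apply]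
    simp [Finset.sum_ite_eq, ite_and]
  have e : ∀ t : ℝ, sigF α m (fun p q => A p q + t * V p q) =
      sigF α m (fun p => d p • Pi.single p 1 + fun q => t * B p q) := by
    intro t
    have h1 := sigF_conj α m (A + t • V) U U.transpose hU
    have h2 : U.transpose * (A + t • V) * U = Matrix.diagonal d + t • B := by
      rw [Matrix.mul_add, Matrix.add_mul, hA, hB]
      congr 1
      · calc U.transpose * (U * Matrix.diagonal d * U.transpose) * U =
            (U.transpose * U) * Matrix.diagonal d * (U.transpose * U) := by
              simp only [Matrix.mul_assoc]
          _ = _ := by rw [hU]; simp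
      · simp
    rw [h2] at h1
    have h3 : (fun p => d p • (Pi.single p 1 : ι → ℝ) + fun q => t * B p q) =
        (Matrix.diagonal d + t • B : Matrix ι ι ℝ) := by
      have := diagonal_eq_smul_single d
      funext p q
      have := congrFun (congrFun this p) q
      simp [this]
    rw [h3, h1]
    rfl
  have D1 : HasDerivAt (fun t : ℝ => sigF α m (fun p q => A p q + t * V p q)) (linF α m A i j) 0 := by
    have hd : ∀ p q, HasDerivAt (fun t : ℝ => A p q + t * V p q) (V p q) 0 := fun p q => by
      simpa using ((hasDerivAt_id (0 : ℝ)).mul_const (V p q)).const_add (A p q)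
    have := fderiv_sigF α m (A := fun (t : ℝ) p q => A p q + t * V p q) (x := 0)
      (fun p q => (hd p q).differentiableAt) 1
    have h2 := this.1.hasDerivAt
    have h3 : deriv (fun t : ℝ => sigF α m (fun p q => A p q + t * V p q)) 0 = linF α m A i j := by
      rw [← fderiv_apply_one_eq_deriv, this.2]
      simp only [fderiv_apply_one_eq_deriv, (hd _ _).deriv, zero_mul, add_zero]
      simp [hV, Matrix.single_apply, ite_and]
    rw [h3] at h2
    exact h2
  have D2 : HasDerivAt (fun t : ℝ => sigF α m (fun p => d p • Pi.single p 1 + fun q => t * B p q))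
      (∑ l, fst1 α m d l * B l l) 0 := by
    have T := sigF_taylor (N := fun t p q => t * B p q) (B := B) (W := 0) (by simp) α m d
    rw [hasDerivAt_iff_isLittleO]
    have pw : (fun s : ℝ => s ^ 2) =o[𝓝 0] fun s => s := by
      simpa using isLittleO_pow_of_lt (show 1 < 2 by norm_num)
    have := (T.trans pw).add (pw.const_mul_left (1 / 2 * (∑ i, fst1 α m d i * (0 : ι → ι → ℝ) i i +
      ∑ p ∈ Finset.univ.offDiag, snd2 α m d p.1 p.2 *
          (B p.1 p.1 * B p.2 p.2 - B p.1 p.2 * B p.2 p.1))))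
    refine this.congr (fun s => ?_) (fun s => by simp)
    have h0 : (fun p => d p • (Pi.single p 1 : ι → ℝ) + fun q => (0 : ℝ) * B p q) =
        fun p => d p • Pi.single p 1 := by
      funext p q; simp
    simp only [h0, sigF_diagonal]
    simp
    ring
  simp_rw [e] at D1
  rw [D1.unique D2]
  exact Finset.sum_congr rfl fun l _ => by rw [hBl]

end MatrixCalculus

section RankOne
variable {ι : Type*} [Fintype ι] [DecidableEq ι]

theorem sig_diagonal_add_rank_one (d ξ : ι → ℝ) (p : ℝ) (k : ℕ) :
    sig (k + 1) (fun i => d i • Pi.single i 1 + fun j => p * (ξ i * ξ j)) =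
      esym Finset.univ d (k + 1) + p * ∑ i, ξ i ^ 2 * esym (Finset.univ.erase i) d k := by
  set B : ι → ι → ℝ := fun i j => p * (ξ i * ξ j) with hB
  set g : Finset ι → ℝ := fun S => esym Sᶜ d (k + 1 - S.card)
  have key : ∀ S : Finset ι, (if S.card ≤ k + 1 then esym Sᶜ d (k + 1 - S.card) * pminor S B else 0) =
      (if S = ∅ then esym Finset.univ d (k + 1) else 0) + g S * minorFst B S := by
    intro S
    rcases Nat.lt_trichotomy S.card 1 with h | h | h
    · obtain rfl : S = ∅ := Finset.card_eq_zero.1 (by omega)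
      simp [minorFst, pminor_empty]
    · obtain ⟨i, rfl⟩ := Finset.card_eq_one.1 h
      simp [minorFst, pminor_singleton, g]
    · have hS : S ≠ ∅ := by rintro rfl; simp at h
      have h0 : pminor S B = 0 := by
        rw [pminor_eq_det_submatrix]
        have : Nontrivial {x // x ∈ S} := by
          obtain ⟨a, ha, b, hb, hab⟩ := Finset.one_lt_card.1 h
          exact ⟨⟨⟨a, ha⟩, ⟨b, hb⟩, fun h => hab (congrArg Subtype.val h)⟩⟩
        have : ((Matrix.of B).submatrix (↑) (↑) : Matrix S S ℝ) =
            Matrix.vecMulVec (fun i : S => p * ξ i) (fun j : S => ξ j) := by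
          ext i j; simp [Matrix.vecMulVec_apply, hB, mul_assoc]
        rw [this, Matrix.det_vecMulVec]
      simp [hS, h0, minorFst, h.ne']
  change sig (k + 1) (fun i => d i • Pi.single i 1 + B i) = _
  rw [sig_add_diagonal, Finset.sum_congr rfl fun S _ => key S, Finset.sum_add_distrib,
    sum_minorFst]
  congr 1
  · simp
  · rw [Finset.mul_sum]
    refine Finset.sum_congr rfl fun i _ => ?_
    simp only [g, hB, Finset.card_singleton, Nat.add_sub_cancel, Finset.compl_singleton]
    ring

/-- The symmetric matrix `A` has its eigenvalues in the Garding cone. -/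
def gardM (k : ℕ) (A : Matrix ι ι ℝ) : Prop := ∀ j ≤ k, 0 < sig j A

theorem sig_conj_diagonal {A U : Matrix ι ι ℝ} {d : ι → ℝ} (hU : U.transpose * U = 1)
    (hA : A = U * Matrix.diagonal d * U.transpose) (j : ℕ) :
    sig j A = esym Finset.univ d j := by
  rw [hA, sig_conj _ _ _ _ (mul_eq_one_comm.1 hU), sig_diagonal]

theorem gardM.garding {k : ℕ} {A U : Matrix ι ι ℝ} {d : ι → ℝ} (h : gardM k A)
    (hU : U.transpose * U = 1) (hA : A = U * Matrix.diagonal d * U.transpose) :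
    garding Finset.univ k d := fun j hj => by
  rw [← sig_conj_diagonal hU hA]; exact h j hj

theorem exists_sig_add_rank_one {A : Matrix ι ι ℝ} (hA : A.IsSymm) (ξ : ι → ℝ) :
    ∃ (d ζ : ι → ℝ), (ζ = 0 → ξ = 0) ∧ (∀ j, sig j A = esym Finset.univ d j) ∧
      ∀ p k, sig (k + 1) (A + p • Matrix.vecMulVec ξ ξ : Matrix ι ι ℝ) =
        esym Finset.univ d (k + 1) + p * ∑ i, ζ i ^ 2 * esym (Finset.univ.erase i) d k := by
  obtain ⟨U, d, hU, hU', hAd⟩ := exists_orthogonal_diagonalization hA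
  refine ⟨d, Matrix.mulVec U.transpose ξ, fun h => ?_, sig_conj_diagonal hU hAd, fun p k => ?_⟩
  · have : Matrix.mulVec U (Matrix.mulVec U.transpose ξ) = ξ := by
      rw [Matrix.mulVec_mulVec, hU', Matrix.one_mulVec]
    rw [← this, h, Matrix.mulVec_zero]
  · rw [← sig_diagonal_add_rank_one]
    refine (sig_conj _ (A + p • Matrix.vecMulVec ξ ξ : Matrix ι ι ℝ) U U.transpose hU).symm.trans ?_
    congr 1
    rw [Matrix.mul_add, Matrix.add_mul]
    have h1 : U.transpose * A * U = Matrix.diagonal d := by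
      rw [hAd]
      calc _ = (U.transpose * U) * Matrix.diagonal d * (U.transpose * U) := by
              simp only [Matrix.mul_assoc]
          _ = _ := by rw [hU]; simp
    rw [h1, Matrix.mul_smul, Matrix.smul_mul, Matrix.mul_vecMulVec, Matrix.vecMulVec_mul,
      ← Matrix.mulVec_transpose]
    have := diagonal_eq_smul_single d
    funext p q
    have := congrFun (congrFun this p) q
    simp [this, Matrix.vecMulVec_apply]

theorem gardM.add_rank_one {k : ℕ} {A : Matrix ι ι ℝ} (h : gardM k A) (hA : A.IsSymm)
    (ξ : ι → ℝ) {p : ℝ} (hp : 0 ≤ p) :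
    gardM k (A + p • Matrix.vecMulVec ξ ξ : Matrix ι ι ℝ) ∧
    (∀ j ≤ k, sig j A ≤ sig j (A + p • Matrix.vecMulVec ξ ξ : Matrix ι ι ℝ)) ∧
    ((0 < p ∧ ξ ≠ 0) → ∀ j < k, sig (j + 1) A < sig (j + 1) (A + p • Matrix.vecMulVec ξ ξ : Matrix ι ι ℝ)) := by
  obtain ⟨d, ζ, hζ, h0, h1⟩ := exists_sig_add_rank_one hA ξ
  have hd : _root_.garding Finset.univ k d := fun j hj => by rw [← h0]; exact h j hj
  have hpos : ∀ j < k, ∀ i, 0 < esym (Finset.univ.erase i) d j := fun j hj i => by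
    have := (hd.mono (show j + 1 ≤ k by omega)).erase (Finset.mem_univ i)
    exact this j le_rfl
  have hle : ∀ j ≤ k, sig j A ≤ sig j (A + p • Matrix.vecMulVec ξ ξ : Matrix ι ι ℝ) := by
    intro j hj
    rcases j with _ | j
    · simp only [sig, Finset.powersetCard_zero, Finset.sum_singleton]
      exact ((pminor_empty _).trans (pminor_empty _).symm).le
    · rw [h1, h0]
      have : 0 ≤ p * ∑ i, ζ i ^ 2 * esym (Finset.univ.erase i) d j :=
        mul_nonneg hp (Finset.sum_nonneg fun i _ => mul_nonneg (sq_nonneg _) (hpos j (by omega) i).le)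
      linarith
  refine ⟨fun j hj => (h j hj).trans_le (hle j hj), hle, ?_⟩
  rintro ⟨hp, hξ⟩ j hj
  rw [h1, h0]
  have : 0 < p * ∑ i, ζ i ^ 2 * esym (Finset.univ.erase i) d j := by
    refine mul_pos hp ?_
    obtain ⟨i, hi⟩ : ∃ i, ζ i ≠ 0 := by
      by_contra hcon; push Not at hcon
      exact hξ (hζ (funext hcon))
    exact Finset.sum_pos' (fun i _ => mul_nonneg (sq_nonneg _) (hpos j (by omega) i).le)
      ⟨i, Finset.mem_univ _, mul_pos (by positivity) (hpos j (by omega) i)⟩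
  linarith

/-- `sigF` is strictly increasing on the Garding cone along positive semidefinite directions. -/
theorem gardM.eq_zero_of_posSemidef {α : ℝ} (hα : 0 ≤ α) {m : ℕ} {A P : Matrix ι ι ℝ} (h : gardM (m + 2) A) (hA : A.IsSymm)
    (hP : P.IsSymm) (hP0 : ∀ ξ : ι → ℝ, 0 ≤ ∑ i, ∑ j, P i j * ξ i * ξ j)
    (heq : sigF α m (A + P : Matrix ι ι ℝ) ≤ sigF α m A) : P = 0 := by
  obtain ⟨U, d, hU, hU', hPd⟩ := exists_orthogonal_diagonalization hP
  set V : ι → ι → ℝ := fun l i => U i l with hV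
  have hsum : P = ∑ l, d l • Matrix.vecMulVec (V l) (V l) := by
    ext i j
    rw [hPd, Matrix.sum_apply]
    simp only [Matrix.mul_apply, Matrix.diagonal_apply, Matrix.transpose_apply, Matrix.smul_apply,
      Matrix.vecMulVec_apply, smul_eq_mul, hV]
    refine Finset.sum_congr rfl fun l _ => ?_
    simp
    ring
  have horth : ∀ l l', ∑ i, U i l * U i l' = if l = l' then 1 else 0 := by
    intro l l'
    have := congrFun (congrFun hU l) l'
    simpa [Matrix.mul_apply, Matrix.one_apply] using this
  have hd : ∀ l, 0 ≤ d l := by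
    intro l
    have h1 := hP0 (V l)
    have h2 : ∑ i, ∑ j, P i j * V l i * V l j = d l := by
      have h3 : U.transpose * P * U = Matrix.diagonal d := by
        rw [hPd]
        calc _ = (U.transpose * U) * Matrix.diagonal d * (U.transpose * U) := by
                simp only [Matrix.mul_assoc]
            _ = _ := by rw [hU]; simp
      have h4 := congrFun (congrFun h3 l) l
      simp only [Matrix.mul_apply, Matrix.transpose_apply, Matrix.diagonal_apply_eq] at h4
      rw [← h4, Finset.sum_comm]
      refine Finset.sum_congr rfl fun i _ => ?_
      rw [Finset.sum_mul]
      refine Finset.sum_congr rfl fun j _ => ?_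
      simp only [hV]; ring
    rwa [h2] at h1
  have hstep : ∀ T : Finset ι, gardM (m + 2) (A + ∑ l ∈ T, d l • Matrix.vecMulVec (V l) (V l) : Matrix ι ι ℝ) ∧
      (A + ∑ l ∈ T, d l • Matrix.vecMulVec (V l) (V l) : Matrix ι ι ℝ).IsSymm ∧
      (sigF α m A ≤ sigF α m (A + ∑ l ∈ T, d l • Matrix.vecMulVec (V l) (V l) : Matrix ι ι ℝ)) ∧
      ((∃ l ∈ T, 0 < d l) → sigF α m A < sigF α m (A + ∑ l ∈ T, d l • Matrix.vecMulVec (V l) (V l) : Matrix ι ι ℝ)) := by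
    intro T
    induction T using Finset.induction_on with
    | empty => simpa using ⟨h, hA⟩
    | insert a T ha ih =>
      obtain ⟨i1, i2, i3, i4⟩ := ih
      have := i1.add_rank_one i2 (V a) (hd a)
      have hF := add_le_add (this.2.1 (m + 2) le_rfl)
        (mul_le_mul_of_nonneg_left (this.2.1 (m + 1) (by omega)) hα)
      rw [Finset.sum_insert ha, add_comm (d a • _), ← add_assoc]
      refine ⟨this.1, ?_, i3.trans hF, ?_⟩
      · rw [Matrix.IsSymm, Matrix.transpose_add, i2]
        congr 1
        ext i j; simp [Matrix.vecMulVec_apply, mul_comm]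
      · rintro ⟨l, hl, hdl⟩
        rcases Finset.mem_insert.1 hl with rfl | hl
        · refine i3.trans_lt (add_lt_add_of_lt_of_le (this.2.2 ⟨hdl, fun h0 => ?_⟩ (m + 1) (by omega))
            (mul_le_mul_of_nonneg_left (this.2.1 (m + 1) (by omega)) hα))
          have := horth l l
          have h1 : ∀ i, U i l = 0 := fun i => congrFun h0 i
          simp [h1] at this
        · exact (i4 ⟨l, hl, hdl⟩).trans_le hF
  have hz : ∀ l, d l = 0 := by
    intro l
    by_contra hne
    have := (hstep Finset.univ).2.2.2 ⟨l, Finset.mem_univ l, lt_of_le_of_ne (hd l) (Ne.symm hne)⟩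
    rw [← hsum] at this
    exact absurd heq (not_le.2 this)
  rw [hsum]
  simp [hz]

end RankOne

section VectorEstimates
variable {ι : Type*} [DecidableEq ι]

theorem garding.esym_succ_le {T : Finset ι} {k : ℕ} {x : ι → ℝ} (h : garding T k x) :
    ∀ j ≤ k, esym T x (j + 1) ≤ esym T x 1 * esym T x j := by
  intro j
  induction j with
  | zero => intro _; simp
  | succ j ih =>
    intro hj
    have h1 := ih (by omega)
    have h2 := newton_esym' T x j
    have p0 := h j (by omega)
    have p1 := h (j + 1) hj
    refine le_of_mul_le_mul_left ?_ p0
    calc esym T x j * esym T x (j + 2) ≤ esym T x (j + 1) * esym T x (j + 1) := by rw [← sq]; exact h2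
      _ ≤ esym T x (j + 1) * (esym T x 1 * esym T x j) := mul_le_mul_of_nonneg_left h1 p1.le
      _ = _ := by ring

theorem garding.esym_le_pow {T : Finset ι} {k : ℕ} {x : ι → ℝ} (h : garding T (k + 1) x) :
    ∀ j ≤ k + 1, esym T x j ≤ esym T x 1 ^ j := by
  intro j
  induction j with
  | zero => intro _; simp
  | succ j ih =>
    intro hj
    refine (h.esym_succ_le j (by omega)).trans ?_
    rw [pow_succ']
    exact mul_le_mul_of_nonneg_left (ih (by omega)) (h 1 (by omega)).le

theorem garding.ratio_le {T : Finset ι} {k : ℕ} {x : ι → ℝ} (h : garding T k x) {ρ : ℝ}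
    (hρ : ρ * esym T x k ≤ esym T x (k + 1)) : ∀ j ≤ k, ρ * esym T x j ≤ esym T x (j + 1) := by
  intro j hj
  obtain ⟨d, rfl⟩ := Nat.exists_eq_add_of_le hj
  clear hj
  induction d with
  | zero => simpa using hρ
  | succ d ih =>
    have p0 := h (j + d) (by omega)
    have p1 := h (j + d + 1) (by omega)
    refine ih (h.mono (by omega)) ?_
    have h2 := newton_esym' T x (j + d)
    have hρ' : ρ * esym T x (j + d + 1) ≤ esym T x (j + d + 2) := hρ
    refine le_of_mul_le_mul_left ?_ p1
    have := mul_le_mul_of_nonneg_left hρ' p0.le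
    nlinarith

theorem garding.pow_le {T : Finset ι} {k : ℕ} {x : ι → ℝ} (h : garding T k x) {ρ : ℝ} (h0 : 0 ≤ ρ)
    (hρ : ρ * esym T x k ≤ esym T x (k + 1)) : ∀ j ≤ k + 1, ρ ^ j ≤ esym T x j := by
  intro j
  induction j with
  | zero => intro _; simp
  | succ j ih =>
    intro hj
    refine le_trans ?_ (h.ratio_le hρ j (by omega))
    rw [pow_succ']
    exact mul_le_mul_of_nonneg_left (ih (by omega)) h0

theorem le_max_of_pow_le {ρ C : ℝ} (m : ℕ) (h : ρ ^ (m + 1) ≤ C) : ρ ≤ max 1 C := by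
  rcases le_or_gt ρ 1 with h1 | h1
  · exact h1.trans (le_max_left _ _)
  · exact ((le_self_pow₀ h1.le (by omega)).trans h).trans (le_max_right _ _)

variable [Fintype ι] {α : ℝ} {m : ℕ} {x : ι → ℝ}

theorem esym_pred_le (hα : 0 < α) (h : garding Finset.univ (m + 2) x)
    (hF : hsym α Finset.univ x (m + 2) = 1) :
    esym Finset.univ x (m + 2) ≤ 1 ∧ esym Finset.univ x (m + 1) ≤ 1 / α := by
  rw [hsym_succ] at hF
  have h1 := h (m + 2) le_rfl
  have h2 := h (m + 1) (by omega)
  refine ⟨by nlinarith, ?_⟩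
  rw [le_div_iff₀ hα]
  have : esym Finset.univ x (m + 1 + 1) = esym Finset.univ x (m + 2) := rfl
  linarith

theorem fst1_eq (x : ι → ℝ) (i : ι) : fst1 α m x i =
    esym (Finset.univ.erase i) x (m + 1) + α * esym (Finset.univ.erase i) x m := by
  rw [fst1, hsym_succ, Finset.compl_singleton]

theorem fst1_pos (hα : 0 ≤ α) (h : garding Finset.univ (m + 2) x) (i : ι) : 0 < fst1 α m x i := by
  have := (h.erase (Finset.mem_univ i)).hsym_pos hα (m + 1) le_rfl
  rwa [fst1, Finset.compl_singleton]

theorem snd2_pos (hα : 0 ≤ α) (h : garding Finset.univ (m + 2) x) {i j : ι} (hij : i ≠ j) :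
    0 < snd2 α m x i j := by
  have := ((h.erase (Finset.mem_univ i)).erase
    (Finset.mem_erase.2 ⟨hij.symm, Finset.mem_univ j⟩)).hsym_pos hα m le_rfl
  rw [snd2]
  convert this using 2
  ext a; simp [and_comm]

theorem fst1_sub (x : ι → ℝ) {p i : ι} (hpi : p ≠ i) :
    fst1 α m x i = fst1 α m x p + snd2 α m x p i * (x p - x i) := by
  have e1 := hsym_erase (α := α) (T := {i}ᶜ) (i := p) (by simpa using hpi) x m
  have e2 := hsym_erase (α := α) (T := {p}ᶜ) (i := i) (by simpa using hpi.symm) x m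
  have s1 : ({i}ᶜ : Finset ι).erase p = {p, i}ᶜ := by ext a; simp
  have s2 : ({p}ᶜ : Finset ι).erase i = {p, i}ᶜ := by ext a; simp; tauto
  rw [s1] at e1; rw [s2] at e2
  rw [fst1, fst1, e1, e2, snd2]; ring

theorem sum_fst1_mul_le (hα : 0 < α) (h : garding Finset.univ (m + 2) x)
    (hF : hsym α Finset.univ x (m + 2) = 1) : ∑ i, fst1 α m x i * x i ≤ m + 2 := by
  have e1 := esym_sum_mul_erase Finset.univ x (m + 1)
  have e2 := esym_sum_mul_erase Finset.univ x m
  have : ∑ i, fst1 α m x i * x i = ((m + 1 : ℕ) + 1) * esym Finset.univ x (m + 1 + 1) +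
      α * (((m : ℝ) + 1) * esym Finset.univ x (m + 1)) := by
    rw [← e1, ← e2, Finset.mul_sum, ← Finset.sum_add_distrib]
    refine Finset.sum_congr rfl fun i _ => ?_
    rw [fst1_eq]; ring
  rw [this]
  rw [hsym_succ] at hF
  have h1 := h (m + 2) le_rfl
  have h2 := mul_pos hα (h (m + 1) (by omega))
  push_cast
  nlinarith

/-- Lower bound for the eigenvalues. -/
theorem eigenvalue_lower_bound (hα : 0 < α) (h : garding Finset.univ (m + 2) x)
    (hF : hsym α Finset.univ x (m + 2) = 1) (i : ι) :
    -max 1 ((Fintype.card ι + 1) / α) ≤ x i := by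
  rcases le_or_gt 0 (x i) with h0 | h0
  · exact (neg_nonpos.2 (zero_le_one.trans (le_max_left _ _))).trans h0
  set T := Finset.univ.erase i
  have hμ : garding T (m + 1) x := h.erase (Finset.mem_univ i)
  have e2 := esym_erase (Finset.mem_univ i) x (m + 1)
  have e1 := esym_erase (Finset.mem_univ i) x m
  have p2 := h (m + 2) le_rfl
  have q1 := hμ (m + 1) le_rfl
  have q0 := hμ m (by omega)
  have hle := (esym_pred_le hα h hF).2
  have N1 := newton_esym T x m
  have hρ : (-x i) * esym T x (m + 1) ≤ esym T x (m + 1 + 1) := by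
    change 0 < esym Finset.univ x (m + 1 + 1) at p2
    rw [e2] at p2; linarith
  have hc : (T.card : ℝ) + 1 ≤ Fintype.card ι + 1 := by
    have := Finset.card_le_univ T
    have : (T.card : ℝ) ≤ Fintype.card ι := by exact_mod_cast this
    linarith
  have hT : (0 : ℝ) ≤ T.card := Nat.cast_nonneg _
  have h4 : ((T.card : ℝ) + 1) * (-x i * esym T x m) ≤ T.card * esym T x (m + 1) := by
    refine le_of_mul_le_mul_right ?_ q1
    have := mul_le_mul_of_nonneg_left hρ (mul_nonneg (by linarith : 0 ≤ (T.card : ℝ) + 1) q0.le)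
    have e : esym T x (m + 1 + 1) = esym T x (m + 2) := rfl
    rw [e] at this
    nlinarith
  have h5 : esym T x (m + 1) ≤ (Fintype.card ι + 1) / α := by
    have : esym T x (m + 1) ≤ (T.card + 1) * esym Finset.univ x (m + 1) := by
      rw [e1]; nlinarith
    refine this.trans ?_
    rw [div_eq_mul_one_div]
    exact mul_le_mul hc hle (h (m + 1) (by omega)).le (by positivity)
  have h6 := hμ.pow_le (neg_nonneg.2 h0.le) hρ (m + 1) (by omega)
  have := le_max_of_pow_le m (h6.trans h5)
  linarith

theorem ratio_bound (hα : 0 < α) (h : garding Finset.univ (m + 2) x)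
    (hF : hsym α Finset.univ x (m + 2) = 1) {p : ι} (hp : 0 ≤ x p) :
    esym (Finset.univ.erase p) x (m + 1) ≤ max 1 (1 / α) * esym (Finset.univ.erase p) x m := by
  set T := Finset.univ.erase p
  have hμ : garding T (m + 1) x := h.erase (Finset.mem_univ p)
  have e1 := esym_erase (Finset.mem_univ p) x m
  have q1 := hμ (m + 1) le_rfl
  have q0 := hμ m (by omega)
  have hle := (esym_pred_le hα h hF).2
  have hr := (hμ.mono (show m ≤ m + 1 by omega)).pow_le (ρ := esym T x (m + 1) / esym T x m)
    (by positivity) (by rw [div_mul_cancel₀ _ q0.ne']) (m + 1) le_rfl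
  have := le_max_of_pow_le m (hr.trans (show _ ≤ 1 / α by
    have := mul_nonneg hp q0.le
    linarith))
  rwa [div_le_iff₀ q0] at this

theorem fst1_mul_le (hα : 0 < α) (h : garding Finset.univ (m + 2) x)
    (hF : hsym α Finset.univ x (m + 2) = 1) {p : ι} (hp : 0 ≤ x p) :
    fst1 α m x p * x p ≤ max 1 (1 / α) / α + 1 := by
  have hr := ratio_bound hα h hF hp
  have hμ := h.erase (Finset.mem_univ p)
  have e1 := esym_erase (Finset.mem_univ p) x m
  have q1 := hμ (m + 1) le_rfl
  have q0 := hμ m (by omega)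
  have hle := (esym_pred_le hα h hF).2
  rw [fst1_eq]
  set a := esym (Finset.univ.erase p) x m
  set b := esym (Finset.univ.erase p) x (m + 1)
  set R := max 1 (1 / α)
  have hR : 0 ≤ R := zero_le_one.trans (le_max_left _ _)
  have h1 : x p * a ≤ 1 / α := by linarith
  have h2 : b * x p ≤ R / α := by
    calc b * x p ≤ R * a * x p := mul_le_mul_of_nonneg_right hr hp
      _ = R * (x p * a) := by ring
      _ ≤ R * (1 / α) := mul_le_mul_of_nonneg_left h1 hR
      _ = _ := by ring
  have h3 : α * (x p * a) ≤ 1 := by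
    calc _ ≤ α * (1 / α) := mul_le_mul_of_nonneg_left h1 hα.le
      _ = 1 := by field_simp
  nlinarith

theorem one_le_mul_esym (hα : 0 < α) (h : garding Finset.univ (m + 2) x)
    (hF : hsym α Finset.univ x (m + 2) = 1) (i : ι) {S : ℝ}
    (hS : esym (Finset.univ.erase i) x (m + 1) ≤ S * esym (Finset.univ.erase i) x m)
    (hxi : 0 ≤ |x i|) :
    1 ≤ (S ^ 2 + (|x i| + α) * S + α * |x i|) * esym (Finset.univ.erase i) x m := by
  have hμ := h.erase (Finset.mem_univ i)
  have q1 := hμ (m + 1) le_rfl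
  have q0 := hμ m (by omega)
  have e1 := esym_erase (Finset.mem_univ i) x m
  have e2 := esym_erase (Finset.mem_univ i) x (m + 1)
  have N1 := newton_esym' (Finset.univ.erase i) x m
  rw [hsym_succ, e1, e2] at hF
  change esym (Finset.univ.erase i) x (m + 2) + _ + _ = 1 at hF
  set a := esym (Finset.univ.erase i) x m
  set b := esym (Finset.univ.erase i) x (m + 1)
  set c := esym (Finset.univ.erase i) x (m + 2)
  have hS0 : 0 ≤ S := by
    by_contra hneg
    nlinarith
  have hc : c ≤ S ^ 2 * a := by
    refine le_of_mul_le_mul_left ?_ q0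
    have := mul_le_mul hS hS q1.le (by positivity)
    nlinarith
  have hx := le_abs_self (x i)
  have h1 : (x i + α) * b ≤ (|x i| + α) * (S * a) :=
    (mul_le_mul_of_nonneg_right (by linarith) q1.le).trans
      (mul_le_mul_of_nonneg_left hS (by positivity))
  have h2 : α * (x i * a) ≤ α * (|x i| * a) :=
    mul_le_mul_of_nonneg_left (mul_le_mul_of_nonneg_right hx q0.le) hα.le
  nlinarith

/-- Uniform ellipticity on bounded sets of eigenvalues. -/
theorem exists_ellipticity (ι : Type*) [Fintype ι] [DecidableEq ι] {α : ℝ} (hα : 0 < α) (m : ℕ)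
    {Λ : ℝ} (hΛ : 0 < Λ) :
    ∃ c > 0, ∃ C > 0, ∀ x : ι → ℝ, garding Finset.univ (m + 2) x →
      hsym α Finset.univ x (m + 2) = 1 → (∀ i, |x i| ≤ Λ) → ∀ i, c ≤ fst1 α m x i ∧
      fst1 α m x i ≤ C := by
  set S : ℝ := (Fintype.card ι + 1) * Λ with hS
  have hS0 : 0 < S := by positivity
  refine ⟨α / (S ^ 2 + (Λ + α) * S + α * Λ), by positivity, S ^ (m + 1) + α * S ^ m,
    by positivity, fun x h hF hx i => ?_⟩
  have hμ := h.erase (Finset.mem_univ i)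
  have q1 := hμ (m + 1) le_rfl
  have q0 := hμ m (by omega)
  have hs1 : esym (Finset.univ.erase i) x 1 ≤ S := by
    rw [esym_one]
    calc ∑ j ∈ Finset.univ.erase i, x j ≤ ∑ j ∈ Finset.univ.erase i, Λ :=
          Finset.sum_le_sum fun j _ => (le_abs_self _).trans (hx j)
      _ = (Finset.univ.erase i).card * Λ := by simp
      _ ≤ S := by
        rw [hS]
        refine mul_le_mul_of_nonneg_right ?_ hΛ.le
        have : ((Finset.univ.erase i).card : ℝ) ≤ Fintype.card ι := by
          exact_mod_cast Finset.card_le_univ _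
        linarith
  have hp1 : 0 ≤ esym (Finset.univ.erase i) x 1 := (hμ 1 (by omega)).le
  have hb := (hμ.esym_succ_le m (by omega)).trans (mul_le_mul_of_nonneg_right hs1 q0.le)
  have h1 := one_le_mul_esym hα h hF i hb (abs_nonneg _)
  rw [fst1_eq]
  constructor
  · rw [div_le_iff₀ (by positivity)]
    have h2 : (S ^ 2 + (|x i| + α) * S + α * |x i|) ≤ S ^ 2 + (Λ + α) * S + α * Λ := by
      have := hx i
      nlinarith
    have h3 := h1.trans (mul_le_mul_of_nonneg_right h2 q0.le)
    have hX : 0 ≤ S ^ 2 + (Λ + α) * S + α * Λ := by positivity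
    nlinarith [mul_nonneg q1.le hX]
  · exact add_le_add ((hμ.esym_le_pow (m + 1) le_rfl).trans (pow_le_pow_left₀ hp1 hs1 _))
      (mul_le_mul_of_nonneg_left ((hμ.esym_le_pow m (by omega)).trans
        (pow_le_pow_left₀ hp1 hs1 _)) hα.le)

theorem le_sum_fst1 (hα : 0 < α) (h : garding Finset.univ (m + 2) x) :
    α * esym Finset.univ x m ≤ ∑ i, fst1 α m x i := by
  have hc : m + 2 ≤ Fintype.card ι := by
    by_contra hlt
    have := h (m + 2) le_rfl
    rw [esym_of_card_lt x (by simpa using hlt)] at this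
    exact lt_irrefl _ this
  have e := esym_sum_erase Finset.univ x m
  have hc' : (m : ℝ) + 2 ≤ (Finset.univ : Finset ι).card := by
    rw [Finset.card_univ]; exact_mod_cast hc
  have p0 := h m (by omega)
  calc α * esym Finset.univ x m ≤ α * ∑ i, esym (Finset.univ.erase i) x m := by
        rw [e]; exact mul_le_mul_of_nonneg_left (by nlinarith) hα.le
    _ ≤ _ := by
        rw [Finset.mul_sum]
        refine Finset.sum_le_sum fun i _ => ?_
        rw [fst1_eq]
        have := h.erase (Finset.mem_univ i) (m + 1) le_rfl
        linarith

/-- Large eigenvalues force a large trace of the linearised operator. -/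
theorem exists_eigenvalue_le_trace (ι : Type*) [Fintype ι] [DecidableEq ι] {α : ℝ} (hα : 0 < α)
    (m : ℕ) :
    ∃ C > 0, ∀ x : ι → ℝ, garding Finset.univ (m + 2) x →
      hsym α Finset.univ x (m + 2) = 1 → ∀ p, 1 ≤ x p →
      x p ≤ C * (∑ i, fst1 α m x i) ^ m := by
  set R := max 1 (1 / α)
  have hR : 1 ≤ R := le_max_left _ _
  rcases m with _ | q
  · refine ⟨1 / α, by positivity, fun x h hF p hp => ?_⟩
    have h1 := (esym_pred_le hα h hF).2
    have e1 := esym_erase (Finset.mem_univ p) x 0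
    have := h.erase (Finset.mem_univ p) 1 le_rfl
    rw [esym_zero] at e1
    simp only [zero_add] at *
    simp only [pow_zero, mul_one]
    linarith
  · set D := R ^ 2 + (1 + α) * R + α with hD
    have hD0 : 0 < D := by positivity
    refine ⟨D ^ q / α ^ (q + 1), by positivity, fun x h hF p hp => ?_⟩
    have hp0 : 0 ≤ x p := by linarith
    set T := Finset.univ.erase p
    have hμ : garding T (q + 1 + 1) x := h.erase (Finset.mem_univ p)
    have q1 := hμ (q + 1) (by omega)
    have q0 := hμ q (by omega)
    have hr := ratio_bound hα h hF hp0
    have h1 := one_le_mul_esym hα h hF p hr (abs_nonneg _)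
    rw [abs_of_nonneg hp0] at h1
    have h2 : 1 ≤ D * (x p * esym T x (q + 1)) := by
      refine h1.trans ?_
      rw [← mul_assoc]
      refine mul_le_mul_of_nonneg_right ?_ q1.le
      rw [hD]
      nlinarith [mul_nonneg (sub_nonneg.2 hp) (sq_nonneg R),
        mul_nonneg (sub_nonneg.2 hp) (mul_nonneg hα.le (zero_le_one.trans hR))]
    have h3 : esym T x (q + 1) ^ q ≤ esym T x q ^ (q + 1) := by
      set r := esym T x (q + 1) / esym T x q
      have hr0 : 0 ≤ r := by positivity
      have hrq := (hμ.mono (show q ≤ q + 1 + 1 by omega)).pow_le (ρ := r) hr0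
        (by rw [div_mul_cancel₀ _ q0.ne']) q (by omega)
      have e : esym T x (q + 1) = r * esym T x q := by rw [div_mul_cancel₀ _ q0.ne']
      rw [e, mul_pow, pow_succ']
      exact mul_le_mul_of_nonneg_right hrq (by positivity)
    have h4 : x p * esym T x q ≤ esym Finset.univ x (q + 1) := by
      rw [esym_erase (Finset.mem_univ p) x q]; linarith
    have h5 := (mul_le_mul_of_nonneg_left h4 hα.le).trans (le_sum_fst1 hα h)
    have h6 : x p ≤ D ^ q * (x p * esym T x q) ^ (q + 1) := by
      calc x p ≤ x p * (D * (x p * esym T x (q + 1))) ^ q :=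
            le_mul_of_one_le_right hp0 (one_le_pow₀ h2)
        _ = D ^ q * (x p ^ (q + 1) * esym T x (q + 1) ^ q) := by rw [mul_pow, mul_pow]; ring
        _ ≤ D ^ q * (x p ^ (q + 1) * esym T x q ^ (q + 1)) := by gcongr
        _ = _ := by rw [mul_pow]
    rw [div_mul_eq_mul_div, le_div_iff₀ (by positivity)]
    calc x p * α ^ (q + 1) ≤ D ^ q * (x p * esym T x q) ^ (q + 1) * α ^ (q + 1) := by gcongr
      _ = D ^ q * (α * (x p * esym T x q)) ^ (q + 1) := by rw [mul_pow α]; ring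
      _ ≤ _ := by gcongr

end VectorEstimates

section Calculus
open Filter Topology Asymptotics
open scoped ContDiff
variable {E : Type*} [NormedAddCommGroup E] [NormedSpace ℝ E]

theorem two_le_infty : (2 : WithTop ℕ∞) ≤ ∞ := by
  exact WithTop.coe_le_coe.2 (le_top : (2 : ℕ∞) ≤ ⊤)

/-- Directional derivative along a fixed vector. -/
noncomputable def dd (e : E) (f : E → ℝ) : E → ℝ := fun x => fderiv ℝ f x e

theorem ContDiff.dd {f : E → ℝ} (hf : ContDiff ℝ ∞ f) (e : E) : ContDiff ℝ ∞ (dd e f) :=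
  (hf.fderiv_right (m := ∞) (by simp)).clm_apply contDiff_const

theorem dd_comm {f : E → ℝ} (hf : ContDiff ℝ ∞ f) (a b : E) : dd a (dd b f) = dd b (dd a f) := by
  funext x
  have hd : DifferentiableAt ℝ (fderiv ℝ f) x :=
    ((hf.fderiv_right (m := ∞) (by simp)).differentiable (by simp)) x
  have key : ∀ a b : E, dd a (dd b f) x = fderiv ℝ (fderiv ℝ f) x a b := by
    intro a b
    unfold dd
    rw [fderiv_clm_apply hd (differentiableAt_const b)]
    simp
  rw [key, key]
  exact (hf.contDiffAt.isSymmSndFDerivAt (by simpa using two_le_infty)) a b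

theorem dd_sum_left {ι : Type*} (s : Finset ι) (c : ι → ℝ) (e : ι → E) (f : E → ℝ) (x : E) :
    dd (∑ i ∈ s, c i • e i) f x = ∑ i ∈ s, c i * dd (e i) f x := by
  simp [dd, map_sum]

theorem dd_smul_left (c : ℝ) (e : E) (f : E → ℝ) : dd (c • e) f = fun x => c * dd e f x := by
  funext x; simp [dd]

theorem dd_add_left (a b : E) (f : E → ℝ) : dd (a + b) f = fun x => dd a f x + dd b f x := by
  funext x; simp [dd]

theorem dd_const_mul {f : E → ℝ} (hf : ContDiff ℝ ∞ f) (c : ℝ) (e : E) :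
    dd e (fun x => c * f x) = fun x => c * dd e f x := by
  funext x
  unfold dd
  rw [fderiv_const_mul (hf.differentiable (by simp) x)]
  simp

theorem dd_add {f g : E → ℝ} (hf : ContDiff ℝ ∞ f) (hg : ContDiff ℝ ∞ g) (e : E) :
    dd e (fun x => f x + g x) = fun x => dd e f x + dd e g x := by
  funext x
  unfold dd
  rw [fderiv_fun_add (hf.differentiable (by simp) x) (hg.differentiable (by simp) x)]
  simp

theorem dd_sub {f g : E → ℝ} (hf : ContDiff ℝ ∞ f) (hg : ContDiff ℝ ∞ g) (e : E) :
    dd e (fun x => f x - g x) = fun x => dd e f x - dd e g x := by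
  funext x
  unfold dd
  rw [fderiv_fun_sub (hf.differentiable (by simp) x) (hg.differentiable (by simp) x)]
  simp

theorem dd_const (c : ℝ) (e : E) : dd e (fun _ => c) = fun _ => 0 := by
  funext x; simp [dd]

theorem dd_sum {ι : Type*} (s : Finset ι) {f : ι → E → ℝ} (hf : ∀ i ∈ s, ContDiff ℝ ∞ (f i))
    (e : E) : dd e (fun x => ∑ i ∈ s, f i x) = fun x => ∑ i ∈ s, dd e (f i) x := by
  funext x
  unfold dd
  rw [fderiv_fun_sum fun i hi => (hf i hi).differentiable (by simp) x]
  simp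

theorem dd_dd_sum {ι κ : Type*} (s : Finset ι) (t : Finset κ) (c : ι → ℝ) (e : ι → E) (c' : κ → ℝ)
    (e' : κ → E) {f : E → ℝ} (hf : ContDiff ℝ ∞ f) (x : E) :
    dd (∑ i ∈ s, c i • e i) (dd (∑ j ∈ t, c' j • e' j) f) x =
      ∑ i ∈ s, ∑ j ∈ t, c i * c' j * dd (e i) (dd (e' j) f) x := by
  rw [dd_sum_left]
  refine Finset.sum_congr rfl fun i _ => ?_
  have : dd (∑ j ∈ t, c' j • e' j) f = fun x => ∑ j ∈ t, c' j * dd (e' j) f x :=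
    funext fun x => dd_sum_left _ _ _ _ _
  rw [this, dd_sum t (fun j _ => contDiff_const.mul (hf.dd _)), Finset.mul_sum]
  refine Finset.sum_congr rfl fun j _ => ?_
  rw [dd_const_mul (hf.dd _)]
  ring

theorem hasDerivAt_line {f : E → ℝ} (hf : ContDiff ℝ ∞ f) (x e : E) (s : ℝ) :
    HasDerivAt (fun s : ℝ => f (x + s • e)) (dd e f (x + s • e)) s := by
  have h1 : HasDerivAt (fun s : ℝ => x + s • e) e s := by
    simpa using ((hasDerivAt_id s).smul_const e).const_add x
  exact ((hf.differentiable (by simp) _).hasFDerivAt).comp_hasDerivAt s h1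

theorem taylor_line {f : E → ℝ} (hf : ContDiff ℝ ∞ f) (x e : E) :
    (fun s : ℝ => f (x + s • e) - f x - (s * dd e f x + s ^ 2 / 2 * dd e (dd e f) x))
      =o[𝓝 0] fun s => s ^ 2 := by
  have hg : ContDiff ℝ (2 : ℕ) fun s : ℝ => f (x + s • e) := by
    refine (hf.of_le two_le_infty).comp ?_
    fun_prop
  have := taylor_isLittleO_univ (x₀ := 0) hg
  have d1 : deriv (fun s : ℝ => f (x + s • e)) = fun s => dd e f (x + s • e) :=
    funext fun s => (hasDerivAt_line hf x e s).deriv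
  have d2 : deriv (fun s : ℝ => dd e f (x + s • e)) = fun s => dd e (dd e f) (x + s • e) :=
    funext fun s => (hasDerivAt_line (hf.dd e) x e s).deriv
  refine this.congr (fun s => ?_) (fun s => by simp)
  rw [taylor_within_apply]
  simp only [iteratedDerivWithin_univ, Finset.sum_range_succ, Finset.sum_range_zero,
    iteratedDeriv_zero, iteratedDeriv_succ, d1, d2]
  simp
  ring

variable {ι : Type*} [Fintype ι] [DecidableEq ι]

/-- The Hessian matrix in the frame `e`. -/
noncomputable def hess (e : ι → E) (u : E → ℝ) (x : E) : Matrix ι ι ℝ :=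
  Matrix.of fun i j => dd (e i) (dd (e j) u) x

theorem hess_apply (e : ι → E) (u : E → ℝ) (x : E) (i j : ι) :
    hess e u x i j = dd (e i) (dd (e j) u) x := rfl

theorem hess_isSymm (e : ι → E) {u : E → ℝ} (hu : ContDiff ℝ ∞ u) (x : E) :
    (hess e u x).IsSymm := by
  ext i j
  rw [Matrix.transpose_apply, hess_apply, hess_apply, dd_comm hu]

/-- The frame rotated by `U`. -/
noncomputable def rot (e : ι → E) (U : Matrix ι ι ℝ) (l : ι) : E := ∑ i, U i l • e i

theorem hess_rot (e : ι → E) (U : Matrix ι ι ℝ) {u : E → ℝ} (hu : ContDiff ℝ ∞ u) (x : E) :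
    hess (rot e U) u x = U.transpose * hess e u x * U := by
  ext p q
  rw [hess_apply, rot, rot, dd_dd_sum _ _ _ _ _ _ hu, Matrix.mul_apply, Finset.sum_comm]
  refine Finset.sum_congr rfl fun j _ => ?_
  rw [Matrix.mul_apply, Finset.sum_mul]
  refine Finset.sum_congr rfl fun i _ => ?_
  rw [hess_apply, Matrix.transpose_apply]; ring

theorem hess_rot_diag (e : ι → E) {U : Matrix ι ι ℝ} {u : E → ℝ} (hu : ContDiff ℝ ∞ u) {x : E}
    {d : ι → ℝ} (hU : U.transpose * U = 1)
    (hA : hess e u x = U * Matrix.diagonal d * U.transpose) :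
    hess (rot e U) u x = Matrix.diagonal d := by
  rw [hess_rot e U hu, hA]
  calc _ = (U.transpose * U) * Matrix.diagonal d * (U.transpose * U) := by
          simp only [Matrix.mul_assoc]
    _ = _ := by rw [hU]; simp

/-- Differentiating the equation twice in an eigenframe. -/
theorem solution_second_variation {e : ι → E} {u : E → ℝ} (hu : ContDiff ℝ ∞ u) {α : ℝ}
    (hα : 0 ≤ α) {m : ℕ} (hg : ∀ x, gardM (m + 2) (hess e u x))
    (hF : ∀ x, sigF α m (hess e u x) = 1) {x : E} {U : Matrix ι ι ℝ} {d : ι → ℝ}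
    (hU : U.transpose * U = 1) (hA : hess e u x = U * Matrix.diagonal d * U.transpose) (v : E) :
    ∑ i, fst1 α m d i * dd v (dd (rot e U i) (dd (rot e U i) u)) x = 0 ∧
    ∑ p ∈ Finset.univ.offDiag, snd2 α m d p.1 p.2 *
        dd v (dd (rot e U p.1) (dd (rot e U p.2) u)) x ^ 2 ≤
      ∑ i, fst1 α m d i * dd v (dd v (dd (rot e U i) (dd (rot e U i) u))) x := by
  set b := rot e U
  have hdiag := hess_rot_diag e hu hU hA
  refine second_variation (N := fun s i j => dd (b i) (dd (b j) u) (x + s • v) -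
    dd (b i) (dd (b j) u) x) (B := fun i j => dd v (dd (b i) (dd (b j) u)) x)
    (W := fun i j => dd v (dd v (dd (b i) (dd (b j) u))) x)
    (fun i j => taylor_line ((hu.dd _).dd _) x v) hα ((hg x).garding hU hA)
    (fun i j => by rw [dd_comm hu]) (fun s => ?_)
  have h1 : (fun i => d i • (Pi.single i 1 : ι → ℝ) + fun j => dd (b i) (dd (b j) u) (x + s • v) -
      dd (b i) (dd (b j) u) x) = hess b u (x + s • v) := by
    funext i j
    have h2 := congrFun (congrFun (diagonal_eq_smul_single d) i) j
    have h3 := congrFun (congrFun hdiag i) j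
    rw [hess_apply] at h3
    simp only [Pi.add_apply, hess_apply]
    rw [← h2, ← h3, add_sub_cancel]
  have h4 : ∀ y, sigF α m (hess b u y) = 1 := fun y => by
    rw [hess_rot e U hu]
    exact (sigF_conj α m _ _ _ hU).trans (hF y)
  have h5 : (fun i => d i • Pi.single i 1) = hess b u x := by
    rw [hdiag, ← diagonal_eq_smul_single d]
  exact (congrArg _ h1).trans ((h4 _).trans ((h4 x).symm.trans (congrArg _ h5.symm)))

theorem sum_linF_mul {α : ℝ} {m : ℕ} (e : ι → E) {A U : Matrix ι ι ℝ} {d : ι → ℝ}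
    (hU : U.transpose * U = 1) (hA : A = U * Matrix.diagonal d * U.transpose) {f : E → ℝ}
    (hf : ContDiff ℝ ∞ f) (x : E) :
    ∑ i, ∑ j, linF α m A i j * dd (e i) (dd (e j) f) x =
      ∑ l, fst1 α m d l * dd (rot e U l) (dd (rot e U l) f) x := by
  simp only [rot, dd_dd_sum _ _ _ _ _ _ hf, Finset.mul_sum]
  rw [Finset.sum_comm]
  conv_rhs => rw [Finset.sum_comm]
  rw [Finset.sum_comm]
  refine Finset.sum_congr rfl fun i _ => ?_
  rw [Finset.sum_comm]
  refine Finset.sum_congr rfl fun j _ => ?_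
  rw [linF_eq_of_diagonalization α m hU (mul_eq_one_comm.1 hU) hA, Finset.sum_mul]
  exact Finset.sum_congr rfl fun l _ => by ring

end Calculus

section OneVariable
open Filter Topology

theorem IsLocalMax.second_deriv_nonpos {g g' : ℝ → ℝ} {g'' : ℝ} (hm : IsLocalMax g 0)
    (h1 : ∀ᶠ s in 𝓝 0, HasDerivAt g (g' s) s) (h2 : HasDerivAt g' g'' 0) : g' 0 = 0 ∧ g'' ≤ 0 := by
  have h0 : g' 0 = 0 := hm.hasDerivAt_eq_zero h1.self_of_nhds
  refine ⟨h0, ?_⟩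
  by_contra! hpos
  have hd : deriv g =ᶠ[𝓝 0] g' := h1.mono fun s hs => hs.deriv
  have hdd : deriv (deriv g) 0 = g'' := by rw [hd.deriv_eq]; exact h2.deriv
  have hmin : IsLocalMin g 0 := isLocalMin_of_deriv_deriv_pos (by rw [hdd]; exact hpos)
    (by rw [hd.self_of_nhds, h0]) h1.self_of_nhds.continuousAt
  have hc : g =ᶠ[𝓝 0] fun _ => g 0 := by
    filter_upwards [hm, hmin] with s ha hb using le_antisymm ha hb
  have : deriv (deriv g) 0 = 0 := by
    rw [hc.deriv.deriv_eq]; simp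
  linarith

/-- Second derivative test for a local maximum of `w η^β exp φ`, in logarithmic form. -/
theorem log_second_deriv_test {w w' η η' φ φ' : ℝ → ℝ} {w'' η'' φ'' : ℝ} (β : ℕ)
    (hw : ∀ s, HasDerivAt w (w' s) s) (hw' : HasDerivAt w' w'' 0)
    (hη : ∀ s, HasDerivAt η (η' s) s) (hη' : HasDerivAt η' η'' 0)
    (hφ : ∀ s, HasDerivAt φ (φ' s) s) (hφ' : HasDerivAt φ' φ'' 0)
    (w0 : 0 < w 0) (η0 : 0 < η 0)
    (hm : IsLocalMax (fun s => η s ^ β * w s * Real.exp (φ s)) 0) :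
    w' 0 / w 0 + β * (η' 0 / η 0) + φ' 0 = 0 ∧
    w'' / w 0 - (w' 0 / w 0) ^ 2 + β * (η'' / η 0 - (η' 0 / η 0) ^ 2) + φ'' ≤ 0 := by
  have ew : ∀ᶠ s in 𝓝 0, 0 < w s := (hw 0).continuousAt.eventually (lt_mem_nhds w0)
  have eη : ∀ᶠ s in 𝓝 0, 0 < η s := (hη 0).continuousAt.eventually (lt_mem_nhds η0)
  have hlog : ∀ s, 0 < w s → 0 < η s → Real.log (η s ^ β * w s * Real.exp (φ s)) =
      Real.log (w s) + β * Real.log (η s) + φ s := by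
    intro s h1 h2
    rw [Real.log_mul (by positivity) (Real.exp_ne_zero _), Real.log_mul (by positivity) h1.ne',
      Real.log_pow, Real.log_exp]
    ring
  have hmax : IsLocalMax (fun s => Real.log (w s) + β * Real.log (η s) + φ s) 0 := by
    filter_upwards [hm, ew, eη] with s hs h1 h2
    rw [← hlog s h1 h2, ← hlog 0 w0 η0]
    exact Real.log_le_log (by positivity) hs
  have := hmax.second_deriv_nonpos (g' := fun s => w' s / w s + β * (η' s / η s) + φ' s)
    (g'' := (w'' * w 0 - w' 0 * w' 0) / w 0 ^ 2 + β * ((η'' * η 0 - η' 0 * η' 0) / η 0 ^ 2) + φ'')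
    (by
      filter_upwards [ew, eη] with s h1 h2
      exact (((hw s).log h1.ne').add (((hη s).log h2.ne').const_mul (β : ℝ))).add (hφ s))
    (((hw'.div (hw 0) w0.ne').add ((hη'.div (hη 0) η0.ne').const_mul (β : ℝ))).add hφ')
  refine ⟨this.1, le_of_eq_of_le ?_ this.2⟩
  field_simp

theorem le_of_second_deriv_le {h h' h'' : ℝ → ℝ} (h1 : ∀ s, HasDerivAt h (h' s) s)
    (h2 : ∀ s, HasDerivAt h' (h'' s) s) {M a : ℝ} (ha : 0 ≤ a)
    (hM : ∀ s ∈ Set.Icc 0 a, h'' s ≤ M) : h a ≤ h 0 + h' 0 * a + M * a ^ 2 / 2 := by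
  have A1 : AntitoneOn (fun s => h' s - M * s) (Set.Icc 0 a) := by
    have hd : ∀ s, HasDerivAt (fun s => h' s - M * s) (h'' s - M) s := fun s => by
      have e : HasDerivAt (fun s : ℝ => M * s) M s := by
        simpa using (hasDerivAt_id s).const_mul M
      exact (h2 s).sub e
    refine antitoneOn_of_deriv_nonpos (convex_Icc 0 a)
      (fun s _ => (hd s).continuousAt.continuousWithinAt)
      (fun s _ => (hd s).differentiableAt.differentiableWithinAt) fun s hs => ?_
    rw [(hd s).deriv]
    have := hM s (interior_subset hs); linarith
  have A2 : AntitoneOn (fun s => h s - h' 0 * s - M * s ^ 2 / 2) (Set.Icc 0 a) := by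
    have hd : ∀ s, HasDerivAt (fun s => h s - h' 0 * s - M * s ^ 2 / 2) (h' s - h' 0 - M * s) s :=
      fun s => by
      have e1 : HasDerivAt (fun s : ℝ => M * s ^ 2 / 2) (M * (2 * s) / 2) s := by
        simpa using ((hasDerivAt_pow 2 s).const_mul M).div_const 2
      have e2 : HasDerivAt (fun s : ℝ => h' 0 * s) (h' 0) s := by
        simpa using (hasDerivAt_id s).const_mul (h' 0)
      exact (((h1 s).sub e2).sub e1).congr_deriv (by ring)
    refine antitoneOn_of_deriv_nonpos (convex_Icc 0 a)
      (fun s _ => (hd s).continuousAt.continuousWithinAt)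
      (fun s _ => (hd s).differentiableAt.differentiableWithinAt) fun s hs => ?_
    rw [(hd s).deriv]
    have := A1 ⟨le_rfl, ha⟩ (interior_subset hs) (interior_subset hs).1
    simp only at this
    linarith
  have := A2 ⟨le_rfl, ha⟩ ⟨ha, le_rfl⟩ ha
  simp only at this
  nlinarith

/-- A function whose second derivative is controlled on its initial sublevel set
descends by a definite amount. -/
theorem descent_one_variable {h h' h'' : ℝ → ℝ} (h1 : ∀ s, HasDerivAt h (h' s) s)
    (h2 : ∀ s, HasDerivAt h' (h'' s) s) {G K : ℝ} (hK : 0 < K) (hG : 0 < G) (h0 : h' 0 = -G)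
    (hM : ∀ s, h s ≤ h 0 → h'' s ≤ K * G) : h (1 / K) ≤ h 0 - G / (2 * K) := by
  have key : ∀ a, 0 ≤ a → a ≤ 1 / K → (∀ s ∈ Set.Icc 0 a, h s ≤ h 0) →
      h a ≤ h 0 - G * a / 2 := by
    intro a ha haK hs
    have := le_of_second_deriv_le h1 h2 ha fun s h3 => hM s (hs s h3)
    rw [h0] at this
    have hKa : K * a ≤ 1 := by rw [le_div_iff₀ hK] at haK; linarith
    nlinarith [mul_nonneg (mul_nonneg hG.le ha) (sub_nonneg.2 hKa)]
  have hcont : Continuous h := continuous_iff_continuousAt.2 fun s => (h1 s).continuousAt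
  have hle : ∀ s ∈ Set.Icc 0 (1 / K), h s ≤ h 0 := by
    by_contra! hcon
    obtain ⟨s0, hs0, hgt⟩ := hcon
    -- just after `0`, `h` lies strictly below `h 0`
    have hneg : ∀ᶠ s in 𝓝[>] (0 : ℝ), h s < h 0 := by
      have := (h1 0).tendsto_slope_zero_right
      rw [h0] at this
      filter_upwards [this.eventually (gt_mem_nhds (show -G < 0 by linarith)),
        self_mem_nhdsWithin] with s hs hs'
      simp only [zero_add, smul_eq_mul] at hs
      have hs'' : (0 : ℝ) < s := hs'
      by_contra! h4
      exact absurd hs (not_lt.2 (mul_nonneg (inv_nonneg.2 hs''.le) (sub_nonneg.2 h4)))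
    obtain ⟨ε, hε, hεs⟩ := mem_nhdsGT_iff_exists_Ioo_subset.1 hneg
    have hε0 : (0 : ℝ) < ε := hε
    set S := Set.Icc ε s0 ∩ {s | h 0 ≤ h s} with hS
    have hεs0 : ε ≤ s0 := by
      by_contra! hlt
      rcases hs0.1.eq_or_lt with h3 | h3
      · rw [← h3] at hgt; exact lt_irrefl _ hgt
      · exact absurd (hεs ⟨h3, hlt⟩) (not_lt.2 hgt.le)
    have hSc : IsCompact S := isCompact_Icc.inter_right (isClosed_le continuous_const hcont)
    obtain ⟨a, ha, hamin⟩ := hSc.exists_isLeast ⟨s0, ⟨hεs0, le_rfl⟩, hgt.le⟩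
    have ha0 : 0 < a := hε0.trans_le ha.1.1
    have hbelow : ∀ s ∈ Set.Ico 0 a, h s ≤ h 0 := by
      intro s hs
      rcases hs.1.eq_or_lt with h3 | h3
      · rw [← h3]
      · rcases lt_or_ge s ε with h4 | h4
        · exact (hεs ⟨h3, h4⟩).le
        · by_contra! h5
          exact absurd (hamin ⟨⟨h4, hs.2.le.trans ha.1.2⟩, h5.le⟩) (not_le.2 hs.2)
    have hclos : ∀ s ∈ Set.Icc 0 a, h s ≤ h 0 := by
      intro s hs
      have : closure (Set.Ico 0 a) ⊆ {s | h s ≤ h 0} :=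
        closure_minimal hbelow (isClosed_le hcont continuous_const)
      rw [closure_Ico ha0.ne] at this
      exact this hs
    have h6 := key a ha0.le (ha.1.2.trans hs0.2) hclos
    have h7 : h 0 ≤ h a := ha.2
    nlinarith [mul_pos hG ha0]
  have := key (1 / K) (by positivity) le_rfl hle
  convert this using 2
  field_simp

end OneVariable

section PogorelovAlgebra
variable {ι : Type*} [Fintype ι] [DecidableEq ι]

theorem pogorelov_term {f fp c l di y z x β : ℝ} (hf : 0 < f) (hfp : 0 < fp) (hc : 0 < c)
    (hl : 0 < l) (hdi : -l / 4 ≤ di) (hrel : f = fp + c * (l - di)) (hβ : 8 ≤ β)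
    (hy : y = β * z - x) :
    -(2 / β) * f * x ^ 2 - fp * (4 * β ^ 2 * z ^ 2 + 4 * x ^ 2) ≤
      2 * c * l * y ^ 2 - f * y ^ 2 - β * f * z ^ 2 := by
  have hβ0 : 0 < β := by linarith
  have h1 : β * z ^ 2 ≤ 2 / β * (y ^ 2 + x ^ 2) := by
    have hz : z = (y + x) / β := by rw [hy]; field_simp; ring
    have : β * z ^ 2 = (y + x) ^ 2 / β := by rw [hz]; field_simp
    rw [this, div_mul_eq_mul_div]
    refine div_le_div_of_nonneg_right ?_ hβ0.le
    nlinarith [sq_nonneg (y - x)]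
  have h2 : 2 / β ≤ 1 / 4 := by rw [div_le_div_iff₀ hβ0 (by norm_num)]; linarith
  have h3 : 8 / 5 * (f - fp) ≤ 2 * c * l := by
    have : f - fp = c * (l - di) := by linarith
    rw [this]; nlinarith
  have h4 : y ^ 2 ≤ 2 * β ^ 2 * z ^ 2 + 2 * x ^ 2 := by
    rw [hy]; nlinarith [sq_nonneg (β * z + x)]
  have h5 := mul_le_mul_of_nonneg_left h1 hf.le
  have h6 := mul_le_mul_of_nonneg_right h3 (sq_nonneg y)
  have h7 := mul_le_mul_of_nonneg_left h4 hfp.le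
  have h8 : 2 / β * (f * y ^ 2) ≤ 1 / 4 * (f * y ^ 2) :=
    mul_le_mul_of_nonneg_right h2 (by positivity)
  have h9 : 0 ≤ f * y ^ 2 := by positivity
  have h10 : 0 ≤ fp * (β ^ 2 * z ^ 2 + x ^ 2) := by positivity
  nlinarith

theorem pogorelov_term_self {fp y z x β : ℝ} (hfp : 0 < fp) (hβ : 8 ≤ β)
    (hy : y = β * z - x) :
    -(2 / β) * fp * x ^ 2 - fp * (4 * β ^ 2 * z ^ 2 + 4 * x ^ 2) ≤
      - fp * y ^ 2 - β * fp * z ^ 2 := by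
  have hβ0 : 0 < β := by linarith
  have h4 : y ^ 2 ≤ 2 * β ^ 2 * z ^ 2 + 2 * x ^ 2 := by
    rw [hy]; nlinarith [sq_nonneg (β * z + x)]
  have h7 := mul_le_mul_of_nonneg_left h4 hfp.le
  have h8 : 0 ≤ 2 / β * (fp * x ^ 2) := by positivity
  have h9 : 0 ≤ fp * x ^ 2 := by positivity
  have h10 : β * (fp * z ^ 2) ≤ β ^ 2 * (fp * z ^ 2) :=
    mul_le_mul_of_nonneg_right (by nlinarith) (by positivity)
  nlinarith

theorem pogorelov_algebra {f d w W g X c : ι → ℝ} {p : ι} {k β t η D C₁ Q : ℝ}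
    (hf : ∀ i, 0 < f i) (hl : 1 ≤ d p) (hd : ∀ i, -d p / 4 ≤ d i)
    (hc : ∀ i, i ≠ p → 0 < c i ∧ f i = f p + c i * (d p - d i))
    (hk : 0 ≤ k) (hsum : ∑ i, f i * d i ≤ k)
    (hW : 2 * ∑ i ∈ Finset.univ.erase p, c i * w i ^ 2 ≤ ∑ i, f i * W i)
    (h1 : ∀ i, w i / d p - β * (g i / (t * η)) + X i / t = 0)
    (h2 : ∀ i, W i / d p - (w i / d p) ^ 2 + β * (-(d i / (t * η)) - (g i / (t * η)) ^ 2)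
      + 1 / t ≤ 0)
    (hη : 0 < η) (hη2 : η ≤ 2) (ht : 1 ≤ t) (hβ : 8 ≤ β) (hβD : 4 * D ≤ β) (hD : 0 ≤ D)
    (hX : ∑ i, X i ^ 2 ≤ D * t) (hg : ∑ i, g i ^ 2 ≤ 4 * (d p * Q) * t) (hQ : 0 ≤ Q)
    (hC : f p * d p ≤ C₁) :
    ∑ i, f i ≤ (4 * β * k + 32 * β ^ 2 * C₁ * Q + 32 * D * C₁) / η ^ 2 := by
  have ht0 : 0 < t := by linarith
  have hβ0 : 0 < β := by linarith
  set l := d p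
  have hl0 : 0 < l := by linarith
  have hy : ∀ i, w i / l = β * (g i / (t * η)) - X i / t := fun i => by linarith [h1 i]
  -- weighted sum of the second derivative tests
  have hS : ∑ i, f i * (W i / l - (w i / l) ^ 2 + β * (-(d i / (t * η)) - (g i / (t * η)) ^ 2)
      + 1 / t) ≤ 0 :=
    Finset.sum_nonpos fun i _ => mul_nonpos_of_nonneg_of_nonpos (hf i).le (h2 i)
  have eS : ∑ i, f i * (W i / l - (w i / l) ^ 2 + β * (-(d i / (t * η)) - (g i / (t * η)) ^ 2)
      + 1 / t) = (∑ i, f i * W i) / l + ∑ i, (- f i * (w i / l) ^ 2 - β * f i * (g i / (t * η)) ^ 2)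
      - β / (t * η) * ∑ i, f i * d i + 1 / t * ∑ i, f i := by
    rw [Finset.sum_div, Finset.mul_sum, Finset.mul_sum, ← Finset.sum_add_distrib,
      ← Finset.sum_sub_distrib, ← Finset.sum_add_distrib]
    exact Finset.sum_congr rfl fun i _ => by ring
  rw [eS] at hS
  have hA : ∑ i ∈ Finset.univ.erase p, 2 * c i * l * (w i / l) ^ 2 ≤ (∑ i, f i * W i) / l := by
    rw [le_div_iff₀ hl0]
    refine le_trans (le_of_eq ?_) hW
    rw [Finset.sum_mul, Finset.mul_sum]
    exact Finset.sum_congr rfl fun i _ => by field_simp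
  have hB : ∑ i, (-(2 / β) * f i * (X i / t) ^ 2 -
        f p * (4 * β ^ 2 * (g i / (t * η)) ^ 2 + 4 * (X i / t) ^ 2)) ≤
      ∑ i ∈ Finset.univ.erase p, 2 * c i * l * (w i / l) ^ 2 +
      ∑ i, (- f i * (w i / l) ^ 2 - β * f i * (g i / (t * η)) ^ 2) := by
    rw [← Finset.add_sum_erase _ _ (Finset.mem_univ p),
      ← Finset.add_sum_erase _ (fun i => - f i * (w i / l) ^ 2 - _) (Finset.mem_univ p),
      add_left_comm, ← Finset.sum_add_distrib]
    refine add_le_add (pogorelov_term_self (hf p) hβ (hy p)) (Finset.sum_le_sum fun i hi => ?_)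
    obtain ⟨c0, hrel⟩ := hc i (Finset.ne_of_mem_erase hi)
    have := pogorelov_term (hf i) (hf p) c0 hl0 (hd i) hrel hβ (hy i)
    linarith
  have eB : ∑ i, (-(2 / β) * f i * (X i / t) ^ 2 -
        f p * (4 * β ^ 2 * (g i / (t * η)) ^ 2 + 4 * (X i / t) ^ 2)) =
      -(2 / β) * ∑ i, f i * (X i / t) ^ 2 -
        f p * (4 * β ^ 2 * ((∑ i, g i ^ 2) / (t * η) ^ 2) + 4 * ((∑ i, X i ^ 2) / t ^ 2)) := by
    rw [Finset.sum_div, Finset.sum_div, Finset.mul_sum, Finset.mul_sum, Finset.mul_sum,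
      ← Finset.sum_add_distrib, Finset.mul_sum, ← Finset.sum_sub_distrib]
    exact Finset.sum_congr rfl fun i _ => by rw [div_pow, div_pow]; ring
  rw [eB] at hB
  set Ftr := ∑ i, f i with hFtr
  have hFtr0 : 0 ≤ Ftr := Finset.sum_nonneg fun i _ => (hf i).le
  have b1 : 2 / β * ∑ i, f i * (X i / t) ^ 2 ≤ 1 / 2 * (1 / t) * Ftr := by
    have : ∑ i, f i * (X i / t) ^ 2 ≤ Ftr * (D / t) := by
      rw [hFtr, Finset.sum_mul]
      refine Finset.sum_le_sum fun i _ => mul_le_mul_of_nonneg_left ?_ (hf i).le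
      rw [div_pow, div_le_div_iff₀ (by positivity) ht0]
      have : X i ^ 2 ≤ D * t := le_trans
        (Finset.single_le_sum (f := fun i => X i ^ 2) (fun i _ => sq_nonneg _) (Finset.mem_univ i)) hX
      nlinarith
    calc _ ≤ 2 / β * (Ftr * (D / t)) := mul_le_mul_of_nonneg_left this (by positivity)
      _ = (2 * D / β) * ((1 / t) * Ftr) := by ring
      _ ≤ 1 / 2 * ((1 / t) * Ftr) := by
        refine mul_le_mul_of_nonneg_right ?_ (by positivity)
        rw [div_le_div_iff₀ hβ0 (by norm_num)]; linarith
      _ = _ := by ring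
  have b2 : f p * (4 * β ^ 2 * ((∑ i, g i ^ 2) / (t * η) ^ 2) + 4 * ((∑ i, X i ^ 2) / t ^ 2)) ≤
      1 / t * ((16 * β ^ 2 * C₁ * Q + 16 * D * C₁) / η ^ 2) := by
    have hfp : f p ≤ C₁ := by nlinarith [hf p]
    have g1 : (∑ i, g i ^ 2) / (t * η) ^ 2 ≤ 4 * (l * Q) * t / (t * η) ^ 2 :=
      div_le_div_of_nonneg_right hg (by positivity)
    have g2 : (∑ i, X i ^ 2) / t ^ 2 ≤ D * t / t ^ 2 := div_le_div_of_nonneg_right hX (by positivity)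
    have hη4 : 1 ≤ 4 / η ^ 2 := by
      rw [le_div_iff₀ (by positivity)]; nlinarith
    calc _ ≤ f p * (4 * β ^ 2 * (4 * (l * Q) * t / (t * η) ^ 2) + 4 * (D * t / t ^ 2)) := by
          refine mul_le_mul_of_nonneg_left ?_ (hf p).le
          refine add_le_add (mul_le_mul_of_nonneg_left g1 (by positivity))
            (mul_le_mul_of_nonneg_left g2 (by norm_num))
      _ = 1 / t * ((f p * l) * (16 * β ^ 2 * Q / η ^ 2) + f p * (4 * D)) := by
          field_simp; ring
      _ ≤ 1 / t * (C₁ * (16 * β ^ 2 * Q / η ^ 2) + C₁ * (4 * D * (4 / η ^ 2))) := by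
          refine mul_le_mul_of_nonneg_left (add_le_add
            (mul_le_mul_of_nonneg_right hC (by positivity)) ?_) (by positivity)
          refine mul_le_mul hfp ?_ (by positivity) ((hf p).le.trans hfp)
          exact le_mul_of_one_le_right (by positivity) hη4
      _ = _ := by ring
  have b3 : β / (t * η) * ∑ i, f i * d i ≤ 1 / t * (2 * β * k / η ^ 2) := by
    calc _ ≤ β / (t * η) * k := mul_le_mul_of_nonneg_left hsum (by positivity)
      _ = 1 / t * (β * k / η ^ 2 * η) := by field_simp
      _ ≤ 1 / t * (β * k / η ^ 2 * 2) := by gcongr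
      _ = _ := by ring
  have fin : 1 / t * (1 / 2 * Ftr) ≤ 1 / t * ((16 * β ^ 2 * C₁ * Q + 16 * D * C₁) / η ^ 2 +
      2 * β * k / η ^ 2) := by
    have : 1 / t * Ftr - 1 / 2 * (1 / t) * Ftr = 1 / t * (1 / 2 * Ftr) := by ring
    rw [mul_add, ← this]
    linarith
  have := le_of_mul_le_mul_left fin (by positivity)
  have e : (4 * β * k + 32 * β ^ 2 * C₁ * Q + 32 * D * C₁) / η ^ 2 =
    2 * ((16 * β ^ 2 * C₁ * Q + 16 * D * C₁) / η ^ 2 + 2 * β * k / η ^ 2) := by ring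
  rw [e]; linarith

end PogorelovAlgebra

section Euclidean
open scoped ContDiff
variable {ι : Type*} [Fintype ι] [DecidableEq ι]

/-- The standard frame of Euclidean space. -/
noncomputable def stdFrame (ι : Type*) [DecidableEq ι] (i : ι) : EuclideanSpace ℝ ι :=
  EuclideanSpace.single i 1

theorem eq_sum_stdFrame (x : EuclideanSpace ℝ ι) : x = ∑ i, x i • stdFrame ι i := by
  ext j
  simp [stdFrame, Pi.single_apply]

theorem sum_smul_stdFrame_apply (c : ι → ℝ) (j : ι) :
    (∑ i, c i • stdFrame ι i : EuclideanSpace ℝ ι) j = c j := by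
  simp [stdFrame, Pi.single_apply]

theorem rot_apply (U : Matrix ι ι ℝ) (l i : ι) : rot (stdFrame ι) U l i = U i l :=
  sum_smul_stdFrame_apply _ _

theorem dd_eq_sum (v : EuclideanSpace ℝ ι) (f : EuclideanSpace ℝ ι → ℝ)
    (x : EuclideanSpace ℝ ι) : dd v f x = ∑ i, v i * dd (stdFrame ι i) f x := by
  conv_lhs => rw [eq_sum_stdFrame v]
  exact dd_sum_left _ _ _ _ _

theorem dd_dd_eq_sum {u : EuclideanSpace ℝ ι → ℝ} (hu : ContDiff ℝ ∞ u)
    (v w : EuclideanSpace ℝ ι) (x : EuclideanSpace ℝ ι) :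
    dd v (dd w u) x = ∑ i, ∑ j, v i * w j * dd (stdFrame ι i) (dd (stdFrame ι j) u) x := by
  conv_lhs => rw [eq_sum_stdFrame v, eq_sum_stdFrame w]
  exact dd_dd_sum _ _ _ _ _ _ hu x

theorem sum_sq_rot {U : Matrix ι ι ℝ} (hU : U.transpose * U = 1) (y : ι → ℝ) :
    ∑ l, (∑ i, U i l * y i) ^ 2 = ∑ i, y i ^ 2 := by
  have hU' := mul_eq_one_comm.1 hU
  have h : ∀ i j, ∑ l, U i l * U j l = if i = j then 1 else 0 := fun i j => by
    have := congrFun (congrFun hU' i) j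
    rw [Matrix.mul_apply, Matrix.one_apply] at this
    simpa using this
  calc ∑ l, (∑ i, U i l * y i) ^ 2 = ∑ i, ∑ j, y i * y j * ∑ l, U i l * U j l := by
        simp only [sq, Finset.mul_sum, Finset.sum_mul]
        rw [Finset.sum_comm]
        refine Finset.sum_congr rfl fun i _ => ?_
        rw [Finset.sum_comm]
        exact Finset.sum_congr rfl fun j _ => Finset.sum_congr rfl fun l _ => by ring
    _ = _ := by simp [h, sq]

theorem norm_rot {U : Matrix ι ι ℝ} (hU : U.transpose * U = 1) (l : ι) :
    ‖rot (stdFrame ι) U l‖ = 1 := by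
  have h : ‖rot (stdFrame ι) U l‖ ^ 2 = 1 := by
    rw [EuclideanSpace.real_norm_sq_eq]
    have := congrFun (congrFun hU l) l
    rw [Matrix.mul_apply] at this
    simpa [rot_apply, sq] using this
  exact (pow_eq_one_iff_of_nonneg (norm_nonneg _) two_ne_zero).1 h

theorem dd_rot_rot {u : EuclideanSpace ℝ ι → ℝ} (hu : ContDiff ℝ ∞ u) {x : EuclideanSpace ℝ ι}
    {U : Matrix ι ι ℝ} {d : ι → ℝ} (hU : U.transpose * U = 1)
    (hA : hess (stdFrame ι) u x = U * Matrix.diagonal d * U.transpose) (i j : ι) :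
    dd (rot (stdFrame ι) U i) (dd (rot (stdFrame ι) U j) u) x = if i = j then d i else 0 := by
  have := congrFun (congrFun (hess_rot_diag (stdFrame ι) hu hU hA) i) j
  rwa [hess_apply, Matrix.diagonal_apply] at this

theorem dd_dd_eq_sum_eigenvalues {u : EuclideanSpace ℝ ι → ℝ} (hu : ContDiff ℝ ∞ u)
    {x : EuclideanSpace ℝ ι} {U : Matrix ι ι ℝ} {d : ι → ℝ}
    (hA : hess (stdFrame ι) u x = U * Matrix.diagonal d * U.transpose)
    (ξ : EuclideanSpace ℝ ι) :
    dd ξ (dd ξ u) x = ∑ l, (∑ i, U i l * ξ i) ^ 2 * d l := by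
  rw [dd_dd_eq_sum hu]
  have h : ∀ i j, dd (stdFrame ι i) (dd (stdFrame ι j) u) x = ∑ l, U i l * d l * U j l := by
    intro i j
    rw [← hess_apply (stdFrame ι), hA, Matrix.mul_apply]
    simp [Matrix.mul_diagonal]
  simp only [h, sq, Finset.mul_sum, Finset.sum_mul]
  conv_rhs => rw [Finset.sum_comm]
  refine Finset.sum_congr rfl fun i _ => ?_
  rw [Finset.sum_comm]
  exact Finset.sum_congr rfl fun j _ => Finset.sum_congr rfl fun l _ => by ring

theorem dd_dd_le_of_eigenvalues_le {u : EuclideanSpace ℝ ι → ℝ} (hu : ContDiff ℝ ∞ u)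
    {x : EuclideanSpace ℝ ι} {U : Matrix ι ι ℝ} {d : ι → ℝ} (hU : U.transpose * U = 1)
    (hA : hess (stdFrame ι) u x = U * Matrix.diagonal d * U.transpose)
    (ξ : EuclideanSpace ℝ ι) {Λ : ℝ} (h : ∀ i, d i ≤ Λ) :
    dd ξ (dd ξ u) x ≤ Λ * ‖ξ‖ ^ 2 := by
  rw [dd_dd_eq_sum_eigenvalues hu hA, EuclideanSpace.real_norm_sq_eq, ← sum_sq_rot hU,
    Finset.mul_sum]
  exact Finset.sum_le_sum fun l _ => by nlinarith [sq_nonneg (∑ i, U i l * ξ i), h l]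

theorem dd_dd_smul {E : Type*} [NormedAddCommGroup E] [NormedSpace ℝ E] {u : E → ℝ}
    (hu : ContDiff ℝ ∞ u) (c : ℝ) (ξ : E) (x : E) :
    dd (c • ξ) (dd (c • ξ) u) x = c ^ 2 * dd ξ (dd ξ u) x := by
  rw [dd_smul_left, dd_smul_left, dd_const_mul (hu.dd ξ)]
  ring

/-- Gradient bound from a one-sided Hessian bound on a sublevel set. -/
theorem sum_sq_gradient_le {u : EuclideanSpace ℝ ι → ℝ} (hu : ContDiff ℝ ∞ u)
    {x₀ : EuclideanSpace ℝ ι} {K m₀ : ℝ} (hK : 0 < K)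
    (h : ∀ y, u y ≤ u x₀ → ∀ ξ, ‖ξ‖ = 1 → dd ξ (dd ξ u) y ≤ K) (hm : ∀ y, -m₀ ≤ u y) :
    ∑ i, dd (stdFrame ι i) u x₀ ^ 2 ≤ 2 * K * (u x₀ + m₀) := by
  have hG0 : 0 ≤ ∑ i, dd (stdFrame ι i) u x₀ ^ 2 := Finset.sum_nonneg fun i _ => sq_nonneg _
  rcases hG0.eq_or_lt with hG | hG
  · rw [← hG]; nlinarith [hm x₀]
  set v : EuclideanSpace ℝ ι := ∑ i, (-dd (stdFrame ι i) u x₀) • stdFrame ι i with hv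
  have hvi : ∀ i, v i = -dd (stdFrame ι i) u x₀ := sum_smul_stdFrame_apply _
  have hvn : ‖v‖ ^ 2 = ∑ i, dd (stdFrame ι i) u x₀ ^ 2 := by
    rw [EuclideanSpace.real_norm_sq_eq]
    exact Finset.sum_congr rfl fun i _ => by rw [hvi]; ring
  have hv0 : ‖v‖ ≠ 0 := fun h0 => by rw [← hvn, h0] at hG; norm_num at hG
  have hdv : dd v u x₀ = -∑ i, dd (stdFrame ι i) u x₀ ^ 2 := by
    rw [dd_eq_sum, ← Finset.sum_neg_distrib]
    exact Finset.sum_congr rfl fun i _ => by rw [hvi]; ring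
  have hline : ∀ y, u y ≤ u x₀ → dd v (dd v u) y ≤ K * ∑ i, dd (stdFrame ι i) u x₀ ^ 2 := by
    intro y hy
    have e : v = ‖v‖ • (‖v‖⁻¹ • v) := by rw [smul_smul, mul_inv_cancel₀ hv0, one_smul]
    have h1 := h y hy (‖v‖⁻¹ • v) (by rw [norm_smul, norm_inv, norm_norm, inv_mul_cancel₀ hv0])
    rw [e, dd_dd_smul hu, ← hvn, mul_comm K]
    exact mul_le_mul_of_nonneg_left h1 (sq_nonneg _)
  have := descent_one_variable (h := fun s : ℝ => u (x₀ + s • v)) (K := K)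
    (G := ∑ i, dd (stdFrame ι i) u x₀ ^ 2)
    (fun s => hasDerivAt_line hu x₀ v s) (fun s => hasDerivAt_line (hu.dd v) x₀ v s) hK hG
    (by simpa using hdv) (fun s hs => hline _ (by simpa using hs))
  have h2 := hm (x₀ + (1 / K) • v)
  simp only [zero_smul, add_zero] at this
  have h3 : (∑ i, dd (stdFrame ι i) u x₀ ^ 2) / (2 * K) ≤ u x₀ + m₀ := by linarith
  rw [div_le_iff₀ (by positivity)] at h3
  linarith

end Euclidean

section Pogorelov
open scoped ContDiff
open Filter Topology
variable {ι : Type*} [Fintype ι] [DecidableEq ι]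

/-- A smooth entire admissible solution of the equation. -/
structure EntireSolution (α : ℝ) (m : ℕ) (u : EuclideanSpace ℝ ι → ℝ) : Prop where
  pos : 0 < α
  smooth : ContDiff ℝ ∞ u
  convex : ∀ x, gardM (m + 2) (hess (stdFrame ι) u x)
  eq : ∀ x, sigF α m (hess (stdFrame ι) u x) = 1

variable {α : ℝ} {m : ℕ} {u : EuclideanSpace ℝ ι → ℝ}

theorem hsym_eq_sigF {A U : Matrix ι ι ℝ} {d : ι → ℝ} (hU : U.transpose * U = 1)
    (hA : A = U * Matrix.diagonal d * U.transpose) :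
    hsym α Finset.univ d (m + 2) = sigF α m A := by
  rw [← sigF_diagonal, ← diagonal_eq_smul_single, hA]
  exact (sigF_conj α m _ _ _ (mul_eq_one_comm.1 hU)).symm

theorem EntireSolution.eigenframe (S : EntireSolution α m u) (x : EuclideanSpace ℝ ι) :
    ∃ (U : Matrix ι ι ℝ) (d : ι → ℝ), U.transpose * U = 1 ∧
      hess (stdFrame ι) u x = U * Matrix.diagonal d * U.transpose ∧
      garding Finset.univ (m + 2) d ∧ hsym α Finset.univ d (m + 2) = 1 := by
  obtain ⟨U, d, hU, -, hA⟩ := exists_orthogonal_diagonalization (hess_isSymm (stdFrame ι) S.smooth x)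
  exact ⟨U, d, hU, hA, (S.convex x).garding hU hA, (hsym_eq_sigF hU hA).trans (S.eq x)⟩

theorem two_mul_sum_erase_le_sum_offDiag (p : ι) {T : ι → ι → ℝ}
    (hT : ∀ i j, i ≠ j → 0 ≤ T i j) (hsymm : ∀ i, T i p = T p i) :
    2 * ∑ i ∈ Finset.univ.erase p, T p i ≤ ∑ q ∈ Finset.univ.offDiag, T q.1 q.2 := by
  have hsub : (Finset.univ.erase p).image (fun i => (p, i)) ∪
      (Finset.univ.erase p).image (fun i => (i, p)) ⊆ Finset.univ.offDiag := by
    intro q hq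
    simp only [Finset.mem_union, Finset.mem_image, Finset.mem_erase, Finset.mem_univ,
      and_true] at hq
    rcases hq with ⟨i, hi, rfl⟩ | ⟨i, hi, rfl⟩ <;> simp [hi, hi.symm]
  have hdis : Disjoint ((Finset.univ.erase p).image (fun i => (p, i)))
      ((Finset.univ.erase p).image (fun i => (i, p))) := by
    rw [Finset.disjoint_left]
    intro q h1 h2
    simp only [Finset.mem_image, Finset.mem_erase, Finset.mem_univ, and_true] at h1 h2
    obtain ⟨i, hi, rfl⟩ := h1
    obtain ⟨j, hj, h⟩ := h2
    exact hj (congrArg Prod.fst h)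
  refine le_trans (le_of_eq ?_) (Finset.sum_le_sum_of_subset_of_nonneg hsub fun q hq _ =>
    hT _ _ (Finset.mem_offDiag.1 hq).2.2)
  rw [Finset.sum_union hdis, Finset.sum_image (by intro a _ b _ h; exact congrArg Prod.snd h),
    Finset.sum_image (by intro a _ b _ h; exact congrArg Prod.fst h), two_mul]
  simp only [hsymm]

theorem hasDerivAt_norm_sq_line (x b : EuclideanSpace ℝ ι) (hb : ‖b‖ = 1) (t s : ℝ) :
    HasDerivAt (fun s : ℝ => ‖x + s • b‖ ^ 2 / (2 * t)) ((inner ℝ x b + s) / t) s := by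
  have h1 : HasDerivAt (fun s : ℝ => x + s • b) b s := by
    simpa using ((hasDerivAt_id s).smul_const b).const_add x
  refine (h1.norm_sq.div_const (2 * t)).congr_deriv ?_
  rw [inner_add_left, real_inner_smul_left, real_inner_self_eq_norm_sq, hb]
  rw [mul_div_mul_left _ _ two_ne_zero]
  simp

theorem sum_sq_inner_rot {U : Matrix ι ι ℝ} (hU : U.transpose * U = 1)
    (x : EuclideanSpace ℝ ι) : ∑ i, (inner ℝ x (rot (stdFrame ι) U i)) ^ 2 = ‖x‖ ^ 2 := by
  rw [EuclideanSpace.real_norm_sq_eq]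
  refine (Finset.sum_congr rfl fun l _ => ?_).trans (sum_sq_rot hU x)
  congr 1
  rw [PiLp.inner_apply]
  exact Finset.sum_congr rfl fun i _ => by rw [rot_apply]; simp

theorem sum_sq_dd_rot {U : Matrix ι ι ℝ} (hU : U.transpose * U = 1)
    (f : EuclideanSpace ℝ ι → ℝ) (x : EuclideanSpace ℝ ι) :
    ∑ i, (dd (rot (stdFrame ι) U i) f x) ^ 2 = ∑ i, dd (stdFrame ι i) f x ^ 2 := by
  refine (Finset.sum_congr rfl fun l _ => ?_).trans (sum_sq_rot hU _)
  rw [rot, dd_sum_left]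

theorem EntireSolution.pogorelov_at_max (S : EntireSolution α m u) {x₀ : EuclideanSpace ℝ ι}
    {U : Matrix ι ι ℝ} {d : ι → ℝ} (hU : U.transpose * U = 1)
    (hA : hess (stdFrame ι) u x₀ = U * Matrix.diagonal d * U.transpose)
    (hd : garding Finset.univ (m + 2) d) (hF : hsym α Finset.univ d (m + 2) = 1) {p : ι}
    {β : ℕ} {t D m₀ : ℝ} (hη : 0 < 1 - u x₀ / t) (ht : 1 ≤ t) (hm₀t : m₀ ≤ t) (hD : 0 ≤ D)
    (hxD : ‖x₀‖ ^ 2 ≤ D * t) (hm₀ : ∀ y, -m₀ ≤ u y) (hβ : (8 : ℝ) ≤ β) (hβD : 4 * D ≤ β)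
    (hl : 1 ≤ d p) (hl' : 4 * max 1 ((Fintype.card ι + 1) / α) ≤ d p)
    (hmax : ∀ y, u y ≤ t → ∀ ξ : EuclideanSpace ℝ ι, ‖ξ‖ = 1 →
      (1 - u y / t) ^ β * dd ξ (dd ξ u) y * Real.exp (‖y‖ ^ 2 / (2 * t)) ≤
      (1 - u x₀ / t) ^ β * d p * Real.exp (‖x₀‖ ^ 2 / (2 * t))) :
    ∑ i, fst1 α m d i ≤ (4 * β * ((m : ℝ) + 2) +
      32 * (β : ℝ) ^ 2 * (max 1 (1 / α) / α + 1) * Real.exp (D / 2) +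
      32 * D * (max 1 (1 / α) / α + 1)) / (1 - u x₀ / t) ^ 2 := by
  have hu := S.smooth
  have ht0 : 0 < t := by linarith
  have hu0 : u x₀ < t := by
    have : u x₀ / t < 1 := by linarith
    rwa [div_lt_one ht0] at this
  have hl0 : 0 < d p := by linarith
  set b := rot (stdFrame ι) U with hb
  have hbn : ∀ i, ‖b i‖ = 1 := norm_rot hU
  have hdiag := dd_rot_rot hu hU hA
  have htest : ∀ i, dd (b i) (dd (b p) (dd (b p) u)) x₀ / d p +
      β * (-(dd (b i) u x₀ / t) / (1 - u x₀ / t)) + inner ℝ x₀ (b i) / t = 0 ∧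
      dd (b i) (dd (b i) (dd (b p) (dd (b p) u))) x₀ / d p -
      (dd (b i) (dd (b p) (dd (b p) u)) x₀ / d p) ^ 2 + β * (-(d i / t) / (1 - u x₀ / t) -
        (-(dd (b i) u x₀ / t) / (1 - u x₀ / t)) ^ 2) + 1 / t ≤ 0 := by
    intro i
    have hw : ContDiff ℝ ∞ (dd (b p) (dd (b p) u)) := (hu.dd _).dd _
    have h1 := hasDerivAt_line hw x₀ (b i)
    have h2 := hasDerivAt_line (hw.dd (b i)) x₀ (b i) 0
    have h3 : ∀ s, HasDerivAt (fun s : ℝ => 1 - u (x₀ + s • b i) / t)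
        (-(dd (b i) u (x₀ + s • b i) / t)) s := fun s =>
      ((hasDerivAt_line hu x₀ (b i) s).div_const t).const_sub 1
    have h4 : HasDerivAt (fun s : ℝ => -(dd (b i) u (x₀ + s • b i) / t)) (-(d i / t)) 0 := by
      have := ((hasDerivAt_line (hu.dd (b i)) x₀ (b i) 0).div_const t).neg
      rw [zero_smul, add_zero, hdiag i i, if_pos rfl] at this
      exact this
    have h5 := hasDerivAt_norm_sq_line x₀ (b i) (hbn i) t
    have h6 : HasDerivAt (fun s : ℝ => (inner ℝ x₀ (b i) + s) / t) (1 / t) 0 :=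
      ((hasDerivAt_id (0 : ℝ)).const_add _).div_const t
    have hwp : dd (b p) (dd (b p) u) x₀ = d p := by rw [hdiag, if_pos rfl]
    have := log_second_deriv_test β h1 h2 h3 h4 h5 h6 (by simpa [hwp] using hl0)
      (by simpa using hη) (by
        have hcont : Continuous fun s : ℝ => u (x₀ + s • b i) :=
          hu.continuous.comp (by fun_prop)
        have hev : ∀ᶠ s in 𝓝 (0 : ℝ), u (x₀ + s • b i) < t :=
          hcont.continuousAt.eventually (gt_mem_nhds (by simpa using hu0))
        filter_upwards [hev] with s hs
        simpa [hwp] using hmax _ hs.le (b p) (hbn p))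
    simpa only [zero_smul, add_zero, hwp] using this
  have hgrad : ∑ i, dd (b i) u x₀ ^ 2 ≤ 4 * (d p * Real.exp (D / 2)) * t := by
    rw [hb, sum_sq_dd_rot hU]
    refine (sum_sq_gradient_le hu (K := d p * Real.exp (D / 2)) (m₀ := m₀) (by positivity)
      (fun y hy ξ hξ => ?_) hm₀).trans ?_
    · have h1 := hmax y (hy.trans hu0.le) ξ hξ
      have h2 : 1 - u x₀ / t ≤ 1 - u y / t := by
        have := div_le_div_of_nonneg_right hy ht0.le
        linarith
      rcases le_or_gt (dd ξ (dd ξ u) y) 0 with h3 | h3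
      · exact h3.trans (by positivity)
      have h4 : 1 ≤ Real.exp (‖y‖ ^ 2 / (2 * t)) := Real.one_le_exp (by positivity)
      have h5 : Real.exp (‖x₀‖ ^ 2 / (2 * t)) ≤ Real.exp (D / 2) := by
        refine Real.exp_le_exp.2 ?_
        rw [div_le_div_iff₀ (by positivity) two_pos]; nlinarith
      have h6 : (1 - u x₀ / t) ^ β * dd ξ (dd ξ u) y ≤
          (1 - u x₀ / t) ^ β * (d p * Real.exp (D / 2)) := by
        calc _ ≤ (1 - u y / t) ^ β * dd ξ (dd ξ u) y :=
              mul_le_mul_of_nonneg_right (pow_le_pow_left₀ hη.le h2 β) h3.le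
          _ ≤ (1 - u y / t) ^ β * dd ξ (dd ξ u) y * Real.exp (‖y‖ ^ 2 / (2 * t)) :=
              le_mul_of_one_le_right
                (mul_nonneg (pow_nonneg (hη.le.trans h2) _) h3.le) h4
          _ ≤ (1 - u x₀ / t) ^ β * d p * Real.exp (‖x₀‖ ^ 2 / (2 * t)) := h1
          _ ≤ (1 - u x₀ / t) ^ β * d p * Real.exp (D / 2) :=
              mul_le_mul_of_nonneg_left h5 (by positivity)
          _ = _ := by ring
      exact le_of_mul_le_mul_left h6 (pow_pos hη β)
    · have h7 : u x₀ + m₀ ≤ 2 * t := by linarith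
      have h8 : 0 ≤ 2 * (d p * Real.exp (D / 2)) := by positivity
      nlinarith [mul_le_mul_of_nonneg_left h7 h8]
  have hvar := (solution_second_variation hu S.pos.le S.convex S.eq hU hA (b p)).2
  have hcomm : ∀ i, dd (b p) (dd (b p) (dd (b i) u)) = dd (b i) (dd (b p) (dd (b p) u)) :=
    fun i => by rw [dd_comm hu (b p) (b i), dd_comm (hu.dd (b p)) (b p) (b i)]
  have hcomm4 : ∀ i, dd (b p) (dd (b p) (dd (b i) (dd (b i) u))) =
      dd (b i) (dd (b i) (dd (b p) (dd (b p) u))) := fun i => by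
    rw [dd_comm (hu.dd (b i)) (b p) (b i), dd_comm ((hu.dd (b i)).dd (b p)) (b p) (b i), hcomm]
  have hoff := two_mul_sum_erase_le_sum_offDiag p
    (T := fun i j => snd2 α m d i j * dd (b p) (dd (b i) (dd (b j) u)) x₀ ^ 2)
    (fun i j hij => mul_nonneg (snd2_pos S.pos.le hd hij).le (sq_nonneg _))
    (fun i => by
      rw [dd_comm hu (b i) (b p)]
      unfold snd2
      rw [Finset.pair_comm])
  refine pogorelov_algebra (p := p) (d := d) (t := t) (c := fun i => snd2 α m d p i)
    (w := fun i => dd (b i) (dd (b p) (dd (b p) u)) x₀)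
    (W := fun i => dd (b i) (dd (b i) (dd (b p) (dd (b p) u))) x₀)
    (g := fun i => dd (b i) u x₀) (X := fun i => inner ℝ x₀ (b i))
    (fst1_pos S.pos.le hd) hl (fun i => ?_)
    (fun i hi => ⟨snd2_pos S.pos.le hd hi.symm, fst1_sub d hi.symm⟩) (by positivity)
    (sum_fst1_mul_le S.pos hd hF) ?_ (fun i => ?_) (fun i => ?_) hη ?_ ht hβ hβD hD ?_ hgrad
    (Real.exp_pos _).le (fst1_mul_le S.pos hd hF hl0.le)
  · have := eigenvalue_lower_bound S.pos hd hF i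
    linarith
  · simp only [hcomm] at hoff
    refine hoff.trans (hvar.trans (le_of_eq ?_))
    exact Finset.sum_congr rfl fun i _ => by rw [hcomm4]
  · rw [← (htest i).1]
    field_simp
    ring
  · refine le_of_eq_of_le ?_ (htest i).2
    field_simp
  · have h1 : -t ≤ u x₀ := by linarith [hm₀ x₀]
    have : -1 ≤ u x₀ / t := by rw [le_div_iff₀ ht0]; linarith
    linarith
  · rw [hb, sum_sq_inner_rot hU]; exact hxD

end Pogorelov

section GlobalBound
open scoped ContDiff
open Filter Topology
variable {ι : Type*} [Fintype ι] [DecidableEq ι] {α : ℝ} {m : ℕ} {u : EuclideanSpace ℝ ι → ℝ}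

theorem continuous_dd_dd (hu : ContDiff ℝ ∞ u) :
    Continuous fun q : EuclideanSpace ℝ ι × EuclideanSpace ℝ ι => dd q.2 (dd q.2 u) q.1 := by
  refine Continuous.congr ?_ fun q => (dd_dd_eq_sum hu q.2 q.2 q.1).symm
  refine continuous_finsetSum _ fun i _ => continuous_finsetSum _ fun j _ => ?_
  have := ((hu.dd (stdFrame ι j)).dd (stdFrame ι i)).continuous
  have h1 : Continuous fun q : EuclideanSpace ℝ ι × EuclideanSpace ℝ ι => q.2 i := by fun_prop
  have h2 : Continuous fun q : EuclideanSpace ℝ ι × EuclideanSpace ℝ ι => q.2 j := by fun_prop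
  exact (h1.mul h2).mul (this.comp continuous_fst)

theorem EntireSolution.exists_interior_estimate (S : EntireSolution α m u) {D m₀ : ℝ} (hD : 0 ≤ D)
    (hgr : ∀ t, 1 ≤ t → ∀ x, u x ≤ t → ‖x‖ ^ 2 ≤ D * t) (hm₀ : ∀ y, -m₀ ≤ u y) :
    ∃ (β : ℕ) (C : ℝ), ∀ t, 1 ≤ t → m₀ ≤ t → ∀ x ξ : EuclideanSpace ℝ ι, ‖ξ‖ = 1 → u x ≤ t →
      (1 - u x / t) ^ β * dd ξ (dd ξ u) x ≤ C := by
  have hu := S.smooth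
  obtain ⟨Ct, hCt, htr⟩ := exists_eigenvalue_le_trace ι S.pos m
  obtain ⟨N, hN⟩ := exists_nat_ge (4 * D)
  set β : ℕ := N + 8 + 2 * m with hβ
  set L₀ : ℝ := max 1 (4 * max 1 ((Fintype.card ι + 1) / α)) with hL₀
  set C₄ : ℝ := 4 * β * ((m : ℝ) + 2) +
      32 * (β : ℝ) ^ 2 * (max 1 (1 / α) / α + 1) * Real.exp (D / 2) +
      32 * D * (max 1 (1 / α) / α + 1) with hC₄
  have hL1 : 1 ≤ L₀ := le_max_left _ _
  have hβD : 4 * D ≤ β := by rw [hβ]; push_cast; have : (0 : ℝ) ≤ m := m.cast_nonneg; linarith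
  have hβ8 : (8 : ℝ) ≤ β := by
    rw [hβ]; push_cast
    have : (0 : ℝ) ≤ m := m.cast_nonneg
    have : (0 : ℝ) ≤ N := N.cast_nonneg
    linarith
  refine ⟨β, (2 ^ β * L₀ + Ct * C₄ ^ m * 2 ^ (N + 8)) * Real.exp (D / 2),
    fun t ht hmt x ξ hξ hx => ?_⟩
  have hC₄0 : 0 ≤ C₄ := by
    have := S.pos
    have h1 : 0 < max 1 (1 / α) / α + 1 := by
      have : (0 : ℝ) < max 1 (1 / α) := zero_lt_one.trans_le (le_max_left _ _)
      positivity
    rw [hC₄]; positivity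
  have hC0 : 0 ≤ (2 ^ β * L₀ + Ct * C₄ ^ m * 2 ^ (N + 8)) := by positivity
  have ht0 : 0 < t := by linarith
  have hηt : ∀ y, u y ≤ t → 0 ≤ 1 - u y / t := fun y hy => by
    have : u y / t ≤ 1 := by rwa [div_le_one ht0]
    linarith
  rcases le_or_gt (dd ξ (dd ξ u) x) 0 with hneg | hpos
  · exact (mul_nonpos_of_nonneg_of_nonpos (pow_nonneg (hηt x hx) _) hneg).trans (by positivity)
  -- the maximum point of the auxiliary function
  have hsub : IsCompact {y : EuclideanSpace ℝ ι | u y ≤ t} := by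
    refine Metric.isCompact_of_isClosed_isBounded (isClosed_le hu.continuous continuous_const) ?_
    refine (Metric.isBounded_closedBall (x := (0 : EuclideanSpace ℝ ι)) (r := D * t + 1)).subset
      fun y hy => ?_
    rw [mem_closedBall_zero_iff]
    have := hgr t ht y hy
    nlinarith [sq_nonneg (‖y‖ - 1)]
  have hK := hsub.prod (isCompact_sphere (0 : EuclideanSpace ℝ ι) 1)
  have hcont : Continuous fun q : EuclideanSpace ℝ ι × EuclideanSpace ℝ ι =>
      (1 - u q.1 / t) ^ β * dd q.2 (dd q.2 u) q.1 * Real.exp (‖q.1‖ ^ 2 / (2 * t)) := by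
    have h1 := continuous_dd_dd hu
    have h2 := hu.continuous.comp (continuous_fst (X := EuclideanSpace ℝ ι)
      (Y := EuclideanSpace ℝ ι))
    refine (Continuous.mul ?_ h1).mul (by fun_prop)
    exact (continuous_const.sub (h2.div_const t)).pow β
  obtain ⟨⟨x₀, ξ₀⟩, ⟨hx₀, hξ₀⟩, hmax⟩ := hK.exists_isMaxOn ⟨(x, ξ), hx, by simpa using hξ⟩
    hcont.continuousOn
  have hx₀ : u x₀ ≤ t := hx₀
  have hξ₀ : ‖ξ₀‖ = 1 := by simpa using hξ₀
  have hmax' : ∀ y, u y ≤ t → ∀ ζ : EuclideanSpace ℝ ι, ‖ζ‖ = 1 →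
      (1 - u y / t) ^ β * dd ζ (dd ζ u) y * Real.exp (‖y‖ ^ 2 / (2 * t)) ≤
      (1 - u x₀ / t) ^ β * dd ξ₀ (dd ξ₀ u) x₀ * Real.exp (‖x₀‖ ^ 2 / (2 * t)) :=
    fun y hy ζ hζ => hmax (a := (y, ζ)) ⟨hy, by simpa using hζ⟩
  obtain ⟨U, d, hU, hA, hd, hF⟩ := S.eigenframe x₀
  have : Nonempty ι := by
    by_contra hne
    rw [not_nonempty_iff] at hne
    have : ξ = 0 := Subsingleton.elim _ _
    rw [this, norm_zero] at hξ
    exact zero_ne_one hξ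
  obtain ⟨p, hp⟩ := Finite.exists_max d
  have hξp : dd ξ₀ (dd ξ₀ u) x₀ ≤ d p := by
    have := dd_dd_le_of_eigenvalues_le hu hU hA ξ₀ hp
    rwa [hξ₀, one_pow, mul_one] at this
  have hmaxp : ∀ y, u y ≤ t → ∀ ζ : EuclideanSpace ℝ ι, ‖ζ‖ = 1 →
      (1 - u y / t) ^ β * dd ζ (dd ζ u) y * Real.exp (‖y‖ ^ 2 / (2 * t)) ≤
      (1 - u x₀ / t) ^ β * d p * Real.exp (‖x₀‖ ^ 2 / (2 * t)) :=
    fun y hy ζ hζ => (hmax' y hy ζ hζ).trans (mul_le_mul_of_nonneg_right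
      (mul_le_mul_of_nonneg_left hξp (pow_nonneg (hηt x₀ hx₀) _)) (Real.exp_pos _).le)
  have hη2 : 1 - u x₀ / t ≤ 2 := by
    have : -1 ≤ u x₀ / t := by rw [le_div_iff₀ ht0]; linarith [hm₀ x₀]
    linarith
  have hη0 := hηt x₀ hx₀
  have key : (1 - u x₀ / t) ^ β * d p ≤ 2 ^ β * L₀ + Ct * C₄ ^ m * 2 ^ (N + 8) := by
    rcases le_or_gt (d p) L₀ with hsmall | hlarge
    · have h1 : (1 - u x₀ / t) ^ β * d p ≤ (1 - u x₀ / t) ^ β * L₀ :=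
        mul_le_mul_of_nonneg_left hsmall (pow_nonneg hη0 _)
      have h2 : (1 - u x₀ / t) ^ β * L₀ ≤ 2 ^ β * L₀ :=
        mul_le_mul_of_nonneg_right (pow_le_pow_left₀ hη0 hη2 _) (by linarith)
      have h3 : 0 ≤ Ct * C₄ ^ m * 2 ^ (N + 8) := by positivity
      linarith
    rcases hη0.eq_or_lt with hz | hηpos
    · rw [← hz, zero_pow (by omega), zero_mul]; exact hC0
    have hp1 : 1 ≤ d p := hL1.trans hlarge.le
    have htrace := S.pogorelov_at_max hU hA hd hF (p := p) hηpos ht hmt hD (hgr t ht x₀ hx₀) hm₀ hβ8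
      hβD hp1 ((le_max_right _ _).trans hlarge.le) hmaxp
    have h1 := htr d hd hF p hp1
    have hf0 : 0 ≤ ∑ i, fst1 α m d i := Finset.sum_nonneg fun i _ => (fst1_pos S.pos.le hd i).le
    calc (1 - u x₀ / t) ^ β * d p ≤ (1 - u x₀ / t) ^ β *
          (Ct * (C₄ / (1 - u x₀ / t) ^ 2) ^ m) := by
          refine mul_le_mul_of_nonneg_left (h1.trans ?_) (pow_nonneg hη0 _)
          exact mul_le_mul_of_nonneg_left (pow_le_pow_left₀ hf0 htrace m) hCt.le
      _ = Ct * C₄ ^ m * (1 - u x₀ / t) ^ (N + 8) := by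
          rw [hβ, pow_add _ (N + 8), div_pow, ← pow_mul]
          generalize 1 - u x₀ / t = y at hηpos
          field_simp
      _ ≤ Ct * C₄ ^ m * 2 ^ (N + 8) :=
          mul_le_mul_of_nonneg_left (pow_le_pow_left₀ hη0 hη2 _) (by positivity)
      _ ≤ _ := le_add_of_nonneg_left (by positivity)
  have hexp : Real.exp (‖x₀‖ ^ 2 / (2 * t)) ≤ Real.exp (D / 2) := by
    refine Real.exp_le_exp.2 ?_
    rw [div_le_div_iff₀ (by positivity) two_pos]
    nlinarith [hgr t ht x₀ hx₀]
  calc (1 - u x / t) ^ β * dd ξ (dd ξ u) x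
      ≤ (1 - u x / t) ^ β * dd ξ (dd ξ u) x * Real.exp (‖x‖ ^ 2 / (2 * t)) :=
        le_mul_of_one_le_right (mul_nonneg (pow_nonneg (hηt x hx) _) hpos.le)
          (Real.one_le_exp (by positivity))
    _ ≤ (1 - u x₀ / t) ^ β * d p * Real.exp (‖x₀‖ ^ 2 / (2 * t)) := hmaxp x hx ξ hξ
    _ ≤ _ := mul_le_mul key hexp (Real.exp_pos _).le hC0

theorem EntireSolution.exists_hessian_bound (S : EntireSolution α m u) {D m₀ : ℝ} (hD : 0 ≤ D)
    (hgr : ∀ t, 1 ≤ t → ∀ x, u x ≤ t → ‖x‖ ^ 2 ≤ D * t) (hm₀ : ∀ y, -m₀ ≤ u y) :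
    ∃ Λ, ∀ x ξ : EuclideanSpace ℝ ι, ‖ξ‖ = 1 → dd ξ (dd ξ u) x ≤ Λ := by
  obtain ⟨β, C, h⟩ := S.exists_interior_estimate hD hgr hm₀
  refine ⟨max 0 (2 ^ β * C), fun x ξ hξ => ?_⟩
  rcases le_or_gt (dd ξ (dd ξ u) x) 0 with hneg | hpos
  · exact hneg.trans (le_max_left _ _)
  refine le_trans ?_ (le_max_right _ _)
  set t := max (max 1 m₀) (2 * u x) with ht
  have h1 : 1 ≤ t := (le_max_left _ _).trans (le_max_left _ _)
  have h2 : m₀ ≤ t := (le_max_right _ _).trans (le_max_left _ _)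
  have h3 : 2 * u x ≤ t := le_max_right _ _
  have ht0 : 0 < t := by linarith
  have h4 := h t h1 h2 x ξ hξ (by linarith)
  have h5 : 1 / 2 ≤ 1 - u x / t := by
    have : u x / t ≤ 1 / 2 := by rw [div_le_div_iff₀ ht0 two_pos]; linarith
    linarith
  have h6 : (1 / 2 : ℝ) ^ β * dd ξ (dd ξ u) x ≤ C :=
    (mul_le_mul_of_nonneg_right (pow_le_pow_left₀ (by norm_num) h5 β) hpos.le).trans h4
  calc dd ξ (dd ξ u) x = 2 ^ β * ((1 / 2 : ℝ) ^ β * dd ξ (dd ξ u) x) := by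
        rw [← mul_assoc, ← mul_pow]; norm_num
    _ ≤ _ := mul_le_mul_of_nonneg_left h6 (by positivity)

theorem sublevel_bound_of_quadratic_growth (hu : Continuous u) {c b R : ℝ} (hc : 0 < c)
    (hb : 0 < b) (h : ∀ x, R ≤ ‖x‖ → c * ‖x‖ ^ 2 - b ≤ u x) :
    (∃ D, 0 ≤ D ∧ ∀ t, 1 ≤ t → ∀ x, u x ≤ t → ‖x‖ ^ 2 ≤ D * t) ∧ ∃ m₀, ∀ y, -m₀ ≤ u y := by
  constructor
  · refine ⟨(1 + b) / c + R ^ 2, by positivity, fun t ht x hx => ?_⟩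
    have e1 : 0 ≤ (1 + b) / c := by positivity
    rcases le_or_gt R ‖x‖ with h1 | h1
    · have h2 := h x h1
      have h3 : ‖x‖ ^ 2 ≤ (t + b) / c := by rw [le_div_iff₀ hc]; linarith
      have h4 : (t + b) / c ≤ (1 + b) / c * t := by
        rw [div_mul_eq_mul_div]
        exact div_le_div_of_nonneg_right (by nlinarith) hc.le
      nlinarith [sq_nonneg R]
    · have : ‖x‖ ^ 2 ≤ R ^ 2 := pow_le_pow_left₀ (norm_nonneg _) h1.le 2
      nlinarith [sq_nonneg R]
  · obtain ⟨M, hM⟩ := (isCompact_closedBall (0 : EuclideanSpace ℝ ι) R).bddBelow_image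
      hu.continuousOn
    refine ⟨max b (-M), fun y => ?_⟩
    rcases le_or_gt R ‖y‖ with h1 | h1
    · have h2 := h y h1
      have := le_max_left b (-M)
      have h3 : 0 ≤ c * ‖y‖ ^ 2 := by positivity
      linarith
    · have := hM ⟨y, by simpa using h1.le, rfl⟩
      have := le_max_right b (-M)
      linarith

end GlobalBound

section Elliptic
open scoped ContDiff ENNReal
open Filter Topology MeasureTheory
variable {ι : Type*} [Fintype ι] [DecidableEq ι]

/-- A smooth symmetric uniformly elliptic matrix field with divergence-free columns. -/
structure EllipticField (a : EuclideanSpace ℝ ι → Matrix ι ι ℝ) (c C : ℝ) : Prop where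
  pos : 0 < c
  smooth : ∀ i j, ContDiff ℝ ∞ fun x => a x i j
  symm : ∀ x i j, a x i j = a x j i
  lower : ∀ x (ξ : ι → ℝ), c * ∑ i, ξ i ^ 2 ≤ ∑ i, ∑ j, a x i j * ξ i * ξ j
  upper : ∀ x (ξ : ι → ℝ), ∑ i, ∑ j, a x i j * ξ i * ξ j ≤ C * ∑ i, ξ i ^ 2
  div : ∀ x j, ∑ i, dd (stdFrame ι i) (fun y => a y i j) x = 0

/-- A nonnegative smooth supersolution of the elliptic operator with coefficients `a`. -/
structure Supersolution (a : EuclideanSpace ℝ ι → Matrix ι ι ℝ)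
    (v : EuclideanSpace ℝ ι → ℝ) : Prop where
  smooth : ContDiff ℝ ∞ v
  nonneg : ∀ x, 0 ≤ v x
  le : ∀ x, ∑ i, ∑ j, a x i j * dd (stdFrame ι i) (dd (stdFrame ι j) v) x ≤ 0

variable {a : EuclideanSpace ℝ ι → Matrix ι ι ℝ} {c C : ℝ} {v : EuclideanSpace ℝ ι → ℝ}

/-- Gradient map of a paraboloid contact. -/
noncomputable def contactMap (A : ℝ) (v : EuclideanSpace ℝ ι → ℝ) (x : EuclideanSpace ℝ ι) :
    EuclideanSpace ℝ ι :=
  WithLp.toLp 2 fun i => x i + A⁻¹ * dd (stdFrame ι i) v x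

theorem hasFDerivAt_contactMap (hv : ContDiff ℝ ∞ v) (A : ℝ) (x : EuclideanSpace ℝ ι) :
    HasFDerivAt (contactMap A v)
      (Matrix.toEuclideanCLM (n := ι) (𝕜 := ℝ) (1 + A⁻¹ • hess (stdFrame ι) v x)) x := by
  rw [← hasFDerivWithinAt_univ, hasFDerivWithinAt_euclidean]
  intro i
  rw [hasFDerivWithinAt_univ]
  have h1 : HasFDerivAt (fun x : EuclideanSpace ℝ ι => x i)
      (PiLp.proj 2 (fun _ : ι => ℝ) i : EuclideanSpace ℝ ι →L[ℝ] ℝ) x :=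
    (PiLp.proj 2 (fun _ : ι => ℝ) i : EuclideanSpace ℝ ι →L[ℝ] ℝ).hasFDerivAt
  have h2 := (((hv.dd (stdFrame ι i)).differentiable (by simp)) x).hasFDerivAt
  refine (h1.add (h2.const_mul A⁻¹)).congr_fderiv ?_
  ext w
  have h3 : fderiv ℝ (dd (stdFrame ι i) v) x w =
      ∑ j, dd (stdFrame ι i) (dd (stdFrame ι j) v) x * w j := by
    change dd w (dd (stdFrame ι i) v) x = _
    rw [dd_eq_sum]
    exact Finset.sum_congr rfl fun j _ => by rw [dd_comm hv]; ring
  simp [h3, Matrix.mulVec, dotProduct, hess_apply]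

theorem det_toEuclideanCLM (M : Matrix ι ι ℝ) :
    (Matrix.toEuclideanCLM (n := ι) (𝕜 := ℝ) M).det = M.det :=
  LinearMap.det_toLpLin 2 M

theorem abs_det_contactMap_le (ha : EllipticField a c C) (hv : Supersolution a v) {A : ℝ}
    (hA : 0 < A) {x : EuclideanSpace ℝ ι}
    (hx : ∀ ξ : EuclideanSpace ℝ ι, 0 ≤ dd ξ (dd ξ v) x + A * ‖ξ‖ ^ 2) :
    |(fderiv ℝ (contactMap A v) x).det| ≤
      (Fintype.card ι * C / c) ^ Fintype.card ι := by
  rw [(hasFDerivAt_contactMap hv.smooth A x).fderiv, det_toEuclideanCLM]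
  obtain ⟨U, d, hU, hU', hH⟩ := exists_orthogonal_diagonalization
    (hess_isSymm (stdFrame ι) hv.smooth x)
  have hM : 1 + A⁻¹ • hess (stdFrame ι) v x =
      U * Matrix.diagonal (fun l => 1 + A⁻¹ * d l) * U.transpose := by
    have e : Matrix.diagonal (fun l => 1 + A⁻¹ * d l) =
        (1 : Matrix ι ι ℝ) + A⁻¹ • Matrix.diagonal d := by
      ext i j
      by_cases h : i = j <;> simp [h, Matrix.diagonal_apply]
    rw [e, Matrix.mul_add, Matrix.add_mul, mul_one, hU', hH, Matrix.mul_smul, Matrix.smul_mul]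
  have hdet : (U * Matrix.diagonal (fun l => 1 + A⁻¹ * d l) * U.transpose).det =
      ∏ l, (1 + A⁻¹ * d l) := by
    rw [Matrix.det_mul, Matrix.det_mul, mul_right_comm, ← Matrix.det_mul, hU', Matrix.det_one,
      one_mul, Matrix.det_diagonal]
  rw [hM, hdet, Finset.abs_prod, ← Finset.card_univ, ← Finset.prod_const]
  have hpos : ∀ l, 0 ≤ 1 + A⁻¹ * d l := fun l => by
    have := hx (rot (stdFrame ι) U l)
    rw [dd_rot_rot hv.smooth hU hH, if_pos rfl, norm_rot hU, one_pow, mul_one] at this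
    have h1 : 1 + A⁻¹ * d l = A⁻¹ * (d l + A) := by field_simp; ring
    rw [h1]; positivity
  have hcol : ∀ l, ∑ i, U i l ^ 2 = 1 := fun l => by
    have := congrFun (congrFun hU l) l
    rw [Matrix.mul_apply] at this
    simpa [sq] using this
  have hq : ∀ l, c ≤ ∑ i, ∑ j, a x i j * U i l * U j l ∧
      ∑ i, ∑ j, a x i j * U i l * U j l ≤ C := fun l => by
    have h1 := ha.lower x fun i => U i l
    have h2 := ha.upper x fun i => U i l
    rw [hcol, mul_one] at h1 h2
    exact ⟨h1, h2⟩
  have hL : ∑ l, d l * ∑ i, ∑ j, a x i j * U i l * U j l ≤ 0 := by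
    refine le_of_eq_of_le ?_ (hv.le x)
    simp only [Finset.mul_sum]
    rw [Finset.sum_comm]
    refine Finset.sum_congr rfl fun i _ => ?_
    rw [Finset.sum_comm]
    refine Finset.sum_congr rfl fun j _ => ?_
    rw [← hess_apply (stdFrame ι), hH, Matrix.mul_apply, Finset.mul_sum]
    exact Finset.sum_congr rfl fun l _ => by rw [Matrix.mul_diagonal, Matrix.transpose_apply]; ring
  have hsum : ∑ l, (1 + A⁻¹ * d l) * ∑ i, ∑ j, a x i j * U i l * U j l ≤ Fintype.card ι * C := by
    have e : ∑ l, (1 + A⁻¹ * d l) * ∑ i, ∑ j, a x i j * U i l * U j l =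
        ∑ l, ∑ i, ∑ j, a x i j * U i l * U j l +
        A⁻¹ * ∑ l, d l * ∑ i, ∑ j, a x i j * U i l * U j l := by
      rw [Finset.mul_sum, ← Finset.sum_add_distrib]
      exact Finset.sum_congr rfl fun l _ => by ring
    rw [e]
    have h1 : ∑ l, ∑ i, ∑ j, a x i j * U i l * U j l ≤ ∑ _l : ι, C :=
      Finset.sum_le_sum fun l _ => (hq l).2
    rw [Finset.sum_const, Finset.card_univ, nsmul_eq_mul] at h1
    have h2 := mul_nonpos_of_nonneg_of_nonpos (inv_nonneg.2 hA.le) hL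
    linarith
  refine Finset.prod_le_prod (fun _ _ => abs_nonneg _) fun l _ => ?_
  rw [abs_of_nonneg (hpos l), le_div_iff₀ ha.pos]
  refine (mul_le_mul_of_nonneg_left (hq l).1 (hpos l)).trans (le_trans ?_ hsum)
  exact Finset.single_le_sum (f := fun l => (1 + A⁻¹ * d l) * ∑ i, ∑ j, a x i j * U i l * U j l)
    (fun l _ => mul_nonneg (hpos l) (ha.pos.le.trans (hq l).1)) (Finset.mem_univ l)

/-- Measure estimate for small values of a supersolution near a point where it is small. -/
theorem volume_le_of_supersolution (ha : EllipticField a c C) (hv : Supersolution a v)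
    {ε : ℝ} (hε : 0 < ε) {x₀ : EuclideanSpace ℝ ι} (hx₀ : v x₀ ≤ ε) :
    volume (Metric.ball (0 : EuclideanSpace ℝ ι) (1 / 4)) ≤
      ENNReal.ofReal ((Fintype.card ι * C / c) ^ Fintype.card ι) *
        volume ({x | v x ≤ 2 * ε} ∩ Metric.closedBall x₀ 1) := by
  set A := 8 * ε with hA
  have hA0 : 0 < A := by positivity
  set Γ : Set (EuclideanSpace ℝ ι) := ({x | v x ≤ 2 * ε} ∩ Metric.closedBall x₀ 1) ∩
    {x | ∀ ξ : EuclideanSpace ℝ ι, 0 ≤ dd ξ (dd ξ v) x + A * ‖ξ‖ ^ 2} with hΓ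
  have hvc := hv.smooth.continuous
  have hΓc : IsClosed Γ := by
    refine ((isClosed_le hvc continuous_const).inter Metric.isClosed_closedBall).inter ?_
    rw [Set.ofPred_forall]
    exact isClosed_iInter fun ξ => isClosed_le continuous_const
      (((hv.smooth.dd ξ).dd ξ).continuous.add continuous_const)
  have hcover : Metric.ball x₀ (1 / 4) ⊆ contactMap A v '' Γ := by
    intro y hy
    have hcont : Continuous fun x => v x + A / 2 * ‖x - y‖ ^ 2 := by fun_prop
    obtain ⟨x, hx, hmin⟩ := (isCompact_closedBall x₀ 1).exists_isMinOn
      ⟨x₀, Metric.mem_closedBall_self zero_le_one⟩ hcont.continuousOn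
    have hy' : ‖x₀ - y‖ < 1 / 4 := by rw [← dist_eq_norm, dist_comm]; exact hy
    have h0 : v x + A / 2 * ‖x - y‖ ^ 2 ≤ v x₀ + A / 2 * ‖x₀ - y‖ ^ 2 :=
      hmin (Metric.mem_closedBall_self zero_le_one)
    have h1 : A / 2 * ‖x₀ - y‖ ^ 2 ≤ ε / 4 := by
      have : ‖x₀ - y‖ ^ 2 ≤ 1 / 16 := by nlinarith [norm_nonneg (x₀ - y)]
      rw [hA]; nlinarith
    have hxint : x ∈ Metric.ball x₀ 1 := by
      by_contra hxn
      rw [Metric.mem_ball, not_lt, dist_eq_norm] at hxn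
      have h2 : ‖x - x₀‖ ≤ ‖x - y‖ + ‖x₀ - y‖ := by
        rw [norm_sub_rev x₀ y]; exact norm_sub_le_norm_sub_add_norm_sub x y x₀
      have h3 : 3 / 4 < ‖x - y‖ := by linarith
      have h4 : ε * 2 < A / 2 * ‖x - y‖ ^ 2 := by
        have : 9 / 16 < ‖x - y‖ ^ 2 := by nlinarith
        rw [hA]; nlinarith
      linarith [hv.nonneg x]
    have hline : ∀ b : EuclideanSpace ℝ ι, dd b v x + A * inner ℝ (x - y) b = 0 ∧
        0 ≤ dd b (dd b v) x + A * ‖b‖ ^ 2 := by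
      intro b
      have e1 : ∀ s : ℝ, HasDerivAt (fun s : ℝ => x + s • b - y) b s := fun s => by
        simpa using (((hasDerivAt_id s).smul_const b).const_add x).sub_const y
      have e2 : ∀ s : ℝ, HasDerivAt (fun s : ℝ => -(v (x + s • b) + A / 2 * ‖x + s • b - y‖ ^ 2))
          (-(dd b v (x + s • b) + A * (inner ℝ (x - y) b + s * ‖b‖ ^ 2))) s := fun s => by
        refine ((hasDerivAt_line hv.smooth x b s).add ((e1 s).norm_sq.const_mul (A / 2))).neg.congr_deriv
          ?_
        have : x + s • b - y = (x - y) + s • b := by abel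
        rw [this, inner_add_left, real_inner_smul_left, real_inner_self_eq_norm_sq]
        ring
      have e3 : HasDerivAt (fun s : ℝ => -(dd b v (x + s • b) + A * (inner ℝ (x - y) b + s * ‖b‖ ^ 2)))
          (-(dd b (dd b v) x + A * ‖b‖ ^ 2)) 0 := by
        have h5 := hasDerivAt_line (hv.smooth.dd b) x b 0
        rw [zero_smul, add_zero] at h5
        have h6 : HasDerivAt (fun s : ℝ => A * (inner ℝ (x - y) b + s * ‖b‖ ^ 2)) (A * ‖b‖ ^ 2) 0 := by
          simpa using (((hasDerivAt_id (0 : ℝ)).mul_const (‖b‖ ^ 2)).const_add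
            (inner ℝ (x - y) b)).const_mul A
        exact (h5.add h6).neg
      have hloc : IsLocalMax (fun s : ℝ => -(v (x + s • b) + A / 2 * ‖x + s • b - y‖ ^ 2)) 0 := by
        have hc : Continuous fun s : ℝ => x + s • b := by fun_prop
        have : ∀ᶠ s in 𝓝 (0 : ℝ), x + s • b ∈ Metric.ball x₀ 1 :=
          hc.continuousAt.eventually (Metric.isOpen_ball.mem_nhds (by simpa using hxint))
        filter_upwards [this] with s hs
        have := hmin (Metric.ball_subset_closedBall hs)
        simp only [zero_smul, add_zero]
        exact neg_le_neg this
      have := hloc.second_deriv_nonpos (Eventually.of_forall e2) e3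
      simp only [zero_smul, add_zero, zero_mul] at this
      exact ⟨by linarith [this.1], by linarith [this.2]⟩
    refine ⟨x, ⟨⟨?_, hx⟩, fun ξ => (hline ξ).2⟩, ?_⟩
    · have : 0 ≤ A / 2 * ‖x - y‖ ^ 2 := by positivity
      change v x ≤ 2 * ε
      linarith
    · ext i
      have := (hline (stdFrame ι i)).1
      have e : inner ℝ (x - y) (stdFrame ι i) = x i - y i := by
        rw [stdFrame, EuclideanSpace.inner_single_right]; simp
      rw [e] at this
      change x i + A⁻¹ * dd (stdFrame ι i) v x = y i
      have h7 : dd (stdFrame ι i) v x = A * (y i - x i) := by linarith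
      rw [h7, inv_mul_cancel_left₀ hA0.ne']; ring
  calc volume (Metric.ball (0 : EuclideanSpace ℝ ι) (1 / 4))
      = volume (Metric.ball x₀ (1 / 4)) := (Measure.addHaar_ball_center volume x₀ _).symm
    _ ≤ volume (contactMap A v '' Γ) := measure_mono hcover
    _ ≤ ∫⁻ x in Γ, ENNReal.ofReal |(fderiv ℝ (contactMap A v) x).det| :=
        addHaar_image_le_lintegral_abs_det_fderiv volume hΓc.measurableSet fun x _ =>
          ((hasFDerivAt_contactMap hv.smooth A x).differentiableAt.hasFDerivAt).hasFDerivWithinAt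
    _ ≤ ∫⁻ _ in Γ, ENNReal.ofReal ((Fintype.card ι * C / c) ^ Fintype.card ι) :=
        setLIntegral_mono measurable_const fun x hx =>
          ENNReal.ofReal_le_ofReal (abs_det_contactMap_le ha hv hA0 hx.2)
    _ = ENNReal.ofReal ((Fintype.card ι * C / c) ^ Fintype.card ι) * volume Γ := by
        rw [setLIntegral_const]
    _ ≤ _ := by gcongr; exact Set.inter_subset_left

end Elliptic

section Caccioppoli
open scoped ContDiff ENNReal
open Filter Topology MeasureTheory

theorem dd_mul {E : Type*} [NormedAddCommGroup E] [NormedSpace ℝ E] {f g : E → ℝ}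
    (hf : ContDiff ℝ ∞ f) (hg : ContDiff ℝ ∞ g) (e : E) :
    dd e (fun x => f x * g x) = fun x => dd e f x * g x + f x * dd e g x := by
  funext x
  unfold dd
  rw [fderiv_fun_mul (hf.differentiable (by simp) x) (hg.differentiable (by simp) x)]
  simp only [add_apply, smul_apply, smul_eq_mul]
  ring

theorem dd_log {E : Type*} [NormedAddCommGroup E] [NormedSpace ℝ E] {f : E → ℝ}
    (hf : ContDiff ℝ ∞ f) (hpos : ∀ x, 0 < f x) (e : E) :
    dd e (fun x => Real.log (f x)) = fun x => (f x)⁻¹ * dd e f x := by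
  funext x
  unfold dd
  rw [((hf.differentiable (by simp) x).hasFDerivAt.log (hpos x).ne').fderiv]
  simp

theorem dd_inv {E : Type*} [NormedAddCommGroup E] [NormedSpace ℝ E] {f : E → ℝ}
    (hf : ContDiff ℝ ∞ f) (hpos : ∀ x, 0 < f x) (e : E) :
    dd e (fun x => (f x)⁻¹) = fun x => -((f x)⁻¹ ^ 2 * dd e f x) := by
  funext x
  unfold dd
  have := (hasDerivAt_inv (hpos x).ne').comp_hasFDerivAt x
    (hf.differentiable (by simp) x).hasFDerivAt
  rw [show (fun x => (f x)⁻¹) = Inv.inv ∘ f from rfl, this.fderiv]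
  simp

variable {ι : Type*} [Fintype ι] [DecidableEq ι]
variable {a : EuclideanSpace ℝ ι → Matrix ι ι ℝ} {c C : ℝ} {v : EuclideanSpace ℝ ι → ℝ}

theorem Supersolution.log_le (hv : Supersolution a v) {ε : ℝ} (hε : 0 < ε)
    (x : EuclideanSpace ℝ ι) :
    ∑ i, ∑ j, a x i j * dd (stdFrame ι i) (dd (stdFrame ι j) fun y => Real.log (v y + ε)) x ≤
      -∑ i, ∑ j, a x i j * dd (stdFrame ι i) (fun y => Real.log (v y + ε)) x *
        dd (stdFrame ι j) (fun y => Real.log (v y + ε)) x := by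
  have hw : ContDiff ℝ ∞ fun y => v y + ε := hv.smooth.add contDiff_const
  have hpos : ∀ y, 0 < v y + ε := fun y => by linarith [hv.nonneg y]
  have hinv : ContDiff ℝ ∞ fun y => (v y + ε)⁻¹ := hw.inv fun y => (hpos y).ne'
  have hwd : ∀ e, dd e (fun y => v y + ε) = dd e v := fun e => by
    rw [dd_add hv.smooth contDiff_const, dd_const]; simp
  have h1 : ∀ e, dd e (fun y => Real.log (v y + ε)) = fun y => (v y + ε)⁻¹ * dd e v y := fun e => by
    rw [dd_log hw hpos, hwd]
  have h2 : ∀ i j, dd (stdFrame ι i) (dd (stdFrame ι j) fun y => Real.log (v y + ε)) x =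
      (v x + ε)⁻¹ * dd (stdFrame ι i) (dd (stdFrame ι j) v) x -
      dd (stdFrame ι i) (fun y => Real.log (v y + ε)) x *
        dd (stdFrame ι j) (fun y => Real.log (v y + ε)) x := fun i j => by
    rw [h1, dd_mul hinv (hv.smooth.dd _), dd_inv hw hpos, hwd, h1]
    ring
  have h3 : ∑ i, ∑ j, a x i j *
      dd (stdFrame ι i) (dd (stdFrame ι j) fun y => Real.log (v y + ε)) x =
      (v x + ε)⁻¹ * ∑ i, ∑ j, a x i j * dd (stdFrame ι i) (dd (stdFrame ι j) v) x -
      ∑ i, ∑ j, a x i j * dd (stdFrame ι i) (fun y => Real.log (v y + ε)) x *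
        dd (stdFrame ι j) (fun y => Real.log (v y + ε)) x := by
    simp only [Finset.mul_sum, ← Finset.sum_sub_distrib]
    exact Finset.sum_congr rfl fun i _ => Finset.sum_congr rfl fun j _ => by rw [h2]; ring
  rw [h3]
  have := mul_nonpos_of_nonneg_of_nonpos (inv_nonneg.2 (hpos x).le) (hv.le x)
  linarith

theorem quadratic_young (ha : EllipticField a c C) (x : EuclideanSpace ℝ ι) (t : ℝ)
    (p q : ι → ℝ) :
    2 * t * ∑ i, ∑ j, a x i j * q i * p j - t ^ 2 * ∑ i, ∑ j, a x i j * p i * p j ≤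
      -(c / 2) * (t ^ 2 * ∑ i, p i ^ 2) + 2 * C * ∑ i, q i ^ 2 := by
  have h1 := ha.lower x fun i => t * p i - 2 * q i
  have h2 := ha.lower x p
  have h3 := ha.upper x q
  have h0 : 0 ≤ c * ∑ i, (t * p i - 2 * q i) ^ 2 :=
    mul_nonneg ha.pos.le (Finset.sum_nonneg fun _ _ => sq_nonneg _)
  have hs : ∑ i, ∑ j, a x i j * p i * q j = ∑ i, ∑ j, a x i j * q i * p j := by
    rw [Finset.sum_comm]
    exact Finset.sum_congr rfl fun i _ => Finset.sum_congr rfl fun j _ => by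
      rw [ha.symm x j i]; ring
  have e : ∑ i, ∑ j, a x i j * (t * p i - 2 * q i) * (t * p j - 2 * q j) =
      t ^ 2 * ∑ i, ∑ j, a x i j * p i * p j - 4 * t * ∑ i, ∑ j, a x i j * q i * p j +
      4 * ∑ i, ∑ j, a x i j * q i * q j := by
    have : ∑ i, ∑ j, a x i j * (t * p i - 2 * q i) * (t * p j - 2 * q j) =
      t ^ 2 * ∑ i, ∑ j, a x i j * p i * p j - 2 * t * ∑ i, ∑ j, a x i j * q i * p j -
      2 * t * ∑ i, ∑ j, a x i j * p i * q j +
      4 * ∑ i, ∑ j, a x i j * q i * q j := by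
      simp only [Finset.mul_sum, ← Finset.sum_sub_distrib, ← Finset.sum_add_distrib]
      exact Finset.sum_congr rfl fun i _ => Finset.sum_congr rfl fun j _ => by ring
    rw [this, hs]; ring
  have h4 := mul_le_mul_of_nonneg_left h2 (sq_nonneg t)
  nlinarith

theorem integral_dd_eq_zero {f : EuclideanSpace ℝ ι → ℝ} (hf : ContDiff ℝ ∞ f)
    (hc : HasCompactSupport f) (e : EuclideanSpace ℝ ι) :
    Integrable (dd e f) ∧ ∫ x, dd e f x = 0 := by
  have hi : Integrable (dd e f) :=
    (hf.dd e).continuous.integrable_of_hasCompactSupport (hc.fderiv_apply (𝕜 := ℝ) e)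
  have hi' : Integrable f := hf.continuous.integrable_of_hasCompactSupport hc
  refine ⟨hi, ?_⟩
  have := integral_mul_fderiv_eq_neg_fderiv_mul_of_integrable (μ := volume) (𝕜 := ℝ)
    (f := fun _ : EuclideanSpace ℝ ι => (1 : ℝ)) (g := f) (v := e)
    (by simp) (by simpa [dd] using! hi) (by simpa using hi')
    (fun _ _ => differentiableAt_const _) fun x _ => hf.differentiable (by simp) x
  simpa [dd] using this

theorem caccioppoli (ha : EllipticField a c C) {ψ φ : EuclideanSpace ℝ ι → ℝ}
    (hψ : ContDiff ℝ ∞ ψ) (hφ : ContDiff ℝ ∞ φ) (hc : HasCompactSupport φ)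
    (hL : ∀ x, ∑ i, ∑ j, a x i j * dd (stdFrame ι i) (dd (stdFrame ι j) ψ) x ≤
      -∑ i, ∑ j, a x i j * dd (stdFrame ι i) ψ x * dd (stdFrame ι j) ψ x) :
    c * ∫ x, φ x ^ 2 * ∑ i, dd (stdFrame ι i) ψ x ^ 2 ≤
      4 * C * ∫ x, ∑ i, dd (stdFrame ι i) φ x ^ 2 := by
  set F : ι → EuclideanSpace ℝ ι → ℝ :=
    fun i x => (φ x * φ x) * ∑ j, a x i j * dd (stdFrame ι j) ψ x with hF
  have hs : ∀ i, ContDiff ℝ ∞ fun x => ∑ j, a x i j * dd (stdFrame ι j) ψ x := fun i =>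
    ContDiff.sum fun j _ => (ha.smooth i j).mul (hψ.dd _)
  have hFs : ∀ i, ContDiff ℝ ∞ (F i) := fun i => (hφ.mul hφ).mul (hs i)
  have hFc : ∀ i, HasCompactSupport (F i) := fun i => (hc.mul_right (f' := φ)).mul_right
  have hFi := fun i => integral_dd_eq_zero (hFs i) (hFc i) (stdFrame ι i)
  have hzero : ∫ x, ∑ i, dd (stdFrame ι i) (F i) x = 0 := by
    rw [integral_finsetSum _ fun i _ => (hFi i).1]
    exact Finset.sum_eq_zero fun i _ => (hFi i).2
  have hF' : ∀ i x, dd (stdFrame ι i) (F i) x =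
      2 * φ x * ∑ j, a x i j * dd (stdFrame ι i) φ x * dd (stdFrame ι j) ψ x +
      φ x ^ 2 * (∑ j, dd (stdFrame ι i) (fun y => a y i j) x * dd (stdFrame ι j) ψ x +
        ∑ j, a x i j * dd (stdFrame ι i) (dd (stdFrame ι j) ψ) x) := fun i x => by
    rw [hF]
    simp only
    rw [dd_mul (hφ.mul hφ) (hs i), dd_mul hφ hφ,
      dd_sum _ fun j _ => (ha.smooth i j).mul (hψ.dd _)]
    simp only [dd_mul (ha.smooth i _) (hψ.dd _), Finset.sum_add_distrib]
    have : ∑ j, a x i j * dd (stdFrame ι i) φ x * dd (stdFrame ι j) ψ x =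
        dd (stdFrame ι i) φ x * ∑ j, a x i j * dd (stdFrame ι j) ψ x := by
      rw [Finset.mul_sum]; exact Finset.sum_congr rfl fun j _ => by ring
    rw [this]; ring
  have hpt : ∀ x, ∑ i, dd (stdFrame ι i) (F i) x ≤
      -(c / 2) * (φ x ^ 2 * ∑ i, dd (stdFrame ι i) ψ x ^ 2) +
        2 * C * ∑ i, dd (stdFrame ι i) φ x ^ 2 := fun x => by
    refine le_trans ?_ (quadratic_young ha x (φ x) (fun i => dd (stdFrame ι i) ψ x)
      fun i => dd (stdFrame ι i) φ x)
    simp only [hF', Finset.sum_add_distrib, ← Finset.mul_sum]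
    have hdiv : ∑ i, ∑ j, dd (stdFrame ι i) (fun y => a y i j) x * dd (stdFrame ι j) ψ x = 0 := by
      rw [Finset.sum_comm]
      refine Finset.sum_eq_zero fun j _ => ?_
      rw [← Finset.sum_mul, ha.div, zero_mul]
    rw [hdiv, zero_add]
    have := mul_le_mul_of_nonneg_left (hL x) (sq_nonneg (φ x))
    linarith
  have hi1 : Integrable fun x => φ x ^ 2 * ∑ i, dd (stdFrame ι i) ψ x ^ 2 := by
    refine Continuous.integrable_of_hasCompactSupport ?_ ?_
    · exact (hφ.continuous.pow 2).mul (continuous_finsetSum _ fun i _ => (hψ.dd _).continuous.pow 2)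
    · simp only [sq (φ _)]
      exact (hc.mul_right (f' := φ)).mul_right
  have hi2 : Integrable fun x => ∑ i, dd (stdFrame ι i) φ x ^ 2 := by
    refine integrable_finsetSum _ fun i _ => ?_
    refine ((hφ.dd _).continuous.pow 2).integrable_of_hasCompactSupport ?_
    simp only [sq]
    exact (HasCompactSupport.fderiv_apply hc (𝕜 := ℝ) (stdFrame ι i)).mul_right
  have := integral_mono (integrable_finsetSum _ fun i _ => (hFi i).1)
    ((hi1.const_mul (-(c / 2))).add (hi2.const_mul (2 * C))) hpt
  rw [hzero, integral_add' (hi1.const_mul _) (hi2.const_mul _), integral_const_mul,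
    integral_const_mul] at this
  linarith

end Caccioppoli

section Liouville
open scoped ContDiff ENNReal
open Filter Topology MeasureTheory

theorem dd_comp_smul {E : Type*} [NormedAddCommGroup E] [NormedSpace ℝ E] {f : E → ℝ}
    (hf : ContDiff ℝ ∞ f) (r : ℝ) (e : E) :
    dd e (fun x => f (r • x)) = fun x => r * dd e f (r • x) := by
  funext x
  unfold dd
  have h1 : HasFDerivAt (fun x : E => r • x) (r • ContinuousLinearMap.id ℝ E) x :=
    (hasFDerivAt_id x).const_smul r
  have h2 := (hf.differentiable (by simp) (r • x)).hasFDerivAt.comp x h1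
  rw [show (fun x => f (r • x)) = f ∘ fun x => r • x from rfl, h2.fderiv]
  simp

variable {ι : Type*} [Fintype ι] [DecidableEq ι]
variable {a : EuclideanSpace ℝ ι → Matrix ι ι ℝ} {c C : ℝ} {v : EuclideanSpace ℝ ι → ℝ}

theorem EllipticField.comp_smul (ha : EllipticField a c C) (r : ℝ) :
    EllipticField (fun x => a (r • x)) c C where
  pos := ha.pos
  smooth i j := (ha.smooth i j).comp (contDiff_id.const_smul r)
  symm x := ha.symm (r • x)
  lower x := ha.lower (r • x)
  upper x := ha.upper (r • x)
  div x j := by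
    simp only [dd_comp_smul (ha.smooth _ j)]
    rw [← Finset.mul_sum, ha.div, mul_zero]

theorem Supersolution.comp_smul (hv : Supersolution a v) (r : ℝ) :
    Supersolution (fun x => a (r • x)) fun x => v (r • x) where
  smooth := hv.smooth.comp (contDiff_id.const_smul r)
  nonneg x := hv.nonneg (r • x)
  le x := by
    have h : ∀ i j, dd (stdFrame ι i) (dd (stdFrame ι j) fun x => v (r • x)) x =
        r ^ 2 * dd (stdFrame ι i) (dd (stdFrame ι j) v) (r • x) := fun i j => by
      rw [dd_comp_smul hv.smooth,
        dd_const_mul (f := fun x => dd (stdFrame ι j) v (r • x))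
          ((hv.smooth.dd _).comp (contDiff_id.const_smul r)),
        dd_comp_smul (hv.smooth.dd _)]
      ring
    have e : ∑ i, ∑ j, a (r • x) i j * dd (stdFrame ι i) (dd (stdFrame ι j) fun x => v (r • x)) x =
        r ^ 2 * ∑ i, ∑ j, a (r • x) i j * dd (stdFrame ι i) (dd (stdFrame ι j) v) (r • x) := by
      simp only [Finset.mul_sum]
      exact Finset.sum_congr rfl fun i _ => Finset.sum_congr rfl fun j _ => by rw [h]; ring
    rw [e]
    exact mul_nonpos_of_nonneg_of_nonpos (sq_nonneg r) (hv.le _)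

theorem sq_sub_le_integral {E : Type*} [NormedAddCommGroup E] [NormedSpace ℝ E] {ψ : E → ℝ}
    (hψ : ContDiff ℝ ∞ ψ) (x h : E) :
    (ψ (x + h) - ψ x) ^ 2 ≤ ∫ s in (0 : ℝ)..1, dd h ψ (x + s • h) ^ 2 := by
  have hc : Continuous fun s : ℝ => dd h ψ (x + s • h) :=
    (hψ.dd h).continuous.comp (by fun_prop)
  have h1 : ∫ s in (0 : ℝ)..1, dd h ψ (x + s • h) = ψ (x + h) - ψ x := by
    rw [intervalIntegral.integral_eq_sub_of_hasDerivAt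
      (fun s _ => hasDerivAt_line hψ x h s) (hc.intervalIntegrable _ _)]
    simp
  set m := ψ (x + h) - ψ x
  have h2 : 0 ≤ ∫ s in (0 : ℝ)..1, (dd h ψ (x + s • h) - m) ^ 2 :=
    intervalIntegral.integral_nonneg zero_le_one fun s _ => sq_nonneg _
  have h3 : ∫ s in (0 : ℝ)..1, (dd h ψ (x + s • h) - m) ^ 2 =
      (∫ s in (0 : ℝ)..1, dd h ψ (x + s • h) ^ 2) - m ^ 2 := by
    have i1 : IntervalIntegrable (fun s : ℝ => dd h ψ (x + s • h) ^ 2) volume 0 1 :=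
      (hc.pow 2).intervalIntegrable _ _
    have i2 : IntervalIntegrable (fun s : ℝ => 2 * m * dd h ψ (x + s • h)) volume 0 1 :=
      (hc.const_mul _).intervalIntegrable _ _
    have e : (fun s : ℝ => (dd h ψ (x + s • h) - m) ^ 2) =
        fun s => (dd h ψ (x + s • h) ^ 2 - (2 * m) * dd h ψ (x + s • h)) + m ^ 2 := by
      funext s; ring
    rw [e, intervalIntegral.integral_add (i1.sub i2) intervalIntegrable_const,
      intervalIntegral.integral_sub i1 i2, intervalIntegral.integral_const_mul, h1,
      intervalIntegral.integral_const, smul_eq_mul]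
    ring
  linarith

theorem dd_sq_le (f : EuclideanSpace ℝ ι → ℝ) (h x : EuclideanSpace ℝ ι) :
    dd h f x ^ 2 ≤ ‖h‖ ^ 2 * ∑ i, dd (stdFrame ι i) f x ^ 2 := by
  rw [dd_eq_sum, EuclideanSpace.real_norm_sq_eq]
  exact Finset.sum_mul_sq_le_sq_mul_sq _ _ _

theorem ofReal_sq_sub_le {ψ φ : EuclideanSpace ℝ ι → ℝ} (hψ : ContDiff ℝ ∞ ψ)
    (hφ : Continuous φ) (hφ1 : ∀ x ∈ Metric.closedBall (0 : EuclideanSpace ℝ ι) 2, φ x = 1)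
    {x h : EuclideanSpace ℝ ι} (hx : x ∈ Metric.closedBall (0 : EuclideanSpace ℝ ι) 2)
    (hxh : x + h ∈ Metric.closedBall (0 : EuclideanSpace ℝ ι) 2) :
    ENNReal.ofReal ((ψ (x + h) - ψ x) ^ 2) ≤ ENNReal.ofReal 16 * ∫⁻ s in Set.Ioc (0 : ℝ) 1,
      ENNReal.ofReal (φ (x + s • h) ^ 2 * ∑ i, dd (stdFrame ι i) ψ (x + s • h) ^ 2) := by
  have hn : ‖h‖ ≤ 4 := by
    rw [mem_closedBall_zero_iff] at hx hxh
    have := norm_sub_le (x + h) x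
    rw [add_sub_cancel_left] at this
    linarith
  have hc : Continuous fun s : ℝ =>
      φ (x + s • h) ^ 2 * ∑ i, dd (stdFrame ι i) ψ (x + s • h) ^ 2 := by
    refine Continuous.mul ((hφ.comp (by fun_prop)).pow 2) (continuous_finsetSum _ fun i _ => ?_)
    exact ((hψ.dd _).continuous.comp (by fun_prop)).pow 2
  rw [← ofReal_integral_eq_lintegral_ofReal
    ((hc.intervalIntegrable 0 1).1) (Eventually.of_forall fun s => by
      exact mul_nonneg (sq_nonneg _) (Finset.sum_nonneg fun _ _ => sq_nonneg _)),
    ← ENNReal.ofReal_mul (by norm_num), ← intervalIntegral.integral_of_le zero_le_one]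
  refine ENNReal.ofReal_le_ofReal ((sq_sub_le_integral hψ x h).trans ?_)
  rw [← intervalIntegral.integral_const_mul]
  have hc' : Continuous fun s : ℝ => dd h ψ (x + s • h) :=
    (hψ.dd h).continuous.comp (by fun_prop)
  refine intervalIntegral.integral_mono_on zero_le_one ((hc'.pow 2).intervalIntegrable _ _)
    ((hc.const_mul _).intervalIntegrable _ _) fun s hs => ?_
  have hm : x + s • h ∈ Metric.closedBall (0 : EuclideanSpace ℝ ι) 2 := by
    have := (convex_closedBall (0 : EuclideanSpace ℝ ι) 2).add_smul_sub_mem hx hxh hs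
    rwa [add_sub_cancel_left] at this
  rw [hφ1 _ hm, one_pow, one_mul]
  refine (dd_sq_le ψ h _).trans (mul_le_mul_of_nonneg_right ?_
    (Finset.sum_nonneg fun _ _ => sq_nonneg _))
  nlinarith [norm_nonneg h]

theorem lintegral_segments {G : EuclideanSpace ℝ ι → ℝ≥0∞} (hGm : Measurable G)
    {B : Set (EuclideanSpace ℝ ι)} (hBm : MeasurableSet B) (K : ℝ≥0∞) :
    ∫⁻ x, ∫⁻ h, B.indicator (fun h => K * ∫⁻ s in Set.Ioc (0 : ℝ) 1, G (x + s • h)) h =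
      K * volume B * ∫⁻ x, G x := by
  have hm3 : Measurable fun q : (EuclideanSpace ℝ ι × EuclideanSpace ℝ ι) × ℝ =>
      G (q.1.1 + q.2 • q.1.2) := hGm.comp (by fun_prop)
  have hm2 : Measurable fun q : EuclideanSpace ℝ ι × EuclideanSpace ℝ ι =>
      ∫⁻ s in Set.Ioc (0 : ℝ) 1, G (q.1 + s • q.2) := hm3.lintegral_prod_right'
  have e1 : ∀ x : EuclideanSpace ℝ ι, ∫⁻ h,
      B.indicator (fun h => K * ∫⁻ s in Set.Ioc (0 : ℝ) 1, G (x + s • h)) h =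
      K * ∫⁻ h in B, ∫⁻ s in Set.Ioc (0 : ℝ) 1, G (x + s • h) := fun x => by
    rw [lintegral_indicator hBm]
    exact lintegral_const_mul _ (hm2.comp measurable_prodMk_left)
  have e2 : ∀ h : EuclideanSpace ℝ ι, ∫⁻ x, ∫⁻ s in Set.Ioc (0 : ℝ) 1, G (x + s • h) =
      ∫⁻ x, G x := fun h => by
    rw [lintegral_lintegral_swap]
    · have : ∀ s : ℝ, ∫⁻ x, G (x + s • h) = ∫⁻ x, G x := fun s =>
        lintegral_add_right_eq_self G (s • h)
      simp only [this, setLIntegral_const, Real.volume_Ioc]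
      simp
    · exact (hGm.comp (by fun_prop : Measurable fun q : EuclideanSpace ℝ ι × ℝ =>
        q.1 + q.2 • h)).aemeasurable
  simp only [e1]
  rw [lintegral_const_mul]
  · rw [lintegral_lintegral_swap hm2.aemeasurable]
    simp only [e2, setLIntegral_const]
    ring
  · exact Measurable.lintegral_prod_right' (f := fun q : EuclideanSpace ℝ ι × EuclideanSpace ℝ ι =>
      ∫⁻ s in Set.Ioc (0 : ℝ) 1, G (q.1 + s • q.2)) hm2

theorem poincare {ψ φ : EuclideanSpace ℝ ι → ℝ} (hψ : ContDiff ℝ ∞ ψ)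
    (hφ : Continuous φ) (hφ1 : ∀ x ∈ Metric.closedBall (0 : EuclideanSpace ℝ ι) 2, φ x = 1)
    {S₁ S₂ : Set (EuclideanSpace ℝ ι)} (hS₁ : MeasurableSet S₁) (hS₂ : MeasurableSet S₂)
    (h₁ : S₁ ⊆ Metric.closedBall 0 2) (h₂ : S₂ ⊆ Metric.closedBall 0 2) {T : ℝ}
    (hT : ∀ x ∈ S₁, ∀ y ∈ S₂, T ^ 2 ≤ (ψ y - ψ x) ^ 2) :
    ENNReal.ofReal (T ^ 2) * (volume S₁ * volume S₂) ≤
      ENNReal.ofReal 16 * volume (Metric.closedBall (0 : EuclideanSpace ℝ ι) 4) *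
        ∫⁻ x, ENNReal.ofReal (φ x ^ 2 * ∑ i, dd (stdFrame ι i) ψ x ^ 2) := by
  set G : EuclideanSpace ℝ ι → ℝ≥0∞ :=
    fun x => ENNReal.ofReal (φ x ^ 2 * ∑ i, dd (stdFrame ι i) ψ x ^ 2) with hG
  have hGm : Measurable G := by
    refine (Continuous.mul (hφ.pow 2) (continuous_finsetSum _ fun i _ => ?_)).measurable.ennreal_ofReal
    exact (hψ.dd _).continuous.pow 2
  set B := Metric.closedBall (0 : EuclideanSpace ℝ ι) 4 with hB
  have hBm : MeasurableSet B := Metric.isClosed_closedBall.measurableSet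
  have hpt : ∀ x h, S₁.indicator 1 x * (ENNReal.ofReal (T ^ 2) * S₂.indicator 1 (x + h)) ≤
      B.indicator (fun h => ENNReal.ofReal 16 * ∫⁻ s in Set.Ioc (0 : ℝ) 1, G (x + s • h)) h := by
    intro x h
    by_cases hx : x ∈ S₁
    · by_cases hxh : x + h ∈ S₂
      · have hb : h ∈ B := by
          have h3 := h₁ hx
          have h4 := h₂ hxh
          rw [mem_closedBall_zero_iff] at h3 h4
          rw [hB, mem_closedBall_zero_iff]
          have := norm_sub_le (x + h) x
          rw [add_sub_cancel_left] at this
          linarith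
        rw [Set.indicator_of_mem hx, Set.indicator_of_mem hxh, Set.indicator_of_mem hb]
        simp only [Pi.one_apply, one_mul, mul_one]
        exact (ENNReal.ofReal_le_ofReal (hT x hx _ hxh)).trans
          (ofReal_sq_sub_le hψ hφ hφ1 (h₁ hx) (h₂ hxh))
      · simp [hxh]
    · simp [hx]
  have hleft : ∫⁻ x, ∫⁻ h, S₁.indicator 1 x * (ENNReal.ofReal (T ^ 2) * S₂.indicator 1 (x + h)) =
      ENNReal.ofReal (T ^ 2) * (volume S₁ * volume S₂) := by
    have e : ∀ x : EuclideanSpace ℝ ι,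
        ∫⁻ h, S₁.indicator 1 x * (ENNReal.ofReal (T ^ 2) * S₂.indicator 1 (x + h)) =
        S₁.indicator 1 x * (ENNReal.ofReal (T ^ 2) * volume S₂) := fun x => by
      have hm : Measurable fun h => S₂.indicator (1 : EuclideanSpace ℝ ι → ℝ≥0∞) (x + h) :=
        (measurable_one.indicator hS₂).comp (measurable_const_add x)
      rw [lintegral_const_mul _ (hm.const_mul _), lintegral_const_mul _ hm,
        lintegral_add_left_eq_self (μ := volume) (S₂.indicator 1) x, lintegral_indicator_one hS₂]
    simp only [e]
    rw [lintegral_mul_const _ (measurable_one.indicator hS₁), lintegral_indicator_one hS₁]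
    ring
  rw [← hleft, ← lintegral_segments hGm hBm]
  exact lintegral_mono fun x => lintegral_mono fun h => hpt x h

end Liouville

section Liouville
open scoped ContDiff ENNReal
open Filter Topology MeasureTheory
variable {ι : Type*} [Fintype ι] [DecidableEq ι]
variable {a : EuclideanSpace ℝ ι → Matrix ι ι ℝ} {c C : ℝ} {v : EuclideanSpace ℝ ι → ℝ}

/-- The logarithm of a positive supersolution has scale-invariantly bounded oscillation on
average. -/
theorem exists_log_oscillation_bound (ι : Type*) [Fintype ι] [DecidableEq ι] (c C : ℝ) :
    ∃ K : ℝ≥0∞, K ≠ ⊤ ∧ ∀ (a : EuclideanSpace ℝ ι → Matrix ι ι ℝ) (v : EuclideanSpace ℝ ι → ℝ),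
      EllipticField a c C → Supersolution a v → ∀ ε : ℝ, 0 < ε →
      ∀ S₁ S₂ : Set (EuclideanSpace ℝ ι), MeasurableSet S₁ → MeasurableSet S₂ →
      S₁ ⊆ Metric.closedBall 0 2 → S₂ ⊆ Metric.closedBall 0 2 → ∀ T : ℝ, 0 ≤ T →
      (∀ x ∈ S₁, ∀ y ∈ S₂, T ≤ Real.log (v y + ε) - Real.log (v x + ε)) →
      ENNReal.ofReal (T ^ 2) * (volume S₁ * volume S₂) ≤ K := by
  let φ : ContDiffBump (0 : EuclideanSpace ℝ ι) := ⟨2, 3, by norm_num, by norm_num⟩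
  have hφ : ContDiff ℝ ∞ φ := φ.contDiff
  have hφc : HasCompactSupport φ := φ.hasCompactSupport
  refine ⟨ENNReal.ofReal 16 * volume (Metric.closedBall (0 : EuclideanSpace ℝ ι) 4) *
    ENNReal.ofReal (4 * C / c * ∫ x, ∑ i, dd (stdFrame ι i) φ x ^ 2),
    ENNReal.mul_ne_top (ENNReal.mul_ne_top ENNReal.ofReal_ne_top
      measure_closedBall_lt_top.ne) ENNReal.ofReal_ne_top, ?_⟩
  intro a v ha hv ε hε S₁ S₂ hS₁ hS₂ h₁ h₂ T hT hlog
  have hψ : ContDiff ℝ ∞ fun y => Real.log (v y + ε) :=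
    (hv.smooth.add contDiff_const).log fun y => by linarith [hv.nonneg y]
  have hP := poincare hψ hφ.continuous (fun x hx => φ.one_of_mem_closedBall hx) hS₁ hS₂ h₁ h₂
    (T := T) fun x hx y hy => pow_le_pow_left₀ hT (hlog x hx y hy) 2
  refine hP.trans (mul_le_mul_right ?_ _)
  have hi : Integrable fun x => φ x ^ 2 * ∑ i,
      dd (stdFrame ι i) (fun y => Real.log (v y + ε)) x ^ 2 := by
    refine Continuous.integrable_of_hasCompactSupport ?_ ?_
    · exact (hφ.continuous.pow 2).mul (continuous_finsetSum _ fun i _ => (hψ.dd _).continuous.pow 2)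
    · simp only [sq (φ _)]
      exact (hφc.mul_right (f' := φ)).mul_right
  rw [← ofReal_integral_eq_lintegral_ofReal hi (Eventually.of_forall fun x =>
    mul_nonneg (sq_nonneg _) (Finset.sum_nonneg fun _ _ => sq_nonneg _))]
  refine ENNReal.ofReal_le_ofReal ?_
  have := caccioppoli ha hψ hφ hφc (hv.log_le hε)
  rw [div_mul_eq_mul_div, le_div_iff₀ ha.pos]
  linarith

theorem Supersolution.add {w : EuclideanSpace ℝ ι → ℝ} (hv : Supersolution a v)
    (hw : Supersolution a w) : Supersolution a fun x => v x + w x where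
  smooth := hv.smooth.add hw.smooth
  nonneg x := add_nonneg (hv.nonneg x) (hw.nonneg x)
  le x := by
    have e : ∑ i, ∑ j, a x i j * dd (stdFrame ι i) (dd (stdFrame ι j) fun x => v x + w x) x =
        ∑ i, ∑ j, a x i j * dd (stdFrame ι i) (dd (stdFrame ι j) v) x +
        ∑ i, ∑ j, a x i j * dd (stdFrame ι i) (dd (stdFrame ι j) w) x := by
      simp only [← Finset.sum_add_distrib]
      refine Finset.sum_congr rfl fun i _ => Finset.sum_congr rfl fun j _ => ?_
      rw [dd_add hv.smooth hw.smooth, dd_add (hv.smooth.dd _) (hw.smooth.dd _)]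
      ring
    rw [e]
    linarith [hv.le x, hw.le x]

theorem mul_le_of_le_mul {t V M K s₁ s₂ : ℝ≥0∞} (h₁ : V ≤ M * s₁) (h₂ : V ≤ M * s₂)
    (h : t * (s₁ * s₂) ≤ K) : t * (V * V) ≤ M * M * K := by
  calc t * (V * V) ≤ t * ((M * s₁) * (M * s₂)) := by gcongr
    _ = M * M * (t * (s₁ * s₂)) := by ring
    _ ≤ M * M * K := by gcongr

theorem Supersolution.exists_add_lt [Nonempty ι] {w : EuclideanSpace ℝ ι → ℝ}
    (ha : EllipticField a c C) (hv : Supersolution a v) (hw : Supersolution a w)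
    (hv0 : ∀ ε > 0, ∃ x, v x < ε) (hw0 : ∀ ε > 0, ∃ x, w x < ε) {δ : ℝ} (hδ : 0 < δ) :
    ∃ x, v x + w x < δ := by
  by_contra hcon
  push Not at hcon
  obtain ⟨K, hK, hosc⟩ := exists_log_oscillation_bound ι c C
  set V := volume (Metric.ball (0 : EuclideanSpace ℝ ι) (1 / 4)) with hV
  have hV0 : V ≠ 0 := (Metric.measure_ball_pos _ _ (by norm_num)).ne'
  have hVt : V ≠ ⊤ := measure_ball_lt_top.ne
  set M := ENNReal.ofReal ((Fintype.card ι * C / c) ^ Fintype.card ι) with hM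
  have key : ∀ T : ℝ, 0 ≤ T → ENNReal.ofReal (T ^ 2) * (V * V) ≤ M * M * K := by
    intro T hT
    have hE : 0 < Real.exp T := Real.exp_pos T
    set ε := δ / (1 + 3 * Real.exp T) with hε
    have hε0 : 0 < ε := by positivity
    obtain ⟨x₁, hx₁⟩ := hv0 ε hε0
    obtain ⟨x₂, hx₂⟩ := hw0 ε hε0
    set r := 1 + ‖x₁‖ + ‖x₂‖ with hr
    have hr0 : 0 < r := by positivity
    have ha' := ha.comp_smul r
    have hv' := hv.comp_smul r
    have hw' := hw.comp_smul r
    have hsm : ∀ x : EuclideanSpace ℝ ι, r • r⁻¹ • x = x := fun x => by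
      rw [smul_smul, mul_inv_cancel₀ hr0.ne', one_smul]
    have hin : ∀ x : EuclideanSpace ℝ ι, ‖x‖ ≤ r →
        Metric.closedBall (r⁻¹ • x) 1 ⊆ Metric.closedBall 0 2 := by
      intro x hx
      refine Metric.closedBall_subset_closedBall' ?_
      rw [dist_zero_right, norm_smul, norm_inv, Real.norm_of_nonneg hr0.le]
      have : r⁻¹ * ‖x‖ ≤ 1 := by rw [inv_mul_le_iff₀ hr0]; linarith
      linarith
    have b1 := volume_le_of_supersolution ha' hv' hε0 (x₀ := r⁻¹ • x₁) (by
      simpa only [hsm] using hx₁.le)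
    have b2 := volume_le_of_supersolution ha' hw' hε0 (x₀ := r⁻¹ • x₂) (by
      simpa only [hsm] using hx₂.le)
    have hosc' := hosc _ _ ha' hv' ε hε0
      ({x | v (r • x) ≤ 2 * ε} ∩ Metric.closedBall (r⁻¹ • x₁) 1)
      ({x | w (r • x) ≤ 2 * ε} ∩ Metric.closedBall (r⁻¹ • x₂) 1)
      ((isClosed_le hv'.smooth.continuous continuous_const).inter
        Metric.isClosed_closedBall).measurableSet
      ((isClosed_le hw'.smooth.continuous continuous_const).inter
        Metric.isClosed_closedBall).measurableSet
      (Set.inter_subset_right.trans (hin _ (by rw [hr]; linarith [norm_nonneg x₂])))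
      (Set.inter_subset_right.trans (hin _ (by rw [hr]; linarith [norm_nonneg x₁])))
      T hT (by
        intro x hx y hy
        have h1 : v (r • x) ≤ 2 * ε := hx.1
        have h2 : w (r • y) ≤ 2 * ε := hy.1
        have h3 := hcon (r • y)
        have h4 := hv.nonneg (r • x)
        have h5 : δ = ε * (1 + 3 * Real.exp T) := by rw [hε]; field_simp
        rw [← Real.log_div (by nlinarith) (by linarith), Real.le_log_iff_exp_le (by
          refine div_pos ?_ (by linarith)
          nlinarith [mul_pos hε0 hE]), le_div_iff₀ (by linarith)]
        have h6 : Real.exp T * (v (r • x) + ε) ≤ Real.exp T * (3 * ε) :=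
          mul_le_mul_of_nonneg_left (by linarith) hE.le
        linarith)
    exact mul_le_of_le_mul b1 b2 hosc'
  have hVV : V * V ≠ 0 := mul_ne_zero hV0 hV0
  have hVVt : V * V ≠ ⊤ := ENNReal.mul_ne_top hVt hVt
  have hMK : M * M * K ≠ ⊤ :=
    ENNReal.mul_ne_top (ENNReal.mul_ne_top ENNReal.ofReal_ne_top ENNReal.ofReal_ne_top) hK
  have hq : M * M * K / (V * V) ≠ ⊤ := ENNReal.div_ne_top hMK hVV
  have h1 := key (1 + (M * M * K / (V * V)).toReal) (by positivity)
  rw [← ENNReal.le_div_iff_mul_le (Or.inl hVV) (Or.inl hVVt), ENNReal.ofReal_le_iff_le_toReal hq] at h1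
  have := ENNReal.toReal_nonneg (a := M * M * K / (V * V))
  nlinarith

/-- Finitely many nonnegative supersolutions with infimum zero are simultaneously small. -/
theorem Supersolution.exists_sum_lt [Nonempty ι] {κ : Type*} (ha : EllipticField a c C)
    (s : Finset κ) {w : κ → EuclideanSpace ℝ ι → ℝ} (hw : ∀ k ∈ s, Supersolution a (w k))
    (hw0 : ∀ k ∈ s, ∀ ε > 0, ∃ x, w k x < ε) :
    Supersolution a (fun x => ∑ k ∈ s, w k x) ∧ ∀ ε > 0, ∃ x, ∑ k ∈ s, w k x < ε := by
  classical
  induction s using Finset.induction_on with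
  | empty =>
    refine ⟨⟨by simpa using contDiff_const, by simp, fun x => ?_⟩, fun ε hε => ⟨0, by simpa using hε⟩⟩
    simp [dd_const]
  | insert k s hk ih =>
    obtain ⟨i1, i2⟩ := ih (fun l hl => hw l (Finset.mem_insert_of_mem hl))
      fun l hl => hw0 l (Finset.mem_insert_of_mem hl)
    have hk1 := hw k (Finset.mem_insert_self _ _)
    simp only [Finset.sum_insert hk]
    exact ⟨hk1.add i1, fun ε hε =>
      hk1.exists_add_lt ha i1 (hw0 k (Finset.mem_insert_self _ _)) i2 hε⟩

end Liouville

section Rigidity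
open scoped ContDiff
open Filter Topology
variable {ι : Type*} [Fintype ι] [DecidableEq ι] {α : ℝ} {m : ℕ} {u : EuclideanSpace ℝ ι → ℝ}

theorem continuous_sigF (α : ℝ) (m : ℕ) : Continuous fun A : ι → ι → ℝ => sigF α m A := by
  have h : ∀ s : Finset ι, Continuous fun A : ι → ι → ℝ => pminor s A := fun s => by
    simp only [pminor_eq_det_submatrix]
    refine Continuous.matrix_det ?_
    exact continuous_matrix fun i j => by
      simp only [Matrix.submatrix_apply, Matrix.of_apply]
      fun_prop
  have h' : ∀ k, Continuous fun A : ι → ι → ℝ => sig k A := fun k =>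
    continuous_finsetSum _ fun s _ => h s
  exact (h' _).add ((h' _).const_mul α)

/-- The linearized operator of an entire solution with bounded Hessian is uniformly elliptic. -/
theorem EntireSolution.exists_ellipticField (S : EntireSolution α m u) {L : ℝ}
    (hL : ∀ x ξ : EuclideanSpace ℝ ι, ‖ξ‖ = 1 → dd ξ (dd ξ u) x ≤ L) :
    ∃ c C, EllipticField (fun x => linF α m (hess (stdFrame ι) u x)) c C := by
  set R := max L (max 1 ((Fintype.card ι + 1) / α)) with hR
  have hR0 : 0 < R := lt_of_lt_of_le one_pos ((le_max_left _ _).trans (le_max_right _ _))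
  obtain ⟨c, hc, C, hC, hcC⟩ := exists_ellipticity ι S.pos m hR0
  have hfr : ∀ x, ∃ (U : Matrix ι ι ℝ) (d : ι → ℝ), U.transpose * U = 1 ∧
      (∀ i j, linF α m (hess (stdFrame ι) u x) i j = ∑ l, fst1 α m d l * (U i l * U j l)) ∧
      ∀ l, c ≤ fst1 α m d l ∧ fst1 α m d l ≤ C := by
    intro x
    obtain ⟨U, d, hU, hA, hg, hF⟩ := S.eigenframe x
    refine ⟨U, d, hU, linF_eq_of_diagonalization α m hU (mul_eq_one_comm.1 hU) hA,
      hcC d hg hF fun i => ?_⟩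
    have h1 := hL x (rot (stdFrame ι) U i) (norm_rot hU i)
    rw [dd_rot_rot S.smooth hU hA, if_pos rfl] at h1
    rw [abs_le]
    exact ⟨(neg_le_neg (le_max_right _ _)).trans (eigenvalue_lower_bound S.pos hg hF i),
      h1.trans (le_max_left _ _)⟩
  have hquad : ∀ (U : Matrix ι ι ℝ) (g ξ : ι → ℝ),
      ∑ i, ∑ j, (∑ l, g l * (U i l * U j l)) * ξ i * ξ j =
        ∑ l, g l * (∑ i, U i l * ξ i) ^ 2 := fun U g ξ => by
    simp only [sq, Finset.mul_sum, Finset.sum_mul]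
    conv_rhs => rw [Finset.sum_comm]
    refine Finset.sum_congr rfl fun i _ => ?_
    rw [Finset.sum_comm]
    exact Finset.sum_congr rfl fun l _ => Finset.sum_congr rfl fun j _ => by ring
  refine ⟨c, C, hc, fun i j => ?_, fun x i j => ?_, fun x ξ => ?_, fun x ξ => ?_, fun x j => ?_⟩
  · exact contDiff_linF α m (fun i j => (S.smooth.dd _).dd _) i j
  · obtain ⟨U, d, -, h, -⟩ := hfr x
    rw [h, h]
    exact Finset.sum_congr rfl fun l _ => by ring
  · obtain ⟨U, d, hU, h, hb⟩ := hfr x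
    simp only [h]
    rw [hquad, ← sum_sq_rot hU, Finset.mul_sum]
    exact Finset.sum_le_sum fun l _ => mul_le_mul_of_nonneg_right (hb l).1 (sq_nonneg _)
  · obtain ⟨U, d, hU, h, hb⟩ := hfr x
    simp only [h]
    rw [hquad, ← sum_sq_rot hU, Finset.mul_sum]
    exact Finset.sum_le_sum fun l _ => mul_le_mul_of_nonneg_right (hb l).2 (sq_nonneg _)
  · refine sum_fderiv_linF_eq_zero α m (A := fun y => hess (stdFrame ι) u y)
      (fun i j => (((S.smooth.dd _).dd _).differentiable (by simp)) x) (stdFrame ι)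
      (fun i p q => ?_) j
    change dd (stdFrame ι i) (dd (stdFrame ι p) (dd (stdFrame ι q) u)) x =
      dd (stdFrame ι p) (dd (stdFrame ι i) (dd (stdFrame ι q) u)) x
    rw [dd_comm (S.smooth.dd _)]

theorem EntireSolution.supersolution (S : EntireSolution α m u) (ξ : EuclideanSpace ℝ ι) {M : ℝ}
    (hM : ∀ x, dd ξ (dd ξ u) x ≤ M) :
    Supersolution (fun x => linF α m (hess (stdFrame ι) u x)) fun x => M - dd ξ (dd ξ u) x where
  smooth := contDiff_const.sub ((S.smooth.dd ξ).dd ξ)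
  nonneg x := sub_nonneg.2 (hM x)
  le x := by
    obtain ⟨U, d, hU, hA, hg, hF⟩ := S.eigenframe x
    rw [sum_linF_mul (stdFrame ι) hU hA (contDiff_const.sub ((S.smooth.dd ξ).dd ξ))]
    have hs := (solution_second_variation S.smooth S.pos.le S.convex S.eq hU hA ξ).2
    have h0 : 0 ≤ ∑ p ∈ Finset.univ.offDiag, snd2 α m d p.1 p.2 *
        dd ξ (dd (rot (stdFrame ι) U p.1) (dd (rot (stdFrame ι) U p.2) u)) x ^ 2 :=
      Finset.sum_nonneg fun p hp => mul_nonneg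
        (snd2_pos S.pos.le hg (Finset.mem_offDiag.1 hp).2.2).le (sq_nonneg _)
    have e : ∀ b, dd b (dd b fun x => M - dd ξ (dd ξ u) x) x = -dd ξ (dd ξ (dd b (dd b u))) x := by
      intro b
      have h1 : dd b (fun x => M - dd ξ (dd ξ u) x) = fun x => -1 * dd b (dd ξ (dd ξ u)) x := by
        rw [dd_sub contDiff_const ((S.smooth.dd ξ).dd ξ), dd_const]
        funext y; ring
      rw [h1, dd_const_mul (((S.smooth.dd ξ).dd ξ).dd b), dd_comm (S.smooth.dd ξ) b ξ,
        dd_comm S.smooth b ξ, dd_comm ((S.smooth.dd b).dd ξ) b ξ, dd_comm (S.smooth.dd b) b ξ]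
      ring
    simp only [e, mul_neg, Finset.sum_neg_distrib]
    linarith

theorem eq_quadratic_of_hess_eq (hu : ContDiff ℝ ∞ u) {A : Matrix ι ι ℝ}
    (hA : ∀ x, hess (stdFrame ι) u x = A) (x : EuclideanSpace ℝ ι) :
    u x = (1 / 2) * (∑ i, ∑ j, A i j * x i * x j) + (∑ i, dd (stdFrame ι i) u 0 * x i) + u 0 := by
  set Q := ∑ i, ∑ j, A i j * x i * x j with hQ
  have h2 : ∀ y, dd x (dd x u) y = Q := fun y => by
    rw [dd_dd_eq_sum hu, hQ]
    refine Finset.sum_congr rfl fun i _ => Finset.sum_congr rfl fun j _ => ?_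
    rw [← hess_apply, hA]; ring
  have c1 : ∀ s, dd x u (0 + s • x) = dd x u 0 + s * Q := fun s => by
    have hd : ∀ s : ℝ, HasDerivAt (fun s : ℝ => dd x u (0 + s • x) - s * Q) 0 s := fun s => by
      refine ((hasDerivAt_line (hu.dd x) 0 x s).sub ((hasDerivAt_id s).mul_const Q)).congr_deriv ?_
      rw [h2]; ring
    have := is_const_of_deriv_eq_zero (fun s => (hd s).differentiableAt)
      (fun s => (hd s).deriv) s 0
    simp only [zero_smul, zero_add, zero_mul, sub_zero] at this ⊢
    linarith
  have hd : ∀ s : ℝ, HasDerivAt (fun s : ℝ => u (0 + s • x) - (s * dd x u 0 + s ^ 2 * (Q / 2))) 0 s :=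
    fun s => by
      refine ((hasDerivAt_line hu 0 x s).sub (((hasDerivAt_id s).mul_const (dd x u 0)).add
        ((hasDerivAt_pow 2 s).mul_const (Q / 2)))).congr_deriv ?_
      rw [c1]; push_cast; ring
  have := is_const_of_deriv_eq_zero (fun s => (hd s).differentiableAt)
    (fun s => (hd s).deriv) 1 0
  simp only [zero_smul, one_smul, zero_add, zero_mul] at this
  have h3 : dd x u 0 = ∑ i, dd (stdFrame ι i) u 0 * x i := by
    rw [dd_eq_sum]; exact Finset.sum_congr rfl fun i _ => mul_comm _ _
  rw [← h3]
  linarith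

/-- An entire solution with Hessian bounded above has constant Hessian. -/
theorem EntireSolution.exists_hess_eq [Nonempty ι] (S : EntireSolution α m u) {L : ℝ}
    (hL : ∀ x ξ : EuclideanSpace ℝ ι, ‖ξ‖ = 1 → dd ξ (dd ξ u) x ≤ L) :
    ∃ A : Matrix ι ι ℝ, A.IsSymm ∧ ∀ x, hess (stdFrame ι) u x = A := by
  obtain ⟨c, C, ha⟩ := S.exists_ellipticField hL
  have hbdd : ∀ ξ : EuclideanSpace ℝ ι, BddAbove (Set.range (dd ξ (dd ξ u))) := fun ξ => by
    refine ⟨L * ‖ξ‖ ^ 2, ?_⟩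
    rintro _ ⟨x, rfl⟩
    obtain ⟨U, d, hU, hA, -, -⟩ := S.eigenframe x
    refine dd_dd_le_of_eigenvalues_le S.smooth hU hA ξ fun i => ?_
    have h1 := hL x (rot (stdFrame ι) U i) (norm_rot hU i)
    rwa [dd_rot_rot S.smooth hU hA, if_pos rfl] at h1
  set M : EuclideanSpace ℝ ι → ℝ := fun ξ => ⨆ x, dd ξ (dd ξ u) x with hM
  have hle : ∀ ξ x, dd ξ (dd ξ u) x ≤ M ξ := fun ξ x => le_ciSup (hbdd ξ) x
  have hinf : ∀ ξ, ∀ ε > 0, ∃ x, M ξ - dd ξ (dd ξ u) x < ε := fun ξ ε hε => by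
    obtain ⟨x, hx⟩ := exists_lt_of_lt_ciSup (show M ξ - ε < ⨆ x, dd ξ (dd ξ u) x by
      change M ξ - ε < M ξ; linarith)
    exact ⟨x, by linarith⟩
  have hseq : ∀ s : Finset (EuclideanSpace ℝ ι), ∃ x : ℕ → EuclideanSpace ℝ ι,
      ∀ ξ ∈ s, Tendsto (fun n => dd ξ (dd ξ u) (x n)) atTop (𝓝 (M ξ)) := fun s => by
    have h := (Supersolution.exists_sum_lt ha s (w := fun ξ x => M ξ - dd ξ (dd ξ u) x)
      (fun ξ _ => S.supersolution ξ (hle ξ)) fun ξ _ => hinf ξ).2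
    have h' : ∀ n : ℕ, ∃ x, ∑ ξ ∈ s, (M ξ - dd ξ (dd ξ u) x) < 1 / ((n : ℝ) + 1) :=
      fun n => h _ (by positivity)
    choose x hx using h'
    refine ⟨x, fun ξ hξ => ?_⟩
    have h1 : ∀ n : ℕ, M ξ - 1 / ((n : ℝ) + 1) ≤ dd ξ (dd ξ u) (x n) := fun n => by
      have := Finset.single_le_sum (f := fun ξ => M ξ - dd ξ (dd ξ u) (x n))
        (fun ξ _ => sub_nonneg.2 (hle ξ (x n))) hξ
      have h2 := hx n
      linarith
    have h2 : Tendsto (fun n : ℕ => M ξ - 1 / ((n : ℝ) + 1)) atTop (𝓝 (M ξ)) := by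
      simpa using tendsto_one_div_add_atTop_nhds_zero_nat.const_sub (M ξ)
    exact tendsto_of_tendsto_of_tendsto_of_le_of_le h2 tendsto_const_nhds h1 fun n => hle ξ _
  set e := stdFrame ι
  set A : Matrix ι ι ℝ := Matrix.of fun p q => (M (e p + e q) - M (e p) - M (e q)) / 2 with hA
  have hAs : A.IsSymm := by
    ext p q
    simp only [hA, Matrix.transpose_apply, Matrix.of_apply]
    rw [add_comm (e q)]; ring
  have hpol : ∀ x p q, hess e u x p q =
      (dd (e p + e q) (dd (e p + e q) u) x - dd (e p) (dd (e p) u) x -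
        dd (e q) (dd (e q) u) x) / 2 := fun x p q => by
    rw [dd_add_left, dd_add_left]
    simp only [dd_add (S.smooth.dd _) (S.smooth.dd _)]
    rw [hess_apply, dd_comm S.smooth (e q) (e p)]; ring
  have hlim : ∀ ξ : EuclideanSpace ℝ ι, ∃ x : ℕ → EuclideanSpace ℝ ι,
      (∀ p q, Tendsto (fun n => hess e u (x n) p q) atTop (𝓝 (A p q))) ∧
      Tendsto (fun n => dd ξ (dd ξ u) (x n)) atTop (𝓝 (M ξ)) := fun ξ => by
    obtain ⟨x, hx⟩ := hseq (insert ξ (Finset.univ.image e ∪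
      Finset.univ.image fun q : ι × ι => e q.1 + e q.2))
    refine ⟨x, fun p q => ?_, hx ξ (Finset.mem_insert_self _ _)⟩
    simp only [hpol]
    have m1 : ∀ p, Tendsto (fun n => dd (e p) (dd (e p) u) (x n)) atTop (𝓝 (M (e p))) := fun p =>
      hx _ (Finset.mem_insert_of_mem (Finset.mem_union_left _
        (Finset.mem_image_of_mem _ (Finset.mem_univ p))))
    have m2 := hx (e p + e q) (Finset.mem_insert_of_mem (Finset.mem_union_right _
      (Finset.mem_image_of_mem (fun q : ι × ι => e q.1 + e q.2) (Finset.mem_univ (p, q)))))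
    exact ((m2.sub (m1 p)).sub (m1 q)).div_const 2
  have hF : sigF α m A = 1 := by
    obtain ⟨x, hx, -⟩ := hlim 0
    have h1 : Tendsto (fun n => (hess e u (x n) : ι → ι → ℝ)) atTop (𝓝 A) :=
      tendsto_pi_nhds.2 fun p => tendsto_pi_nhds.2 fun q => hx p q
    have h2 := ((continuous_sigF α m).tendsto A).comp h1
    refine tendsto_nhds_unique h2 ?_
    exact tendsto_const_nhds.congr fun n => (S.eq (x n)).symm
  have hquad : ∀ ξ : EuclideanSpace ℝ ι, M ξ = ∑ i, ∑ j, A i j * ξ i * ξ j := fun ξ => by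
    obtain ⟨x, hx, hξ⟩ := hlim ξ
    refine tendsto_nhds_unique hξ ?_
    simp only [dd_dd_eq_sum S.smooth ξ ξ]
    refine tendsto_finsetSum _ fun i _ => tendsto_finsetSum _ fun j _ => ?_
    have := (hx i j).const_mul (ξ i * ξ j)
    rw [show A i j * ξ i * ξ j = ξ i * ξ j * A i j by ring]
    exact this
  refine ⟨A, hAs, fun x => ?_⟩
  have hP := (S.convex x).eq_zero_of_posSemidef (P := A - hess e u x) S.pos.le
    (hess_isSymm e S.smooth x) (hAs.sub (hess_isSymm e S.smooth x)) (fun ξ => ?_) ?_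
  · exact (sub_eq_zero.1 hP).symm
  · have h1 := hle (WithLp.toLp 2 ξ) x
    rw [hquad, dd_dd_eq_sum S.smooth] at h1
    rw [← sub_nonneg, ← Finset.sum_sub_distrib] at h1
    refine h1.trans_eq (Finset.sum_congr rfl fun i _ => ?_)
    rw [← Finset.sum_sub_distrib]
    refine Finset.sum_congr rfl fun j _ => ?_
    rw [Matrix.sub_apply, hess_apply]; ring
  · rw [add_sub_cancel, hF, S.eq x]

end Rigidity

theorem sigmaMat_eq_sig {n : ℕ} (k : ℕ) (A : Matrix (Fin n) (Fin n) ℝ) :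
    sigmaMat k A = sig k A :=
  Finset.sum_congr rfl fun s _ => (pminor_eq_det_submatrix s A).symm

theorem sig_zero {ι : Type*} [Fintype ι] [DecidableEq ι] (A : ι → ι → ℝ) : sig 0 A = 1 := by
  simp [sig, pminor_eq_det_submatrix]

theorem hessian_eq_hess {n : ℕ} {u : EuclideanSpace ℝ (Fin n) → ℝ}
    (hu : ContDiff ℝ (⊤ : ℕ∞) u) (x : EuclideanSpace ℝ (Fin n)) :
    hessian u x = hess (stdFrame (Fin n)) u x := by
  ext i j
  have hd : DifferentiableAt ℝ (fderiv ℝ u) x :=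
    ((hu.fderiv_right (m := (⊤ : ℕ∞)) (by simp)).differentiable (by simp)) x
  rw [hess_apply, hessian, iteratedFDeriv_two_apply]
  unfold dd
  rw [fderiv_clm_apply hd (differentiableAt_const _)]
  simp [stdFrame]

theorem rigidity_k_convex
    (n : ℕ) (hn : 2 ≤ n) (k : ℕ) (hk1 : 1 < k) (hkn : k ≤ n)
    (α : ℝ) (hα : 0 < α)
    (u : EuclideanSpace ℝ (Fin n) → ℝ)
    -- `u` is smooth on all of `ℝⁿ`
    (hu : ContDiff ℝ (⊤ : ℕ∞) u)
    -- `u` is `k`-convex on `ℝⁿ`: `λ(D²u(x)) ∈ Γ_k` for all `x`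
    (hconv : ∀ x : EuclideanSpace ℝ (Fin n), ∀ j : ℕ, 1 ≤ j → j ≤ k →
      0 < sigmaMat j (hessian u x))
    -- `u` solves `σ_k(D²u) + α σ_{k-1}(D²u) = 1` on `ℝⁿ`
    (heq : ∀ x : EuclideanSpace ℝ (Fin n),
      sigmaMat k (hessian u x) + α * sigmaMat (k - 1) (hessian u x) = 1)
    -- quadratic growth
    (hgrowth : ∃ c : ℝ, 0 < c ∧ ∃ b : ℝ, 0 < b ∧ ∃ R : ℝ, 0 < R ∧
      ∀ x : EuclideanSpace ℝ (Fin n), R ≤ ‖x‖ → c * ‖x‖ ^ 2 - b ≤ u x) :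
    -- `u` is a quadratic polynomial
    ∃ A : Matrix (Fin n) (Fin n) ℝ, A.IsSymm ∧ ∃ p : Fin n → ℝ, ∃ q : ℝ,
      ∀ x : EuclideanSpace ℝ (Fin n),
        u x = (1 / 2) * (∑ i, ∑ j, A i j * x i * x j) + (∑ i, p i * x i) + q := by
  obtain ⟨m, rfl⟩ : ∃ m, k = m + 2 := ⟨k - 2, by omega⟩
  have : Nonempty (Fin n) := ⟨⟨0, by omega⟩⟩
  obtain ⟨c, hc, b, hb, R, -, hgr⟩ := hgrowth
  have S : EntireSolution α m u := {
    pos := hα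
    smooth := hu
    convex := fun x j hj => by
      rcases Nat.eq_zero_or_pos j with rfl | h
      · exact one_pos.trans_eq (sig_zero _).symm
      · have := hconv x j h hj
        rwa [sigmaMat_eq_sig, hessian_eq_hess hu] at this
    eq := fun x => by
      have := heq x
      rwa [sigmaMat_eq_sig, sigmaMat_eq_sig, hessian_eq_hess hu] at this }
  obtain ⟨⟨D, hD, hsub⟩, m₀, hm₀⟩ := sublevel_bound_of_quadratic_growth hu.continuous hc hb hgr
  obtain ⟨L, hL⟩ := S.exists_hessian_bound hD hsub hm₀
  obtain ⟨A, hA, hess_eq⟩ := S.exists_hess_eq hL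
  exact ⟨A, hA, _, _, eq_quadratic_of_hess_eq hu hess_eq⟩
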